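/- For every integer d' ≥ 2 and s = 1 − 1/(2d'), there exist a compact set A ⊂ [1,2] and a Borel probability measure ν on ℝ whose support equals A such that ν is Ahlfors s-regular (so A has Hausdorff dimension s), the restricted maximal operator M_ν is bounded from L^p(ℝ) to L^q(ℝ) for every p > 1/s and every q with p ≤ q ≤ ps/(1−s), and for every p < 1/s and every q ∈ [1,∞], M_ν is NOT bounded from L^p(ℝ) to L^q(ℝ). In particular the threshold exponent 1/s is sharp up to the endpoint. -/

import Mathlib

open MeasureTheory Set
open scoped ENNReal

/-- The restricted maximal operator `M_ν f(x) = sup_{r ∈ [1,2]} ∫ |f(x+ry)| dν(y)`. -/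
noncomputable def restrictedMax (ν : Measure ℝ) (f : ℝ → ℝ) (x : ℝ) : ℝ :=
  ⨆ r : Icc (1 : ℝ) 2, ∫ y, |f (x + (r : ℝ) * y)| ∂ν

/-- The (topological) support of a measure on `ℝ`. -/
def msupport (ν : Measure ℝ) : Set ℝ :=
  {x | ∀ ε > 0, 0 < ν (Metric.ball x ε)}

/-- Ahlfors `s`-regularity of a measure on `ℝ`. -/
def IsAhlforsRegular (ν : Measure ℝ) (s : ℝ) : Prop :=
  ∃ C : ℝ, 1 ≤ C ∧ ∀ x ∈ msupport ν, ∀ r : ℝ, 0 < r → r ≤ 1 →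
    ENNReal.ofReal (C⁻¹ * r ^ s) ≤ ν (Icc (x - r) (x + r)) ∧
      ν (Icc (x - r) (x + r)) ≤ ENNReal.ofReal (C * r ^ s)

/-- Boundedness of the restricted maximal operator from `L^p(ℝ)` to `L^q(ℝ)`
(`q` is allowed to be `∞`). -/
def BoundedLpLq (ν : Measure ℝ) (p : ℝ) (q : ℝ≥0∞) : Prop :=
  ∃ C : ℝ, 0 ≤ C ∧ ∀ f : ℝ → ℝ, Measurable f →
    eLpNorm (restrictedMax ν f) q volume ≤
      ENNReal.ofReal C * eLpNorm f (ENNReal.ofReal p) volume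

/-- A sequence of signs. -/
def IsSigns (ε : ℕ → ℝ) : Prop := ∀ i, ε i = 1 ∨ ε i = -1

theorem IsSigns.abs_eq {ε : ℕ → ℝ} (h : IsSigns ε) (i : ℕ) : |ε i| = 1 := by
  rcases h i with h | h <;> simp [h]

theorem IsSigns.update {ε : ℕ → ℝ} (h : IsSigns ε) (m : ℕ) {v : ℝ} (hv : v = 1 ∨ v = -1) :
    IsSigns (Function.update ε m v) := by
  intro i
  by_cases hi : i = m
  · subst hi; simpa using hv
  · simpa [hi] using h i

/-- `F` is a sum of martingale differences with total variance proxy at most `V`, when the first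
`M` signs are revealed in order. -/
def IsChaos (M : ℕ) (F : (ℕ → ℝ) → ℝ) (V : ℝ) : Prop :=
  ∃ (g : ℕ → (ℕ → ℝ) → ℝ) (a : ℕ → ℝ),
    (∀ b ε ε', (∀ i < b, ε i = ε' i) → g b ε = g b ε') ∧
    (∀ b ε, IsSigns ε → |g b ε| ≤ a b) ∧
    (∀ ε, IsSigns ε → F ε = ∑ b ∈ Finset.range M, ε b * g b ε) ∧
    ∑ b ∈ Finset.range M, a b ^ 2 ≤ V

theorem exists_signs_sum_exp_le {ι : Type*} [Fintype ι] (θ : ι → ℝ)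
    (g : ι → ℕ → (ℕ → ℝ) → ℝ) (a : ι → ℕ → ℝ)
    (hdep : ∀ c b ε ε', (∀ i < b, ε i = ε' i) → g c b ε = g c b ε')
    (hb : ∀ c b ε, IsSigns ε → |g c b ε| ≤ a c b) (m : ℕ) :
    ∃ ε, IsSigns ε ∧ ∑ c, Real.exp (θ c * ∑ b ∈ Finset.range m, ε b * g c b ε -
      θ c ^ 2 / 2 * ∑ b ∈ Finset.range m, a c b ^ 2) ≤ Fintype.card ι := by
  induction m with
  | zero => exact ⟨fun _ => 1, fun _ => Or.inl rfl, by simp⟩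
  | succ m ih =>
    obtain ⟨ε, hε, hsum⟩ := ih
    set X : ι → ℝ := fun c => θ c * ∑ b ∈ Finset.range m, ε b * g c b ε -
      θ c ^ 2 / 2 * ∑ b ∈ Finset.range m, a c b ^ 2 with hX
    have key : ∀ v : ℝ, ∀ c, θ c * ∑ b ∈ Finset.range (m + 1), (Function.update ε m v) b *
        g c b (Function.update ε m v) - θ c ^ 2 / 2 * ∑ b ∈ Finset.range (m + 1), a c b ^ 2 =
        X c + (v * (θ c * g c m ε) - θ c ^ 2 / 2 * a c m ^ 2) := by
      intro v c
      have h1 : ∀ b ∈ Finset.range m, (Function.update ε m v) b * g c b (Function.update ε m v)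
          = ε b * g c b ε := by
        intro b hbm
        have hbm' := Finset.mem_range.1 hbm
        rw [Function.update_of_ne hbm'.ne, hdep c b (Function.update ε m v) ε]
        intro i hi
        rw [Function.update_of_ne (by omega)]
      have h2 : g c m (Function.update ε m v) = g c m ε :=
        hdep c m _ _ fun i hi => by rw [Function.update_of_ne (by omega)]
      rw [Finset.sum_range_succ, Finset.sum_congr rfl h1, Finset.sum_range_succ, h2,
        Function.update_self, hX]
      ring
    have hcosh : ∀ c, Real.exp (X c + (1 * (θ c * g c m ε) - θ c ^ 2 / 2 * a c m ^ 2)) +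
        Real.exp (X c + (-1 * (θ c * g c m ε) - θ c ^ 2 / 2 * a c m ^ 2)) ≤
        2 * Real.exp (X c) := by
      intro c
      have h1 := Real.cosh_le_exp_half_sq (θ c * g c m ε)
      rw [Real.cosh_eq] at h1
      have h2 : Real.exp ((θ c * g c m ε) ^ 2 / 2) ≤ Real.exp (θ c ^ 2 / 2 * a c m ^ 2) := by
        apply Real.exp_le_exp.2
        have h3 : (g c m ε) ^ 2 ≤ a c m ^ 2 := by
          rw [← sq_abs (g c m ε)]
          exact pow_le_pow_left₀ (abs_nonneg _) (hb c m ε hε) 2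
        nlinarith [sq_nonneg (θ c)]
      rw [show X c + (1 * (θ c * g c m ε) - θ c ^ 2 / 2 * a c m ^ 2) =
        X c - θ c ^ 2 / 2 * a c m ^ 2 + θ c * g c m ε by ring,
        show X c + (-1 * (θ c * g c m ε) - θ c ^ 2 / 2 * a c m ^ 2) =
        X c - θ c ^ 2 / 2 * a c m ^ 2 + -(θ c * g c m ε) by ring, Real.exp_add, Real.exp_add,
        ← mul_add]
      have h4 : Real.exp (θ c * g c m ε) + Real.exp (-(θ c * g c m ε)) ≤
          2 * Real.exp (θ c ^ 2 / 2 * a c m ^ 2) := by linarith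
      calc _ ≤ Real.exp (X c - θ c ^ 2 / 2 * a c m ^ 2) *
            (2 * Real.exp (θ c ^ 2 / 2 * a c m ^ 2)) := by gcongr
        _ = 2 * (Real.exp (X c - θ c ^ 2 / 2 * a c m ^ 2) *
            Real.exp (θ c ^ 2 / 2 * a c m ^ 2)) := by ring
        _ = 2 * Real.exp (X c) := by rw [← Real.exp_add]; ring_nf
    have htot := Finset.sum_le_sum fun c (_ : c ∈ Finset.univ) => hcosh c
    rw [Finset.sum_add_distrib, ← Finset.mul_sum] at htot
    by_cases h1 : ∑ c, Real.exp (X c + (1 * (θ c * g c m ε) - θ c ^ 2 / 2 * a c m ^ 2)) ≤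
        Fintype.card ι
    · refine ⟨_, hε.update m (Or.inl rfl), ?_⟩
      simp_rw [key]
      exact h1
    · refine ⟨_, hε.update m (Or.inr rfl), ?_⟩
      simp_rw [key]
      linarith

/-- Simultaneous concentration for finitely many sums of martingale differences. -/
theorem exists_signs_forall_abs_le {ι : Type*} [Fintype ι] (M : ℕ) (F : ι → (ℕ → ℝ) → ℝ)
    (V θ : ι → ℝ) (hF : ∀ c, IsChaos M (F c) (V c)) :
    ∃ ε, IsSigns ε ∧ ∀ c, θ c * |F c ε| ≤
      Real.log (2 * Fintype.card ι) + θ c ^ 2 / 2 * V c := by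
  choose g a hdep hb hsum hV using hF
  obtain ⟨ε, hε, h⟩ := exists_signs_sum_exp_le (ι := ι × Bool)
    (fun c => if c.2 then θ c.1 else -θ c.1) (fun c => g c.1) (fun c => a c.1)
    (fun c => hdep c.1) (fun c => hb c.1) M
  refine ⟨ε, hε, fun c => ?_⟩
  have hall : ∀ t : Bool, (if t then θ c else -θ c) * F c ε ≤
      Real.log (2 * Fintype.card ι) + θ c ^ 2 / 2 * V c := by
    intro t
    have h1 := (Finset.single_le_sum (f := fun c : ι × Bool => Real.exp
      ((if c.2 then θ c.1 else -θ c.1) * ∑ b ∈ Finset.range M, ε b * g c.1 b ε -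
      (if c.2 then θ c.1 else -θ c.1) ^ 2 / 2 * ∑ b ∈ Finset.range M, a c.1 b ^ 2))
      (fun c _ => (Real.exp_pos _).le) (Finset.mem_univ (c, t))).trans h
    have hc : 0 < Fintype.card ι := Fintype.card_pos_iff.2 ⟨c⟩
    have h2 : (if t then θ c else -θ c) ^ 2 = θ c ^ 2 := by cases t <;> simp
    simp only [h2, ← hsum c ε hε] at h1
    have hcard : ((Fintype.card (ι × Bool) : ℕ) : ℝ) = 2 * Fintype.card ι := by
      simp [Fintype.card_prod, mul_comm]
    rw [hcard] at h1
    have h3 := (Real.le_log_iff_exp_le (by positivity)).2 h1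
    nlinarith [mul_le_mul_of_nonneg_left (hV c) (sq_nonneg (θ c))]
  rcases abs_cases (F c ε) with ⟨h, _⟩ | ⟨h, _⟩ <;> rw [h]
  · simpa using hall true
  · have := hall false
    simp only [Bool.false_eq_true, if_false] at this
    linarith

/-- A multilinear integral in the signs is a sum of martingale differences. -/
theorem isChaos_integral {m : ℕ} (S : Finset (Fin m)) (b : Fin m → ℝ → ℕ)
    (hbm : ∀ i, Measurable (b i)) (w : ℝ → ℝ) (hw : Integrable w) (hS : S.Nonempty)
    (hinj : ∀ z, w z ≠ 0 → Set.InjOn (fun i => b i z) S) (M : ℕ)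
    (hM : ∀ z, w z ≠ 0 → ∀ i, b i z < M) (A : ℝ)
    (hA : ∀ c, ∫ z in {z | (S.sup fun i => b i z) = c}, |w z| ≤ A) :
    IsChaos M (fun ε => ∫ z, w z * ∏ i ∈ S, ε (b i z)) (A * ∫ z, |w z|) := by
  classical
  set top : ℝ → ℕ := fun z => S.sup fun i => b i z with htop
  have htopm : Measurable top := by
    have h : ∀ T : Finset (Fin m), Measurable fun z => T.sup fun i => b i z := by
      intro T
      induction T using Finset.induction_on with
      | empty => simp
      | insert i T _ ih =>
        simp only [Finset.sup_insert]
        exact (hbm i).max ih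
    exact h S
  have hset : ∀ c, MeasurableSet {z | top z = c} := fun c => htopm (measurableSet_singleton c)
  have hmeas : ∀ (ε : ℕ → ℝ), Measurable fun z => ∏ i ∈ S, ε (b i z) := fun ε =>
    Finset.measurable_fun_prod _ fun i _ => (measurable_from_nat (f := ε)).comp (hbm i)
  have hint : ∀ ε, IsSigns ε → Integrable fun z => w z * ∏ i ∈ S, ε (b i z) := by
    intro ε hε
    refine hw.mul_bdd (c := 1) (hmeas ε).aestronglyMeasurable (ae_of_all _ fun z => ?_)
    rw [Real.norm_eq_abs, Finset.abs_prod]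
    simp [hε.abs_eq]
  refine ⟨fun c ε => ∫ z in {z | top z = c}, w z *
    ∏ i ∈ S, if b i z = c then 1 else ε (b i z), fun c => ∫ z in {z | top z = c}, |w z|,
    ?_, ?_, ?_, ?_⟩
  · intro c ε ε' h
    apply setIntegral_congr_fun (hset c)
    intro z hz
    dsimp only
    congr 1
    apply Finset.prod_congr rfl
    intro i hi
    split_ifs with hc
    · rfl
    · have : b i z ≤ top z := Finset.le_sup (f := fun i => b i z) hi
      rw [h _ (lt_of_le_of_ne (this.trans (le_of_eq hz)) hc)]
  · intro c ε hε
    rw [← Real.norm_eq_abs]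
    refine norm_integral_le_of_norm_le hw.abs.integrableOn (ae_of_all _ fun z => ?_)
    rw [norm_mul, Real.norm_eq_abs, Real.norm_eq_abs, Finset.abs_prod,
      Finset.prod_eq_one, mul_one]
    intro i _
    split_ifs
    · simp
    · exact hε.abs_eq _
  · intro ε hε
    have h1 : ∀ c, ε c * ∫ z in {z | top z = c}, w z *
        ∏ i ∈ S, (if b i z = c then 1 else ε (b i z)) =
        ∫ z in {z | top z = c}, w z * ∏ i ∈ S, ε (b i z) := by
      intro c
      rw [← integral_const_mul]
      apply setIntegral_congr_fun (hset c)
      intro z hz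
      dsimp only
      by_cases hwz : w z = 0
      · simp [hwz]
      obtain ⟨i₀, hi₀, hi₀'⟩ := Finset.exists_mem_eq_sup S hS fun i => b i z
      have hi₁ : b i₀ z = c := by rw [← hi₀']; exact hz
      rw [← Finset.mul_prod_erase S _ hi₀, ← Finset.mul_prod_erase S (fun i => ε (b i z)) hi₀,
        if_pos hi₁, hi₁]
      have : ∏ i ∈ S.erase i₀, (if b i z = c then 1 else ε (b i z)) =
          ∏ i ∈ S.erase i₀, ε (b i z) := by
        apply Finset.prod_congr rfl
        intro i hi
        rw [if_neg]
        intro hc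
        exact (Finset.ne_of_mem_erase hi) (hinj z hwz (Finset.mem_of_mem_erase hi) hi₀
          (by simpa [hi₁] using hc))
      rw [this]; ring
    simp_rw [h1]
    rw [← integral_biUnion_finset _ (fun c _ => hset c)]
    · symm
      apply setIntegral_eq_integral_of_forall_compl_eq_zero
      intro z hz
      by_contra hne
      have hwz : w z ≠ 0 := left_ne_zero_of_mul hne
      apply hz
      simp only [Set.mem_iUnion]
      refine ⟨top z, ?_, rfl⟩
      obtain ⟨i₀, hi₀, hi₀'⟩ := Finset.exists_mem_eq_sup S hS fun i => b i z
      simp only [Finset.mem_range, htop]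
      rw [hi₀']; exact hM z hwz i₀
    · intro c _ c' _ hcc
      exact Set.disjoint_left.2 fun z hz hz' => hcc (hz.symm.trans hz')
    · exact fun c _ => (hint ε hε).integrableOn
  · have hnn : ∀ c, 0 ≤ ∫ z in {z | top z = c}, |w z| := fun c =>
      integral_nonneg fun z => abs_nonneg _
    have h1 : ∑ c ∈ Finset.range M, ∫ z in {z | top z = c}, |w z| ≤ ∫ z, |w z| := by
      rw [← integral_biUnion_finset _ (fun c _ => hset c)]
      · exact setIntegral_le_integral hw.abs (ae_of_all _ fun z => abs_nonneg _)
      · intro c _ c' _ hcc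
        exact Set.disjoint_left.2 fun z hz hz' => hcc (hz.symm.trans hz')
      · exact fun c _ => hw.abs.integrableOn
    have hA0 : 0 ≤ A := (hnn 0).trans (hA 0)
    calc _ ≤ ∑ c ∈ Finset.range M, A * ∫ z in {z | top z = c}, |w z| := by
          refine Finset.sum_le_sum fun c _ => ?_
          rw [sq]
          exact mul_le_mul_of_nonneg_right (hA c) (hnn c)
      _ ≤ _ := by
          rw [← Finset.mul_sum]
          exact mul_le_mul_of_nonneg_left h1 hA0

/-- Densities of the `k`-th stage of the construction: on each cell of length `2 ^ (-n * k)` the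
density is `0` or `2 ^ k`, and cells of every coarser generation have the expected mass. -/
structure IsLevel (n k : ℕ) (ρ : ℝ → ℝ) : Prop where
  eq_or : ∀ y, ρ y = 0 ∨ ρ y = 2 ^ k
  supp : ∀ y, y ∉ Ico (1 : ℝ) 2 → ρ y = 0
  const : ∀ y y', ⌊y * 2 ^ (n * k)⌋₊ = ⌊y' * 2 ^ (n * k)⌋₊ → ρ y = ρ y'
  mass : ∀ j ≤ k, ∀ a : ℕ, ∫ y in (a / 2 ^ (n * j) : ℝ)..((a + 1) / 2 ^ (n * j)), ρ y ≤
    2 ^ j / 2 ^ (n * j)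
  total : ∫ y, ρ y = 1

theorem measurable_of_floor {g : ℝ → ℝ} {Q : ℝ}
    (h : ∀ y y', ⌊y * Q⌋₊ = ⌊y' * Q⌋₊ → g y = g y') : Measurable g := by
  have hf : Function.FactorsThrough g fun y => ⌊y * Q⌋₊ := fun y y' hy => h y y' hy
  have : g = Function.extend (fun y => ⌊y * Q⌋₊) g 0 ∘ fun y => ⌊y * Q⌋₊ := by
    ext y
    exact (hf.extend_apply 0 y).symm
  rw [this]
  exact measurable_from_nat.comp (Nat.measurable_floor.comp (measurable_id.mul_const Q))

namespace IsLevel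

variable {n k : ℕ} {ρ : ℝ → ℝ}

theorem nonneg (h : IsLevel n k ρ) (y : ℝ) : 0 ≤ ρ y := by
  rcases h.eq_or y with h | h <;> rw [h]
  positivity

theorem le (h : IsLevel n k ρ) (y : ℝ) : ρ y ≤ 2 ^ k := by
  rcases h.eq_or y with h | h <;> rw [h]
  positivity

theorem measurable (h : IsLevel n k ρ) : Measurable ρ := measurable_of_floor h.const

theorem integrable (h : IsLevel n k ρ) : Integrable ρ := by
  have : Integrable ρ (volume.restrict (Ico 1 2)) :=
    Measure.integrableOn_of_bounded (M := 2 ^ k) (by simp) h.measurable.aestronglyMeasurable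
      (ae_of_all _ fun y => by rw [Real.norm_eq_abs, abs_of_nonneg (h.nonneg y)]; exact h.le y)
  exact (integrableOn_iff_integrable_of_support_subset fun y hy => by
    by_contra hc; exact hy (h.supp y hc)).1 this

theorem setIntegral_le_one (h : IsLevel n k ρ) (D : Set ℝ) : ∫ y in D, ρ y ≤ 1 := by
  rw [← h.total]
  exact setIntegral_le_integral h.integrable (ae_of_all _ h.nonneg)

theorem setIntegral_Icc_le (h : IsLevel n k ρ) (hn : 1 ≤ n) (u v : ℝ) :
    ∫ y in Icc u v, ρ y ≤
      2 ^ (n + 1) * max (v - u) (2 ^ (n * k))⁻¹ ^ (1 - 1 / (n : ℝ)) := by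
  set s : ℝ := 1 - 1 / (n : ℝ) with hs
  have hn' : (1 : ℝ) ≤ n := by exact_mod_cast hn
  have hs0 : 0 ≤ s := by
    have : 1 / (n : ℝ) ≤ 1 := by rw [div_le_one (by linarith)]; exact hn'
    linarith
  have hs1 : s ≤ 1 := by
    have : 0 ≤ 1 / (n : ℝ) := by positivity
    linarith
  set l := max (v - u) (2 ^ (n * k))⁻¹ with hl
  have hl0 : 0 < l := lt_of_lt_of_le (by positivity) (le_max_right _ _)
  by_cases hl1 : 1 ≤ l
  · have h1 : 1 ≤ l ^ s := Real.one_le_rpow hl1 hs0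
    have h2 : (1 : ℝ) ≤ 2 ^ (n + 1) := one_le_pow₀ (by norm_num)
    calc _ ≤ 1 := h.setIntegral_le_one _
      _ ≤ _ := by nlinarith
  push Not at hl1
  obtain ⟨m, hm1, hm2⟩ := exists_nat_pow_near_of_lt_one hl0 hl1.le
    (y := ((2 : ℝ) ^ n)⁻¹) (by positivity) (inv_lt_one_of_one_lt₀ (one_lt_pow₀ (by norm_num)
      (by omega)))
  rw [inv_pow, ← pow_mul] at hm1 hm2
  have hmk : m ≤ k := by
    have h1 := (le_max_right (v - u) ((2 : ℝ) ^ (n * k))⁻¹).trans hm2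
    rw [inv_le_inv₀ (by positivity) (by positivity)] at h1
    have := (pow_le_pow_iff_right₀ (by norm_num : (1 : ℝ) < 2)).1 h1
    exact Nat.le_of_mul_le_mul_left this (by omega)
  set Q : ℝ := 2 ^ (n * m) with hQ
  have hQ0 : 0 < Q := by positivity
  set a := ⌊u * Q⌋₊ with ha
  have hvu : v - u ≤ Q⁻¹ := (le_max_left _ _).trans hm2
  have hsub : ∫ y in Icc u v, ρ y ≤ ∫ y in Icc (a / Q) ((a + 2) / Q), ρ y := by
    rw [← integral_indicator measurableSet_Icc, ← integral_indicator measurableSet_Icc]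
    refine integral_mono (h.integrable.indicator measurableSet_Icc)
      (h.integrable.indicator measurableSet_Icc) fun y => ?_
    by_cases hy : y ∈ Icc u v
    · by_cases hy1 : y ∈ Ico (1 : ℝ) 2
      · have : y ∈ Icc (a / Q) ((a + 2) / Q) := by
          constructor
          · rw [div_le_iff₀ hQ0]
            by_cases hu : 0 ≤ u
            · exact (Nat.floor_le (by positivity)).trans (by gcongr; exact hy.1)
            · have : a = 0 := Nat.floor_of_nonpos (by nlinarith)
              rw [this]; have := hy1.1; simp; positivity
          · rw [le_div_iff₀ hQ0]
            have h1 := Nat.lt_floor_add_one (u * Q)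
            have h2 : y - u ≤ Q⁻¹ := by linarith [hy.2]
            have h3 : (y - u) * Q ≤ 1 := by
              calc _ ≤ Q⁻¹ * Q := by gcongr
                _ = 1 := inv_mul_cancel₀ hQ0.ne'
            linarith
        rw [indicator_of_mem hy, indicator_of_mem this]
      · simp only [indicator]
        rw [h.supp y hy1]; simp
    · rw [indicator_of_notMem hy]
      exact indicator_nonneg (fun y _ => h.nonneg y) y
  have hcells : ∫ y in Icc (a / Q) ((a + 2) / Q), ρ y ≤ 2 * (2 ^ m / Q) := by
    rw [integral_Icc_eq_integral_Ioc, ← intervalIntegral.integral_of_le (by gcongr; linarith),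
      ← intervalIntegral.integral_add_adjacent_intervals (b := (a + 1) / Q)
        h.integrable.intervalIntegrable h.integrable.intervalIntegrable]
    have h1 := h.mass m hmk a
    have h2 := h.mass m hmk (a + 1)
    push_cast at h2
    rw [show (a : ℝ) + 1 + 1 = a + 2 by ring] at h2
    linarith
  have hpow : (2 : ℝ) ^ m / Q = (Q⁻¹) ^ s := by
    rw [hQ, hs, ← Real.rpow_natCast, ← Real.rpow_natCast, ← Real.rpow_neg (by norm_num),
      ← Real.rpow_mul (by norm_num), ← Real.rpow_sub (by norm_num)]
    congr 1
    push_cast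
    field_simp
    ring
  have hlQ : Q⁻¹ ≤ 2 ^ n * l := by
    have h2n : (0 : ℝ) < 2 ^ n := by positivity
    have e : Q⁻¹ = 2 ^ n * (2 ^ (n * (m + 1)))⁻¹ := by
      rw [hQ, mul_add, pow_add, mul_one]
      field_simp
    rw [e]
    exact mul_le_mul_of_nonneg_left hm1.le h2n.le
  calc _ ≤ 2 * (Q⁻¹) ^ s := by rw [← hpow]; exact hsub.trans hcells
    _ ≤ 2 * (2 ^ n * l) ^ s := by gcongr
    _ = 2 * ((2 ^ n) ^ s * l ^ s) := by rw [Real.mul_rpow (by positivity) hl0.le]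
    _ ≤ 2 * (2 ^ n * l ^ s) := by
        gcongr
        exact Real.rpow_le_self_of_one_le (one_le_pow₀ (by norm_num)) hs1
    _ = _ := by ring

end IsLevel

/-- The Haar function attached to the pairs of cells of length `2 ^ (-n * (k + 1))`. -/
noncomputable def haar (n k : ℕ) (y : ℝ) : ℝ := if Even ⌊y * 2 ^ (n * (k + 1))⌋₊ then 1 else -1

/-- The index of the pair of cells of length `2 ^ (-n * (k + 1))` containing `y`. -/
noncomputable def block (n k : ℕ) (y : ℝ) : ℕ := ⌊y * 2 ^ (n * (k + 1))⌋₊ / 2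

/-- Doubling the density on one cell of each pair, and removing it from the other. -/
noncomputable def subdivide (n k : ℕ) (ρ : ℝ → ℝ) (ε : ℕ → ℝ) (y : ℝ) : ℝ :=
  ρ y * (1 + ε (block n k y) * haar n k y)

theorem abs_haar (n k : ℕ) (y : ℝ) : |haar n k y| = 1 := by
  unfold haar; split_ifs <;> simp

theorem measurable_haar (n k : ℕ) : Measurable (haar n k) :=
  measurable_of_floor fun y y' h => by unfold haar; rw [h]

theorem measurable_block (n k : ℕ) : Measurable (block n k) :=
  (measurable_from_nat (f := fun m => m / 2)).comp
    (Nat.measurable_floor.comp (measurable_id.mul_const _))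

theorem block_lt {n k : ℕ} {y : ℝ} (hy : y < 2) : block n k y < 2 ^ (n * (k + 1)) := by
  unfold block
  have hQ : (0 : ℝ) < 2 ^ (n * (k + 1)) := by positivity
  rw [Nat.div_lt_iff_lt_mul (by norm_num)]
  by_cases h0 : 0 ≤ y
  · rw [Nat.floor_lt (by positivity)]
    push_cast
    nlinarith
  · rw [Nat.floor_of_nonpos (by nlinarith)]
    positivity

theorem floor_eq_of_floor_succ_eq {n k : ℕ} {y y' : ℝ}
    (h : ⌊y * 2 ^ (n * (k + 1))⌋₊ = ⌊y' * 2 ^ (n * (k + 1))⌋₊) :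
    ⌊y * 2 ^ (n * k)⌋₊ = ⌊y' * 2 ^ (n * k)⌋₊ := by
  have key : ∀ y : ℝ, ⌊y * 2 ^ (n * k)⌋₊ = ⌊y * 2 ^ (n * (k + 1))⌋₊ / 2 ^ n := by
    intro y
    have := Nat.floor_div_natCast (y * 2 ^ (n * (k + 1))) (2 ^ n)
    rw [← this]
    congr 1
    push_cast
    rw [mul_add, pow_add, mul_one, ← mul_assoc, mul_div_assoc, div_self (by positivity), mul_one]
  rw [key, key, h]

theorem integral_cell {g : ℝ → ℝ} {Q : ℝ} (hQ : 0 < Q)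
    (h : ∀ y y', ⌊y * Q⌋₊ = ⌊y' * Q⌋₊ → g y = g y') (c : ℕ) :
    ∫ y in (c / Q : ℝ)..((c + 1) / Q), g y = g (c / Q) / Q := by
  rw [intervalIntegral.integral_of_le (by gcongr; linarith), ← integral_Ico_eq_integral_Ioc]
  rw [setIntegral_congr_fun (g := fun _ => g (c / Q)) measurableSet_Ico]
  · simp only [integral_const, MeasurableSet.univ, measureReal_restrict_apply, univ_inter,
      Real.volume_real_Ico, smul_eq_mul]
    rw [max_eq_left (by rw [sub_nonneg]; gcongr; linarith)]
    ring
  · intro y hy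
    apply h
    rw [div_mul_cancel₀ _ hQ.ne', Nat.floor_natCast, Nat.floor_eq_iff (by
      have := hy.1; have : 0 ≤ (c : ℝ) / Q := by positivity
      have : 0 ≤ y := by linarith [hy.1]
      positivity)]
    exact ⟨(div_le_iff₀ hQ).1 hy.1, (lt_div_iff₀ hQ).1 hy.2⟩

section
variable {n k : ℕ} {ρ : ℝ → ℝ} {ε : ℕ → ℝ}

theorem subdivide_eq_or (h : IsLevel n k ρ) (hε : IsSigns ε) (y : ℝ) :
    subdivide n k ρ ε y = 0 ∨ subdivide n k ρ ε y = 2 ^ (k + 1) := by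
  unfold subdivide
  have h1 : ε (block n k y) * haar n k y = 1 ∨ ε (block n k y) * haar n k y = -1 := by
    unfold haar
    rcases hε (block n k y) with h | h <;> rw [h] <;> split_ifs <;> simp
  rcases h.eq_or y with h2 | h2 <;> rcases h1 with h1 | h1 <;> rw [h1, h2] <;> norm_num [pow_succ]

theorem subdivide_const (h : IsLevel n k ρ) (y y' : ℝ)
    (hy : ⌊y * 2 ^ (n * (k + 1))⌋₊ = ⌊y' * 2 ^ (n * (k + 1))⌋₊) :
    subdivide n k ρ ε y = subdivide n k ρ ε y' := by
  unfold subdivide block haar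
  rw [hy, h.const y y' (floor_eq_of_floor_succ_eq hy)]

theorem subdivide_integrable (h : IsLevel n k ρ) (hε : IsSigns ε) :
    Integrable (subdivide n k ρ ε) := by
  refine h.integrable.mul_bdd (c := 2) ?_ (ae_of_all _ fun y => ?_)
  · exact (measurable_const.add (((measurable_from_nat (f := ε)).comp
      (measurable_block n k)).mul (measurable_haar n k))).aestronglyMeasurable
  · refine (norm_add_le _ _).trans ?_
    rw [norm_mul, Real.norm_eq_abs (ε _), hε.abs_eq, Real.norm_eq_abs (haar _ _ _), abs_haar]
    norm_num

theorem integral_subdivide (hn : 1 ≤ n) (h : IsLevel n k ρ) (hε : IsSigns ε) (a : ℕ) :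
    ∫ y in (0 : ℝ)..(a / 2 ^ (n * k)), subdivide n k ρ ε y =
      ∫ y in (0 : ℝ)..(a / 2 ^ (n * k)), ρ y := by
  set Q' : ℝ := 2 ^ (n * (k + 1)) with hQ'
  have hQ0 : 0 < Q' := by positivity
  have hpair : ∀ c : ℕ, ∫ y in (0 : ℝ)..((2 * c : ℕ) / Q'), subdivide n k ρ ε y =
      ∫ y in (0 : ℝ)..((2 * c : ℕ) / Q'), ρ y := by
    intro c
    induction c with
    | zero => simp
    | succ c ih =>
      have hi := subdivide_integrable h hε
      have e1 : (((2 * (c + 1) : ℕ)) : ℝ) / Q' = (((2 * c + 1 : ℕ) : ℝ) + 1) / Q' := by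
        push_cast; ring
      have split : ∀ g : ℝ → ℝ, Integrable g → ∫ y in (0 : ℝ)..(((2 * (c + 1) : ℕ)) / Q'), g y =
          (∫ y in (0 : ℝ)..((2 * c : ℕ) / Q'), g y) +
          ((∫ y in ((2 * c : ℕ) / Q')..(((2 * c : ℕ) + 1) / Q'), g y) +
          ∫ y in ((2 * c + 1 : ℕ) / Q')..(((2 * c + 1 : ℕ) + 1) / Q'), g y) := by
        intro g hg
        rw [e1]
        rw [← intervalIntegral.integral_add_adjacent_intervals (b := (2 * c : ℕ) / Q')
          hg.intervalIntegrable hg.intervalIntegrable]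
        congr 1
        rw [← intervalIntegral.integral_add_adjacent_intervals (b := ((2 * c : ℕ) + 1) / Q')
          hg.intervalIntegrable hg.intervalIntegrable]
        push_cast; rfl
      rw [split _ hi, split _ h.integrable, ih]
      congr 1
      have hconst : ∀ y y', ⌊y * Q'⌋₊ = ⌊y' * Q'⌋₊ → ρ y = ρ y' := fun y y' hy =>
        h.const y y' (floor_eq_of_floor_succ_eq hy)
      rw [integral_cell hQ0 (subdivide_const h), integral_cell hQ0 (subdivide_const h),
        integral_cell hQ0 hconst, integral_cell hQ0 hconst]
      have f1 : ∀ c : ℕ, ⌊(c : ℝ) / Q' * Q'⌋₊ = c := fun c => by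
        rw [div_mul_cancel₀ _ hQ0.ne', Nat.floor_natCast]
      have hρ : ρ ((2 * c : ℕ) / Q') = ρ ((2 * c + 1 : ℕ) / Q') := by
        apply h.const
        have key : ∀ d : ℕ, (d : ℝ) / Q' * 2 ^ (n * k) = (d : ℝ) / ((2 ^ n : ℕ) : ℝ) := by
          intro d
          rw [hQ', mul_add, pow_add, mul_one]
          push_cast
          field_simp
        rw [key, key, Nat.floor_div_natCast, Nat.floor_div_natCast, Nat.floor_natCast,
          Nat.floor_natCast]
        obtain ⟨m, rfl⟩ : ∃ m, n = m + 1 := ⟨n - 1, by omega⟩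
        rw [pow_succ', ← Nat.div_div_eq_div_mul, ← Nat.div_div_eq_div_mul]
        congr 1; omega
      have hb : block n k ((2 * c : ℕ) / Q') = c := by
        unfold block; rw [f1]; omega
      have hb' : block n k ((2 * c + 1 : ℕ) / Q') = c := by
        unfold block; rw [f1]; omega
      have hh : haar n k ((2 * c : ℕ) / Q') = 1 := by
        unfold haar; rw [f1]; simp
      have hh' : haar n k ((2 * c + 1 : ℕ) / Q') = -1 := by
        unfold haar; rw [f1]; simp
      unfold subdivide
      rw [hb, hb', hh, hh', ← hρ]
      ring
  obtain ⟨m, rfl⟩ : ∃ m, n = m + 1 := ⟨n - 1, by omega⟩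
  have e : (a : ℝ) / 2 ^ ((m + 1) * k) = ((2 * (2 ^ m * a) : ℕ) : ℝ) / Q' := by
    rw [hQ', mul_add (m + 1), pow_add, mul_one]
    push_cast
    field_simp
    ring
  rw [e]
  exact hpair _

theorem isLevel_subdivide (hn : 1 ≤ n) (h : IsLevel n k ρ) (hε : IsSigns ε) :
    IsLevel n (k + 1) (subdivide n k ρ ε) := by
  have hi := subdivide_integrable h hε
  have hsupp : ∀ y, y ∉ Ico (1 : ℝ) 2 → subdivide n k ρ ε y = 0 := by
    intro y hy
    unfold subdivide; rw [h.supp y hy, zero_mul]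
  refine ⟨subdivide_eq_or h hε, hsupp, subdivide_const h, ?_, ?_⟩
  · intro j hj a
    rcases Nat.lt_or_ge k j with hjk | hjk
    · obtain rfl : j = k + 1 := by omega
      have := integral_cell (by positivity) (subdivide_const (ε := ε) h) a
      rw [this]
      gcongr
      rcases subdivide_eq_or h hε ((a : ℝ) / 2 ^ (n * (k + 1))) with h | h <;> rw [h]
      positivity
    · have key : ∀ a : ℕ,
          (a : ℝ) / 2 ^ (n * j) = ((a * 2 ^ (n * (k - j)) : ℕ) : ℝ) / 2 ^ (n * k) := by
        intro a
        have : n * k = n * j + n * (k - j) := by rw [← mul_add]; congr 1; omega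
        rw [this, pow_add]
        push_cast
        field_simp
      have := h.mass j hjk a
      have e : (a : ℝ) + 1 = (a + 1 : ℕ) := by push_cast; rfl
      rw [← intervalIntegral.integral_interval_sub_left (a := 0)
        h.integrable.intervalIntegrable h.integrable.intervalIntegrable, e, key, key] at this
      rw [← intervalIntegral.integral_interval_sub_left (a := 0)
        hi.intervalIntegrable hi.intervalIntegrable, e, key, key, integral_subdivide hn h hε,
        integral_subdivide hn h hε]
      exact this
  · have key : ∀ g : ℝ → ℝ, (∀ y, y ∉ Ico (1 : ℝ) 2 → g y = 0) →
        ∫ y, g y = ∫ y in (0 : ℝ)..((2 * 2 ^ (n * k) : ℕ) / 2 ^ (n * k)), g y := by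
      intro g hg
      have : ((2 * 2 ^ (n * k) : ℕ) : ℝ) / 2 ^ (n * k) = 2 := by
        push_cast; field_simp
      rw [this, intervalIntegral.integral_of_le (by norm_num)]
      symm
      apply setIntegral_eq_integral_of_forall_compl_eq_zero
      intro y hy
      apply hg
      intro hy'
      exact hy ⟨by linarith [hy'.1], hy'.2.le⟩
    rw [key _ hsupp, integral_subdivide hn h hε, ← key _ h.supp, h.total]

theorem isLevel_zero (n : ℕ) : IsLevel n 0 (indicator (Ico (1 : ℝ) 2) 1) := by
  have hint : Integrable (indicator (Ico (1 : ℝ) 2) (1 : ℝ → ℝ)) :=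
    (integrable_indicator_iff measurableSet_Ico).2 (integrableOn_const (by simp))
  have htot : ∫ y, indicator (Ico (1 : ℝ) 2) (1 : ℝ → ℝ) y = 1 := by
    rw [integral_indicator_one measurableSet_Ico]; simp; norm_num
  refine ⟨?_, ?_, ?_, ?_, htot⟩
  · intro y
    by_cases hy : y ∈ Ico (1 : ℝ) 2 <;> simp [hy]
  · intro y hy
    simp [hy]
  · intro y y' hy
    simp only [mul_zero, pow_zero, mul_one] at hy
    have key : ∀ y : ℝ, y ∈ Ico (1 : ℝ) 2 ↔ ⌊y⌋₊ = 1 := by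
      intro y
      rw [Nat.floor_eq_iff' (by norm_num)]
      simp [mem_Ico]; norm_num
    simp only [indicator, key, hy, Pi.one_apply]
  · intro j hj a
    obtain rfl : j = 0 := by omega
    simp only [mul_zero, pow_zero, div_one]
    rw [intervalIntegral.integral_of_le (by linarith)]
    refine (setIntegral_le_integral hint (ae_of_all _ fun y => ?_)).trans htot.le
    exact indicator_nonneg (fun _ _ => zero_le_one) y

end

/-- The point `y` with `z = x + r * y`, where `P = (x, r)`. -/
noncomputable def affineCoord (P : ℝ × ℝ) (z : ℝ) : ℝ := (z - P.1) / P.2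

/-- The parameters `(x, r)` under consideration. -/
def paramBox : Set (ℝ × ℝ) := Icc (0 : ℝ) 1 ×ˢ Icc (1 : ℝ) 2

theorem measurable_affineCoord (P : ℝ × ℝ) : Measurable (affineCoord P) :=
  (measurable_id.sub_const _).div_const _

theorem integral_comp_affineCoord {P : ℝ × ℝ} (hP : 0 < P.2) (g : ℝ → ℝ) :
    ∫ z, g (affineCoord P z) = P.2 * ∫ y, g y := by
  unfold affineCoord
  rw [integral_sub_right_eq_self (fun z => g (z / P.2)) P.1, Measure.integral_comp_div,
    abs_of_pos hP, smul_eq_mul]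

theorem integrable_comp_affineCoord {P : ℝ × ℝ} (hP : 0 < P.2) {g : ℝ → ℝ} (hg : Integrable g) :
    Integrable fun z => g (affineCoord P z) := by
  unfold affineCoord
  exact (hg.comp_div hP.ne').comp_sub_right P.1

theorem affineCoord_le_iff {P : ℝ × ℝ} (hP : 0 < P.2) {z t : ℝ} :
    affineCoord P z ≤ t ↔ z ≤ P.1 + P.2 * t := by
  unfold affineCoord
  rw [div_le_iff₀ hP]
  constructor <;> intro h <;> linarith

theorem le_affineCoord_iff {P : ℝ × ℝ} (hP : 0 < P.2) {z t : ℝ} :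
    t ≤ affineCoord P z ↔ P.1 + P.2 * t ≤ z := by
  unfold affineCoord
  rw [le_div_iff₀ hP]
  constructor <;> intro h <;> linarith

theorem setIntegral_comp_affineCoord_le {P : ℝ × ℝ} (hP : 0 < P.2) {g : ℝ → ℝ}
    (hg : Integrable g) (h0 : ∀ y, 0 ≤ g y) {D : Set ℝ} (hD : MeasurableSet D) {u v : ℝ}
    (h : ∀ z ∈ D, affineCoord P z ∈ Icc u v) :
    ∫ z in D, g (affineCoord P z) ≤ P.2 * ∫ y in Icc u v, g y := by
  rw [← integral_indicator (s := Icc u v) measurableSet_Icc,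
    ← integral_comp_affineCoord hP, ← integral_indicator hD]
  refine integral_mono ((integrable_comp_affineCoord hP hg).indicator hD)
    (integrable_comp_affineCoord hP (hg.indicator measurableSet_Icc)) fun z => ?_
  by_cases hz : z ∈ D
  · simp [hz, indicator_of_mem (h z hz)]
  · rw [indicator_of_notMem hz]
    exact indicator_nonneg (fun y _ => h0 y) _

theorem exists_Icc_of_close {P P' : ℝ × ℝ} (hP : P.2 ∈ Icc (1 : ℝ) 2) (hP' : P'.2 ∈ Icc (1 : ℝ) 2)
    {τ δ : ℝ} (hτ : 0 < τ) (hδ : 0 ≤ δ) (hsep : τ ≤ |P.1 - P'.1|) :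
    ∃ u v : ℝ, u ≤ v ∧ v - u ≤ 64 * δ / τ ∧ ∀ z, affineCoord P z ∈ Icc (1 : ℝ) 2 →
      |affineCoord P z - affineCoord P' z| ≤ 2 * δ → affineCoord P z ∈ Icc u v := by
  have hid : ∀ z, P.1 - P'.1 + (P.2 - P'.2) * affineCoord P z =
      P'.2 * (affineCoord P' z - affineCoord P z) := by
    intro z
    have h1 : P.2 ≠ 0 := by linarith [hP.1]
    have h2 : P'.2 ≠ 0 := by linarith [hP'.1]
    unfold affineCoord
    field_simp
    ring
  have hsmall : ∀ z, |affineCoord P z - affineCoord P' z| ≤ 2 * δ →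
      |P.1 - P'.1 + (P.2 - P'.2) * affineCoord P z| ≤ 4 * δ := by
    intro z hz
    rw [hid, abs_mul, abs_sub_comm, abs_of_pos (by linarith [hP'.1] : 0 < P'.2)]
    nlinarith [hP'.2, abs_nonneg (affineCoord P z - affineCoord P' z)]
  have key : ∀ z w, affineCoord P z ∈ Icc (1 : ℝ) 2 → affineCoord P w ∈ Icc (1 : ℝ) 2 →
      |affineCoord P z - affineCoord P' z| ≤ 2 * δ →
      |affineCoord P w - affineCoord P' w| ≤ 2 * δ →
      |affineCoord P z - affineCoord P w| ≤ 32 * δ / τ := by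
    intro z w hz hw hz' hw'
    have h1 := hsmall z hz'
    have h2 := hsmall w hw'
    rw [le_div_iff₀ hτ]
    by_cases hr : τ / 4 ≤ |P.2 - P'.2|
    · have h3 : |P.2 - P'.2| * |affineCoord P z - affineCoord P w| ≤ 8 * δ := by
        rw [← abs_mul]
        calc _ = |(P.1 - P'.1 + (P.2 - P'.2) * affineCoord P z) -
              (P.1 - P'.1 + (P.2 - P'.2) * affineCoord P w)| := by congr 1; ring
          _ ≤ _ := (abs_sub _ _).trans (by linarith)
      nlinarith [abs_nonneg (affineCoord P z - affineCoord P w)]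
    · push Not at hr
      have h3 : |P.1 - P'.1| ≤ 4 * δ + τ / 4 * 2 := by
        calc _ = |(P.1 - P'.1 + (P.2 - P'.2) * affineCoord P z) -
              (P.2 - P'.2) * affineCoord P z| := by congr 1; ring
          _ ≤ 4 * δ + |(P.2 - P'.2) * affineCoord P z| := (abs_sub _ _).trans (by linarith)
          _ ≤ _ := by
            rw [abs_mul, abs_of_pos (by linarith [hz.1] : 0 < affineCoord P z)]
            have := hz.1
            gcongr
            exact hz.2
      have h4 : |affineCoord P z - affineCoord P w| ≤ 1 := by
        rw [abs_le]; constructor <;> linarith [hz.1, hz.2, hw.1, hw.2]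
      nlinarith [abs_nonneg (affineCoord P z - affineCoord P w)]
  by_cases hne : ∃ z, affineCoord P z ∈ Icc (1 : ℝ) 2 ∧
      |affineCoord P z - affineCoord P' z| ≤ 2 * δ
  · obtain ⟨z, hz, hz'⟩ := hne
    refine ⟨affineCoord P z - 32 * δ / τ, affineCoord P z + 32 * δ / τ, ?_, ?_, ?_⟩
    · have : 0 ≤ 32 * δ / τ := by positivity
      linarith
    · apply le_of_eq; ring
    · intro w hw hw'
      have := abs_le.1 (key z w hz hw hz' hw')
      constructor <;> linarith [this.1, this.2]
  · push Not at hne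
    refine ⟨0, 0, le_rfl, by rw [sub_zero]; positivity, fun z hz hz' => ?_⟩
    exact absurd hz' (not_le.2 (hne z hz))

theorem IsLevel.setIntegral_close_le {n k : ℕ} {ρ : ℝ → ℝ} (h : IsLevel n k ρ) (hn : 1 ≤ n)
    {P P' : ℝ × ℝ} (hP : P.2 ∈ Icc (1 : ℝ) 2) (hP' : P'.2 ∈ Icc (1 : ℝ) 2)
    {τ δ R : ℝ} (hτ : 0 < τ) (hδ : 0 ≤ δ) (hRk : (2 ^ (n * k))⁻¹ ≤ R) (hR : 64 * δ / τ ≤ R)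
    (hsep : τ ≤ |P.1 - P'.1|) {D : Set ℝ} (hD : MeasurableSet D)
    (hDc : ∀ z ∈ D, |affineCoord P z - affineCoord P' z| ≤ 2 * δ) :
    ∫ z in D, ρ (affineCoord P z) ≤ 2 ^ (n + 2) * R ^ (1 - 1 / (n : ℝ)) := by
  obtain ⟨u, v, huv, hlen, hmem⟩ := exists_Icc_of_close hP hP' hτ hδ hsep
  set D' := D ∩ affineCoord P ⁻¹' (Icc 1 2) with hD'
  have hD'm : MeasurableSet D' := hD.inter (measurable_affineCoord P measurableSet_Icc)
  have hP0 : 0 < P.2 := by linarith [hP.1]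
  have hs : 0 ≤ 1 - 1 / (n : ℝ) := by
    have : 1 / (n : ℝ) ≤ 1 := by
      rw [div_le_one (by positivity)]; exact_mod_cast hn
    linarith
  have h1 : ∫ z in D, ρ (affineCoord P z) = ∫ z in D', ρ (affineCoord P z) := by
    rw [← integral_indicator hD, ← integral_indicator hD'm]
    congr 1
    ext z
    by_cases hz : affineCoord P z ∈ Icc (1 : ℝ) 2
    · by_cases hzD : z ∈ D
      · rw [indicator_of_mem hzD, indicator_of_mem (show z ∈ D' from ⟨hzD, hz⟩)]
      · rw [indicator_of_notMem hzD, indicator_of_notMem fun h => hzD h.1]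
    · have : ρ (affineCoord P z) = 0 := h.supp _ fun hc => hz ⟨hc.1, hc.2.le⟩
      simp [indicator, this]
  have h2 := setIntegral_comp_affineCoord_le hP0 h.integrable h.nonneg hD'm
    (fun z hz => hmem z hz.2 (hDc z hz.1))
  have h3 := h.setIntegral_Icc_le hn u v
  rw [h1]
  refine h2.trans ?_
  calc P.2 * ∫ y in Icc u v, ρ y
      ≤ 2 * (2 ^ (n + 1) * max (v - u) (2 ^ (n * k))⁻¹ ^ (1 - 1 / (n : ℝ))) := by
        refine mul_le_mul hP.2 h3 (setIntegral_nonneg measurableSet_Icc fun y _ => h.nonneg y)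
          (by norm_num)
    _ ≤ 2 * (2 ^ (n + 1) * R ^ (1 - 1 / (n : ℝ))) := by
        gcongr
        exact max_le (hlen.trans hR) hRk
    _ = _ := by ring

theorem abs_prod_sub_prod_le {ι : Type*} (S : Finset ι) (a b : ι → ℝ) {B : ℝ}
    (hB : 1 ≤ B) (ha : ∀ i, |a i| ≤ B) (hb : ∀ i, |b i| ≤ B) :
    |∏ i ∈ S, a i - ∏ i ∈ S, b i| ≤ B ^ S.card * ∑ i ∈ S, |a i - b i| := by
  classical
  induction S using Finset.induction_on with
  | empty => simp
  | insert i S hi ih =>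
    rw [Finset.prod_insert hi, Finset.prod_insert hi, Finset.card_insert_of_notMem hi,
      Finset.sum_insert hi]
    have hA : |∏ i ∈ S, a i| ≤ B ^ S.card := by
      rw [Finset.abs_prod]
      exact (Finset.prod_le_prod (fun _ _ => abs_nonneg _) fun i _ => ha i).trans (by simp)
    have e : a i * ∏ i ∈ S, a i - b i * ∏ i ∈ S, b i =
        (a i - b i) * ∏ i ∈ S, a i + b i * (∏ i ∈ S, a i - ∏ i ∈ S, b i) := by ring
    rw [e]
    refine (abs_add_le _ _).trans ?_
    rw [abs_mul, abs_mul, pow_succ, mul_add]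
    have hBS : 0 ≤ B ^ S.card := by positivity
    have hs : 0 ≤ ∑ i ∈ S, |a i - b i| := Finset.sum_nonneg fun _ _ => abs_nonneg _
    have h1 : |a i - b i| * |∏ i ∈ S, a i| ≤ B ^ S.card * B * |a i - b i| := by
      have : |a i - b i| * |∏ i ∈ S, a i| ≤ |a i - b i| * B ^ S.card := by gcongr
      have h2 : |a i - b i| * B ^ S.card ≤ |a i - b i| * B ^ S.card * B :=
        le_mul_of_one_le_right (by positivity) hB
      linarith
    have h2 : |b i| * |∏ i ∈ S, a i - ∏ i ∈ S, b i| ≤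
        B * (B ^ S.card * ∑ i ∈ S, |a i - b i|) :=
      mul_le_mul (hb i) ih (abs_nonneg _) (by linarith)
    linarith

theorem integral_abs_sub_comp_affineCoord_le {g : ℝ → ℝ} {Q : ℕ} (hQ : 0 < Q)
    (hconst : ∀ y y' : ℝ, ⌊y * Q⌋₊ = ⌊y' * Q⌋₊ → g y = g y')
    (hsupp : ∀ y, y ∉ Ico (1 : ℝ) 2 → g y = 0) {B : ℝ} (hB : ∀ y, |g y| ≤ B)
    (hg : Integrable g) {P P' : ℝ × ℝ} (hP : 0 < P.2) (hP' : 0 < P'.2) {η : ℝ}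
    (h1 : |P.1 - P'.1| ≤ η) (h2 : |P.2 - P'.2| ≤ η) :
    ∫ z, |g (affineCoord P z) - g (affineCoord P' z)| ≤ 2 * B * ((Q + 1) * (3 * η)) := by
  have hη : 0 ≤ η := (abs_nonneg _).trans h1
  have hB0 : 0 ≤ B := (abs_nonneg _).trans (hB 0)
  have hQ0 : (0 : ℝ) < Q := by exact_mod_cast hQ
  set J : ℕ → Set ℝ := fun a => uIcc (P.1 + P.2 * (a / Q)) (P'.1 + P'.2 * (a / Q)) with hJ
  have hpt : ∀ z, |g (affineCoord P z) - g (affineCoord P' z)| ≤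
      ∑ a ∈ Finset.Icc Q (2 * Q), (J a).indicator (fun _ => 2 * B) z := by
    intro z
    have hnn : ∀ a ∈ Finset.Icc Q (2 * Q), 0 ≤ (J a).indicator (fun _ => 2 * B) z := fun a _ =>
      indicator_nonneg (fun _ _ => by positivity) z
    by_cases heq : g (affineCoord P z) = g (affineCoord P' z)
    · rw [heq, sub_self, abs_zero]
      exact Finset.sum_nonneg hnn
    have hfl : ⌊affineCoord P z * Q⌋₊ ≠ ⌊affineCoord P' z * Q⌋₊ := fun h => heq (hconst _ _ h)
    have main : ∀ y y' : ℝ, y ∈ Ico (1 : ℝ) 2 → ⌊y * Q⌋₊ ≠ ⌊y' * Q⌋₊ →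
        ∃ a ∈ Finset.Icc Q (2 * Q), (y ≤ a / Q ∧ a / Q ≤ y') ∨ (y' ≤ a / Q ∧ a / Q ≤ y) := by
      intro y y' hy hne
      have hl : Q ≤ ⌊y * Q⌋₊ := Nat.le_floor (by nlinarith [hy.1])
      have hu : ⌊y * Q⌋₊ < 2 * Q := by
        rw [Nat.floor_lt (by nlinarith [hy.1])]; push_cast; nlinarith [hy.2]
      have hy0 : 0 ≤ y := by linarith [hy.1]
      rcases lt_or_gt_of_ne hne with hlt | hlt
      · refine ⟨⌊y * Q⌋₊ + 1, by simp; omega, Or.inl ⟨?_, ?_⟩⟩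
        · rw [le_div_iff₀ hQ0]; push_cast; exact (Nat.lt_floor_add_one _).le
        · rw [div_le_iff₀ hQ0]
          have := Nat.succ_le_of_lt hlt
          exact (Nat.le_floor_iff' (by omega)).1 this
      · refine ⟨⌊y * Q⌋₊, by simp; omega, Or.inr ⟨?_, ?_⟩⟩
        · rw [le_div_iff₀ hQ0]; exact ((Nat.floor_lt' (by omega)).1 hlt).le
        · rw [div_le_iff₀ hQ0]; exact Nat.floor_le (by positivity)
    have hex : ∃ a ∈ Finset.Icc Q (2 * Q), z ∈ J a := by
      have : ∃ a ∈ Finset.Icc Q (2 * Q),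
          (affineCoord P z ≤ a / Q ∧ a / Q ≤ affineCoord P' z) ∨
          (affineCoord P' z ≤ a / Q ∧ a / Q ≤ affineCoord P z) := by
        by_cases hy : affineCoord P z ∈ Ico (1 : ℝ) 2
        · exact main _ _ hy hfl
        · by_cases hy' : affineCoord P' z ∈ Ico (1 : ℝ) 2
          · obtain ⟨a, ha, h⟩ := main _ _ hy' hfl.symm
            exact ⟨a, ha, h.symm⟩
          · exact absurd ((hsupp _ hy).trans (hsupp _ hy').symm) heq
      obtain ⟨a, ha, h⟩ := this
      refine ⟨a, ha, ?_⟩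
      rw [affineCoord_le_iff hP, le_affineCoord_iff hP', affineCoord_le_iff hP',
        le_affineCoord_iff hP] at h
      rw [hJ, mem_uIcc]
      tauto
    obtain ⟨a, ha, hz⟩ := hex
    have hB1 := hB (affineCoord P z)
    have hB2 := hB (affineCoord P' z)
    calc _ ≤ 2 * B := (abs_sub _ _).trans (by linarith)
      _ = (J a).indicator (fun _ => 2 * B) z := by rw [indicator_of_mem hz]
      _ ≤ _ := Finset.single_le_sum hnn ha
  have hJint : ∀ a, Integrable ((J a).indicator fun _ => 2 * B) := fun a =>
    (integrable_indicator_iff measurableSet_uIcc).2 (integrableOn_const (by simp [uIcc]))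
  calc _ ≤ ∫ z, ∑ a ∈ Finset.Icc Q (2 * Q), (J a).indicator (fun _ => 2 * B) z :=
        integral_mono ((integrable_comp_affineCoord hP hg).sub
          (integrable_comp_affineCoord hP' hg)).abs
          (integrable_finsetSum _ fun a _ => hJint a) hpt
    _ = ∑ a ∈ Finset.Icc Q (2 * Q), ∫ z, (J a).indicator (fun _ => 2 * B) z :=
        integral_finsetSum _ fun a _ => hJint a
    _ ≤ ∑ a ∈ Finset.Icc Q (2 * Q), 2 * B * (3 * η) := by
        refine Finset.sum_le_sum fun a ha => ?_
        rw [integral_indicator_const _ measurableSet_uIcc, smul_eq_mul, mul_comm]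
        gcongr
        rw [Measure.real, Real.volume_interval, ENNReal.toReal_ofReal (abs_nonneg _)]
        have ha2 : (a : ℝ) / Q ≤ 2 := by
          rw [div_le_iff₀ hQ0]; exact_mod_cast (Finset.mem_Icc.1 ha).2
        have ha0 : 0 ≤ (a : ℝ) / Q := by positivity
        calc _ = |(P'.1 - P.1) + (P'.2 - P.2) * (a / Q)| := by congr 1; ring
          _ ≤ |P'.1 - P.1| + |P'.2 - P.2| * (a / Q) := by
            refine (abs_add_le _ _).trans ?_
            rw [abs_mul, abs_of_nonneg ha0]
          _ ≤ η + η * 2 := by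
            rw [abs_sub_comm, abs_sub_comm P'.2]
            gcongr
          _ = _ := by ring
    _ = _ := by
        rw [Finset.sum_const, Nat.card_Icc, show 2 * Q + 1 - Q = Q + 1 by omega, nsmul_eq_mul]
        push_cast
        ring

/-- The multilinear correlation of the rescaled and translated copies of `g`. -/
noncomputable def correlation {m : ℕ} (g : ℝ → ℝ) (P : Fin m → ℝ × ℝ) : ℝ :=
  ∫ z, ∏ i, g (affineCoord (P i) z)

theorem integrable_prod_affineCoord {m : ℕ} {g : ℝ → ℝ} {B : ℝ} (hg : Integrable g)
    (hgm : Measurable g) (hB : ∀ y, |g y| ≤ B) {P : Fin m → ℝ × ℝ} (hP : ∀ i, 0 < (P i).2)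
    (hm : 0 < m) : Integrable fun z => ∏ i, g (affineCoord (P i) z) := by
  obtain ⟨m, rfl⟩ : ∃ l, m = l + 1 := ⟨m - 1, by omega⟩
  simp_rw [Fin.prod_univ_succ]
  refine (integrable_comp_affineCoord (hP 0) hg).mul_bdd (c := B ^ m) ?_ (ae_of_all _ fun z => ?_)
  · exact (Finset.measurable_prod _ fun i _ =>
      hgm.comp (measurable_affineCoord _)).aestronglyMeasurable
  · rw [Real.norm_eq_abs, Finset.abs_prod]
    exact (Finset.prod_le_prod (fun _ _ => abs_nonneg _) fun i _ => hB _).trans (by simp)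

theorem abs_correlation_sub_le {m : ℕ} {g : ℝ → ℝ} {Q : ℕ} (hQ : 0 < Q)
    (hconst : ∀ y y' : ℝ, ⌊y * Q⌋₊ = ⌊y' * Q⌋₊ → g y = g y')
    (hsupp : ∀ y, y ∉ Ico (1 : ℝ) 2 → g y = 0) {B : ℝ} (hB1 : 1 ≤ B) (hB : ∀ y, |g y| ≤ B)
    (hg : Integrable g) {P P' : Fin m → ℝ × ℝ} (hP : ∀ i, 0 < (P i).2) (hP' : ∀ i, 0 < (P' i).2)
    (hm : 0 < m) {η : ℝ}
    (h1 : ∀ i, |(P i).1 - (P' i).1| ≤ η) (h2 : ∀ i, |(P i).2 - (P' i).2| ≤ η) :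
    |correlation g P - correlation g P'| ≤ B ^ m * (m * (2 * B * ((Q + 1) * (3 * η)))) := by
  have hgm := measurable_of_floor hconst
  have i1 := integrable_prod_affineCoord hg hgm hB hP hm
  have i2 := integrable_prod_affineCoord hg hgm hB hP' hm
  unfold correlation
  rw [← integral_sub i1 i2]
  refine (abs_integral_le_integral_abs).trans ?_
  have i3 : ∀ i, Integrable fun z => |g (affineCoord (P i) z) - g (affineCoord (P' i) z)| :=
    fun i => ((integrable_comp_affineCoord (hP i) hg).sub
      (integrable_comp_affineCoord (hP' i) hg)).abs
  calc _ ≤ ∫ z, B ^ m * ∑ i, |g (affineCoord (P i) z) - g (affineCoord (P' i) z)| := by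
        refine integral_mono (i1.sub i2).abs ((integrable_finsetSum _ fun i _ => i3 i).const_mul _)
          fun z => ?_
        have := abs_prod_sub_prod_le Finset.univ (fun i => g (affineCoord (P i) z))
          (fun i => g (affineCoord (P' i) z)) hB1 (fun i => hB _) (fun i => hB _)
        simpa using this
    _ = B ^ m * ∑ i, ∫ z, |g (affineCoord (P i) z) - g (affineCoord (P' i) z)| := by
        rw [integral_const_mul, integral_finsetSum _ fun i _ => i3 i]
    _ ≤ B ^ m * ∑ i : Fin m, 2 * B * ((Q + 1) * (3 * η)) := by
        gcongr with i
        exact integral_abs_sub_comp_affineCoord_le hQ hconst hsupp hB hg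
          (hP i) (hP' i) (h1 i) (h2 i)
    _ = _ := by simp

/-- The set on which the rescaled points lie in pairwise distinct blocks. -/
def distinctBlocks (n k : ℕ) {m : ℕ} (P : Fin m → ℝ × ℝ) : Set ℝ :=
  {z | Function.Injective fun i => block n k (affineCoord (P i) z)}

/-- The weight of the chaos of degree `S` in the expansion of a correlation of subdivided
densities. -/
noncomputable def chaosWeight (n k : ℕ) (ρ : ℝ → ℝ) {m : ℕ} (P : Fin m → ℝ × ℝ)
    (S : Finset (Fin m)) (z : ℝ) : ℝ :=
  (distinctBlocks n k P).indicator (fun z => ∏ i, ρ (affineCoord (P i) z)) z *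
    ∏ i ∈ S, haar n k (affineCoord (P i) z)

/-- The chaos of degree `S` in the expansion of a correlation of subdivided densities. -/
noncomputable def chaos (n k : ℕ) (ρ : ℝ → ℝ) {m : ℕ} (P : Fin m → ℝ × ℝ)
    (S : Finset (Fin m)) (ε : ℕ → ℝ) : ℝ :=
  ∫ z, chaosWeight n k ρ P S z * ∏ i ∈ S, ε (block n k (affineCoord (P i) z))

theorem measurableSet_distinctBlocks (n k : ℕ) {m : ℕ} (P : Fin m → ℝ × ℝ) :
    MeasurableSet (distinctBlocks n k P) := by
  have : distinctBlocks n k P = ⋂ i, ⋂ j, ⋂ _ : i ≠ j,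
      {z | block n k (affineCoord (P i) z) = block n k (affineCoord (P j) z)}ᶜ := by
    ext z
    simp only [distinctBlocks, Function.Injective, mem_ofPred_eq, mem_iInter, mem_compl_iff]
    exact forall_congr' fun i => forall_congr' fun j => not_imp_not.symm
  rw [this]
  refine MeasurableSet.iInter fun i => MeasurableSet.iInter fun j =>
    MeasurableSet.iInter fun _ => ?_
  exact (measurableSet_eq_fun ((measurable_block n k).comp (measurable_affineCoord _))
    ((measurable_block n k).comp (measurable_affineCoord _))).compl

theorem mul_le_of_block_eq {n k c : ℕ} {y : ℝ} (hy : 0 ≤ y) (h : block n k y = c) :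
    (2 * c : ℝ) ≤ y * 2 ^ (n * (k + 1)) ∧ y * 2 ^ (n * (k + 1)) ≤ 2 * c + 2 := by
  unfold block at h
  have h0 : 0 ≤ y * 2 ^ (n * (k + 1)) := by positivity
  have h1 := Nat.floor_le h0
  have h2 := Nat.lt_floor_add_one (y * 2 ^ (n * (k + 1)))
  set f := ⌊y * 2 ^ (n * (k + 1))⌋₊
  have h3 : (2 * c : ℝ) ≤ f := by exact_mod_cast (by omega : 2 * c ≤ f)
  have h4 : (f : ℝ) ≤ 2 * c + 1 := by exact_mod_cast (by omega : f ≤ 2 * c + 1)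
  constructor <;> linarith

namespace IsLevel

variable {n k m : ℕ} {ρ : ℝ → ℝ} {P : Fin m → ℝ × ℝ}

theorem abs_le (h : IsLevel n k ρ) (y : ℝ) : |ρ y| ≤ 2 ^ k := by
  rw [abs_of_nonneg (h.nonneg y)]; exact h.le y

theorem mem_of_ne_zero (h : IsLevel n k ρ) {y : ℝ} (hy : ρ y ≠ 0) : y ∈ Ico (1 : ℝ) 2 := by
  by_contra hc; exact hy (h.supp y hc)

theorem prod_nonneg (h : IsLevel n k ρ) (P : Fin m → ℝ × ℝ) (z : ℝ) :
    0 ≤ ∏ i, ρ (affineCoord (P i) z) :=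
  Finset.prod_nonneg fun _ _ => h.nonneg _

theorem integrable_prod (h : IsLevel n k ρ) (hP : ∀ i, (P i).2 ∈ Icc (1 : ℝ) 2) (hm : 0 < m) :
    Integrable fun z => ∏ i, ρ (affineCoord (P i) z) :=
  integrable_prod_affineCoord h.integrable h.measurable h.abs_le
    (fun i => by linarith [(hP i).1]) hm

theorem integrable_chaosWeight (h : IsLevel n k ρ) (hP : ∀ i, (P i).2 ∈ Icc (1 : ℝ) 2)
    (hm : 0 < m) (S : Finset (Fin m)) : Integrable (chaosWeight n k ρ P S) := by
  refine ((h.integrable_prod hP hm).indicator (measurableSet_distinctBlocks n k P)).mul_bdd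
    (c := 1) ?_ (ae_of_all _ fun z => ?_)
  · exact (Finset.measurable_prod _ fun i _ =>
      (measurable_haar n k).comp (measurable_affineCoord _)).aestronglyMeasurable
  · rw [Real.norm_eq_abs, Finset.abs_prod]
    simp [abs_haar]

theorem abs_chaosWeight (h : IsLevel n k ρ) (S : Finset (Fin m)) (z : ℝ) :
    |chaosWeight n k ρ P S z| =
      (distinctBlocks n k P).indicator (fun z => ∏ i, ρ (affineCoord (P i) z)) z := by
  unfold chaosWeight
  rw [abs_mul, Finset.abs_prod]
  simp only [abs_haar, Finset.prod_const_one, mul_one]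
  exact abs_of_nonneg (indicator_nonneg (fun z _ => h.prod_nonneg P z) z)

theorem integral_abs_chaosWeight_le (h : IsLevel n k ρ) (hP : ∀ i, (P i).2 ∈ Icc (1 : ℝ) 2)
    (hm : 0 < m) (S : Finset (Fin m)) :
    ∫ z, |chaosWeight n k ρ P S z| ≤ correlation ρ P := by
  refine integral_mono (h.integrable_chaosWeight hP hm S).abs (h.integrable_prod hP hm)
    fun z => ?_
  simp only [h.abs_chaosWeight]
  exact indicator_le_self' (fun z _ => h.prod_nonneg P z) z

theorem isChaos_chaos (h : IsLevel n k ρ) (hP : ∀ i, (P i).2 ∈ Icc (1 : ℝ) 2)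
    (hm : 0 < m) {S : Finset (Fin m)} (hS : S.Nonempty) :
    IsChaos (2 ^ (n * (k + 1))) (chaos n k ρ P S)
      ((m * (4 / 2 ^ (n * (k + 1)) * (2 ^ k) ^ m)) * ∫ z, |chaosWeight n k ρ P S z|) := by
  have hne : ∀ z, chaosWeight n k ρ P S z ≠ 0 →
      z ∈ distinctBlocks n k P ∧ ∀ i, affineCoord (P i) z ∈ Ico (1 : ℝ) 2 := by
    intro z hz
    have h1 : (distinctBlocks n k P).indicator (fun z => ∏ i, ρ (affineCoord (P i) z)) z ≠ 0 :=
      left_ne_zero_of_mul hz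
    refine ⟨mem_of_indicator_ne_zero h1, fun i => h.mem_of_ne_zero ?_⟩
    rw [indicator_of_mem (mem_of_indicator_ne_zero h1)] at h1
    exact Finset.prod_ne_zero_iff.1 h1 i (Finset.mem_univ i)
  refine isChaos_integral S (fun i z => block n k (affineCoord (P i) z))
    (fun i => (measurable_block n k).comp (measurable_affineCoord _)) _
    (h.integrable_chaosWeight hP hm S) hS (fun z hz => (hne z hz).1.injOn) _
    (fun z hz i => block_lt ((hne z hz).2 i).2) _ fun c => ?_
  set Q : ℝ := 2 ^ (n * (k + 1)) with hQ
  have hQ0 : 0 < Q := by positivity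
  set J : Fin m → Set ℝ := fun i =>
    Icc ((P i).1 + (P i).2 * (2 * c / Q)) ((P i).1 + (P i).2 * ((2 * c + 2) / Q)) with hJ
  set D : Set ℝ := {z | (S.sup fun i => block n k (affineCoord (P i) z)) = c} with hD
  have hpt : ∀ z, D.indicator (fun z => |chaosWeight n k ρ P S z|) z ≤
      ∑ i, (J i).indicator (fun _ => (2 ^ k : ℝ) ^ m) z := by
    intro z
    have hnn : ∀ i ∈ Finset.univ, 0 ≤ (J i).indicator (fun _ => (2 ^ k : ℝ) ^ m) z :=
      fun i _ => indicator_nonneg (fun _ _ => by positivity) z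
    by_cases hz : z ∈ D ∧ chaosWeight n k ρ P S z ≠ 0
    · obtain ⟨hzD, hz0⟩ := hz
      obtain ⟨i, hi, hi'⟩ := Finset.exists_mem_eq_sup S hS
        fun i => block n k (affineCoord (P i) z)
      have hb : block n k (affineCoord (P i) z) = c := by rw [← hi']; exact hzD
      have hy := (hne z hz0).2 i
      have hP0 : 0 < (P i).2 := by linarith [(hP i).1]
      obtain ⟨h1, h2⟩ := mul_le_of_block_eq (by linarith [hy.1]) hb
      have hzJ : z ∈ J i := by
        rw [hJ]
        refine ⟨(le_affineCoord_iff hP0).1 ?_, (affineCoord_le_iff hP0).1 ?_⟩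
        · rwa [div_le_iff₀ hQ0]
        · rwa [le_div_iff₀ hQ0]
      refine le_trans ?_ (Finset.single_le_sum hnn (Finset.mem_univ i))
      rw [indicator_of_mem hzD, indicator_of_mem hzJ, h.abs_chaosWeight,
        indicator_of_mem (hne z hz0).1]
      exact (Finset.prod_le_prod (fun _ _ => h.nonneg _) fun i _ => h.le _).trans (by simp)
    · refine le_trans (le_of_eq ?_) (Finset.sum_nonneg hnn)
      by_cases hzD : z ∈ D
      · have : chaosWeight n k ρ P S z = 0 := by tauto
        rw [indicator_of_mem hzD, this, abs_zero]
      · rw [indicator_of_notMem hzD]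
  have hJint : ∀ i, Integrable ((J i).indicator fun _ => (2 ^ k : ℝ) ^ m) := fun i =>
    (integrable_indicator_iff measurableSet_Icc).2 (integrableOn_const (by simp))
  have hDm : MeasurableSet D := by
    have hsup : ∀ T : Finset (Fin m),
        Measurable fun z => T.sup fun i => block n k (affineCoord (P i) z) := by
      classical
      intro T
      induction T using Finset.induction_on with
      | empty => simp
      | insert a T _ ih =>
        simp only [Finset.sup_insert]
        exact ((measurable_block n k).comp (measurable_affineCoord _)).max ih
    exact hsup S (measurableSet_singleton c)
  rw [← integral_indicator hDm]
  calc _ ≤ ∫ z, ∑ i, (J i).indicator (fun _ => (2 ^ k : ℝ) ^ m) z :=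
        integral_mono ((h.integrable_chaosWeight hP hm S).abs.indicator hDm)
          (integrable_finsetSum _ fun i _ => hJint i) hpt
    _ = ∑ i, ∫ z, (J i).indicator (fun _ => (2 ^ k : ℝ) ^ m) z :=
        integral_finsetSum _ fun i _ => hJint i
    _ ≤ ∑ i : Fin m, 4 / Q * (2 ^ k) ^ m := by
        refine Finset.sum_le_sum fun i _ => ?_
        rw [integral_indicator_const _ measurableSet_Icc, smul_eq_mul]
        gcongr
        rw [Real.volume_real_Icc]
        refine max_le ?_ (by positivity)
        calc _ = (P i).2 * (2 / Q) := by ring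
          _ ≤ 2 * (2 / Q) := by gcongr; exact (hP i).2
          _ = _ := by ring
    _ = _ := by simp

theorem integral_indicator_subdivide_eq (h : IsLevel n k ρ) (hP : ∀ i, (P i).2 ∈ Icc (1 : ℝ) 2)
    (hm : 0 < m) {ε : ℕ → ℝ} (hε : IsSigns ε) :
    ∫ z, (distinctBlocks n k P).indicator
      (fun z => ∏ i, subdivide n k ρ ε (affineCoord (P i) z)) z =
      ∑ S : Finset (Fin m), chaos n k ρ P S ε := by
  unfold chaos
  have hi : ∀ S : Finset (Fin m), Integrable fun z =>
      chaosWeight n k ρ P S z * ∏ i ∈ S, ε (block n k (affineCoord (P i) z)) := by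
    intro S
    refine (h.integrable_chaosWeight hP hm S).mul_bdd (c := 1) ?_ (ae_of_all _ fun z => ?_)
    · exact (Finset.measurable_prod _ fun i _ => (measurable_from_nat (f := ε)).comp
        ((measurable_block n k).comp (measurable_affineCoord _))).aestronglyMeasurable
    · rw [Real.norm_eq_abs, Finset.abs_prod]
      simp [hε.abs_eq]
  rw [← integral_finsetSum _ fun S _ => hi S]
  congr 1
  ext z
  unfold chaosWeight subdivide
  by_cases hz : z ∈ distinctBlocks n k P
  · simp only [indicator_of_mem hz]
    rw [Finset.prod_mul_distrib, Finset.prod_one_add, Finset.mul_sum, Finset.powerset_univ]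
    refine Finset.sum_congr rfl fun S _ => ?_
    rw [Finset.prod_mul_distrib]
    ring
  · simp [indicator_of_notMem hz]

theorem integral_indicator_compl_le (h : IsLevel n k ρ) (hn : 1 ≤ n) {j : ℕ}
    (hP : ∀ i, (P i).2 ∈ Icc (1 : ℝ) 2) (hm : 0 < m) {τ R : ℝ} (hτ : 0 < τ)
    (hRk : ((2 : ℝ) ^ (n * k))⁻¹ ≤ R) (hR : 64 * (2 ^ (n * (j + 1)))⁻¹ / τ ≤ R)
    (hsep : ∀ i i', i ≠ i' → τ ≤ |(P i).1 - (P i').1|) :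
    ∫ z, (distinctBlocks n j P)ᶜ.indicator (fun z => ∏ i, ρ (affineCoord (P i) z)) z ≤
      m * m * ((2 ^ k) ^ (m - 1) *
        (2 ^ (n + 2) * R ^ (1 - 1 / (n : ℝ)))) := by
  classical
  set Q : ℝ := 2 ^ (n * (j + 1)) with hQ
  have hQ0 : 0 < Q := by positivity
  set D : Fin m × Fin m → Set ℝ := fun p =>
    {z | |affineCoord (P p.1) z - affineCoord (P p.2) z| ≤ 2 * Q⁻¹} with hD
  have hDm : ∀ p, MeasurableSet (D p) := fun p =>
    measurableSet_le ((measurable_affineCoord _).sub (measurable_affineCoord _)).abs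
      measurable_const
  set T : Finset (Fin m × Fin m) := Finset.univ.filter fun p => p.1 ≠ p.2 with hT
  set φ : Fin m × Fin m → ℝ → ℝ := fun p z =>
    (D p).indicator (fun z => (2 ^ k) ^ (m - 1) * ρ (affineCoord (P p.1) z)) z with hφ
  have hφ0 : ∀ z, ∀ p ∈ T, 0 ≤ φ p z := fun z p _ =>
    indicator_nonneg (fun z _ => mul_nonneg (by positivity) (h.nonneg _)) z
  have hφi : ∀ p ∈ T, Integrable (φ p) := fun p _ =>
    ((integrable_comp_affineCoord (by linarith [(hP p.1).1]) h.integrable).const_mul _).indicator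
      (hDm p)
  have hpt : ∀ z, (distinctBlocks n j P)ᶜ.indicator
      (fun z => ∏ i, ρ (affineCoord (P i) z)) z ≤ ∑ p ∈ T, φ p z := by
    intro z
    by_cases hz : z ∈ (distinctBlocks n j P)ᶜ ∧ ∏ i, ρ (affineCoord (P i) z) ≠ 0
    · obtain ⟨hzd, hz0⟩ := hz
      have hmem : ∀ i, affineCoord (P i) z ∈ Ico (1 : ℝ) 2 := fun i =>
        h.mem_of_ne_zero (Finset.prod_ne_zero_iff.1 hz0 i (Finset.mem_univ i))
      rw [indicator_of_mem hzd]
      simp only [distinctBlocks, Function.Injective, mem_compl_iff,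
        mem_ofPred_eq, not_forall] at hzd
      obtain ⟨i, i', hb, hne⟩ := hzd
      have hzD : z ∈ D (i, i') := by
        have h1 := mul_le_of_block_eq (by linarith [(hmem i).1]) hb
        have h2 := mul_le_of_block_eq (n := n) (k := j) (by linarith [(hmem i').1] :
          0 ≤ affineCoord (P i') z) rfl
        have : |affineCoord (P i) z - affineCoord (P i') z| * Q ≤ 2 := by
          rw [← abs_of_pos hQ0, ← abs_mul, _root_.abs_le]
          constructor <;> nlinarith [h1.1, h1.2, h2.1, h2.2]
        show |affineCoord (P i) z - affineCoord (P i') z| ≤ 2 * Q⁻¹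
        rwa [← div_eq_mul_inv, le_div_iff₀ hQ0]
      refine le_trans ?_ (Finset.single_le_sum (hφ0 z) (show (i, i') ∈ T by simp [hT, hne]))
      rw [hφ]
      simp only [indicator_of_mem hzD]
      rw [← Finset.mul_prod_erase _ _ (Finset.mem_univ i), mul_comm]
      refine mul_le_mul_of_nonneg_right ?_ (h.nonneg _)
      refine (Finset.prod_le_prod (fun _ _ => h.nonneg _) fun i _ => h.le _).trans ?_
      simp [Finset.card_erase_of_mem]
    · refine le_trans (le_of_eq ?_) (Finset.sum_nonneg (hφ0 z))
      by_cases hzd : z ∈ (distinctBlocks n j P)ᶜ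
      · rw [indicator_of_mem hzd]; tauto
      · rw [indicator_of_notMem hzd]
  calc _ ≤ ∫ z, ∑ p ∈ T, φ p z :=
        integral_mono ((h.integrable_prod hP hm).indicator
          (measurableSet_distinctBlocks n j P).compl) (integrable_finsetSum _ hφi) hpt
    _ = ∑ p ∈ T, ∫ z, φ p z := integral_finsetSum _ hφi
    _ ≤ ∑ p ∈ T, (2 ^ k) ^ (m - 1) *
        (2 ^ (n + 2) * R ^ (1 - 1 / (n : ℝ))) := by
        refine Finset.sum_le_sum fun p hp => ?_
        rw [hφ, integral_indicator (hDm p), integral_const_mul]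
        refine mul_le_mul_of_nonneg_left ?_ (by positivity)
        exact h.setIntegral_close_le hn (hP _) (hP _) hτ (by positivity) hRk hR
          (hsep _ _ (by simpa [hT] using hp)) (hDm p) fun z hz => hz
    _ ≤ _ := by
        have hR0 : 0 ≤ R := le_trans (by positivity) hRk
        rw [Finset.sum_const, nsmul_eq_mul]
        gcongr
        have : T.card ≤ m * m := by
          refine (Finset.card_filter_le _ _).trans ?_
          simp
        exact_mod_cast this

end IsLevel

/-- The points of a uniform grid in the parameter box. -/
noncomputable def gridPoint (q : ℕ) (a : Fin (q + 1) × Fin (q + 1)) : ℝ × ℝ :=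
  (a.1 / q, 1 + a.2 / q)

theorem gridPoint_mem (q : ℕ) (a : Fin (q + 1) × Fin (q + 1)) : gridPoint q a ∈ paramBox := by
  have key : ∀ b : Fin (q + 1), (0 : ℝ) ≤ b / q ∧ (b : ℝ) / q ≤ 1 := fun b =>
    ⟨by positivity, div_le_one_of_le₀ (by exact_mod_cast Nat.lt_succ_iff.1 b.2) (by positivity)⟩
  refine ⟨key a.1, ?_⟩
  have := key a.2
  simp only [gridPoint, mem_Icc]
  constructor <;> linarith [this.1, this.2]

theorem exists_gridPoint {q : ℕ} (hq : 0 < q) {P : ℝ × ℝ} (hP : P ∈ paramBox) :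
    ∃ a, |P.1 - (gridPoint q a).1| ≤ (q : ℝ)⁻¹ ∧ |P.2 - (gridPoint q a).2| ≤ (q : ℝ)⁻¹ := by
  have hq0 : (0 : ℝ) < q := by exact_mod_cast hq
  have key : ∀ t ∈ Icc (0 : ℝ) 1, ∃ b : Fin (q + 1), |t - b / q| ≤ (q : ℝ)⁻¹ := by
    intro t ht
    have h0 : 0 ≤ t * q := mul_nonneg ht.1 hq0.le
    refine ⟨⟨⌊t * q⌋₊, Nat.lt_succ_iff.2 (Nat.floor_le_of_le ?_)⟩, ?_⟩
    · nlinarith [ht.2]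
    · have h1 := Nat.floor_le h0
      have h2 := Nat.lt_floor_add_one (t * q)
      have e : t - (⌊t * q⌋₊ : ℝ) / q = (t * q - ⌊t * q⌋₊) / q := by field_simp
      simp only [e]
      rw [abs_div, abs_of_pos hq0, inv_eq_one_div]
      gcongr
      rw [abs_le]; constructor <;> linarith
  obtain ⟨a, ha⟩ := key P.1 hP.1
  obtain ⟨b, hb⟩ := key (P.2 - 1) ⟨by linarith [hP.2.1], by linarith [hP.2.2]⟩
  refine ⟨(a, b), ha, ?_⟩
  simp only [gridPoint]
  rwa [← sub_sub]

/-- The mesh of the grid of parameters used at stage `k`. -/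
def gridSize (n k : ℕ) : ℕ := 2 ^ (6 * n * (k + 1))

theorem log_card_le (n k : ℕ) (hn : 2 ≤ n) :
    Real.log (2 * ((((gridSize n k + 1) * (gridSize n k + 1)) ^ n * 2 ^ n +
      ((gridSize n k + 1) * (gridSize n k + 1)) ^ 2 : ℕ) : ℝ)) ≤
      ((12 * n ^ 2 + 3 * n + 2 : ℕ) : ℝ) * (k + 1) := by
  set q := gridSize n k with hq
  have hq1 : 1 ≤ q := Nat.one_le_two_pow
  have h1 : (q + 1) * (q + 1) ≤ 2 ^ (2 * (6 * n * (k + 1) + 1)) := by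
    have : q + 1 ≤ 2 ^ (6 * n * (k + 1) + 1) := by
      rw [pow_succ, ← gridSize]; omega
    calc _ ≤ 2 ^ (6 * n * (k + 1) + 1) * 2 ^ (6 * n * (k + 1) + 1) := Nat.mul_le_mul this this
      _ = _ := by rw [← pow_add]; congr 1; ring
  have hone : 1 ≤ (q + 1) * (q + 1) := Nat.succ_le_of_lt (by positivity)
  have h2 : ((q + 1) * (q + 1)) ^ 2 ≤ ((q + 1) * (q + 1)) ^ n * 2 ^ n :=
    (Nat.pow_le_pow_right hone hn).trans (Nat.le_mul_of_pos_right _ (by positivity))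
  have h3 : ((q + 1) * (q + 1)) ^ n * 2 ^ n ≤ 2 ^ (2 * (6 * n * (k + 1) + 1) * n + n) := by
    rw [pow_add, pow_mul]
    gcongr
  have h4 : 2 * (((q + 1) * (q + 1)) ^ n * 2 ^ n + ((q + 1) * (q + 1)) ^ 2) ≤
      2 ^ ((12 * n ^ 2 + 3 * n + 2) * (k + 1)) := by
    calc _ ≤ 2 ^ 2 * 2 ^ (2 * (6 * n * (k + 1) + 1) * n + n) := by omega
      _ = 2 ^ (2 + (2 * (6 * n * (k + 1) + 1) * n + n)) := (pow_add _ _ _).symm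
      _ ≤ _ := Nat.pow_le_pow_right (by norm_num) (by nlinarith [Nat.zero_le (n * k)])
  have hpos : 0 < ((q + 1) * (q + 1)) ^ n * 2 ^ n + ((q + 1) * (q + 1)) ^ 2 := by positivity
  set c := ((q + 1) * (q + 1)) ^ n * 2 ^ n + ((q + 1) * (q + 1)) ^ 2
  calc Real.log (2 * (c : ℝ)) ≤ Real.log (2 ^ ((12 * n ^ 2 + 3 * n + 2) * (k + 1))) := by
        apply Real.log_le_log (by positivity)
        exact_mod_cast h4
    _ = ((12 * n ^ 2 + 3 * n + 2 : ℕ) : ℝ) * (k + 1) * Real.log 2 := by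
        rw [Real.log_pow]; push_cast; ring
    _ ≤ _ := mul_le_of_le_one_right (by positivity) (by linarith [Real.log_two_lt_d9])

theorem exists_signs_grid {n k : ℕ} {ρ : ℝ → ℝ} (h : IsLevel n k ρ) (hn : 2 ≤ n) (θ θ' : ℝ) :
    ∃ ε, IsSigns ε ∧
      (∀ (P : Fin n → Fin (gridSize n k + 1) × Fin (gridSize n k + 1)) (S : Finset (Fin n)),
        S.Nonempty → θ * |chaos n k ρ (fun i => gridPoint _ (P i)) S ε| ≤
          ((12 * n ^ 2 + 3 * n + 2 : ℕ) : ℝ) * (k + 1) + θ ^ 2 / 2 *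
            ((n * (4 / 2 ^ (n * (k + 1)) * (2 ^ k) ^ n)) *
              ∫ z, |chaosWeight n k ρ (fun i => gridPoint _ (P i)) S z|)) ∧
      ∀ P : Fin 2 → Fin (gridSize n k + 1) × Fin (gridSize n k + 1),
        θ' * |chaos n k ρ (fun i => gridPoint _ (P i)) Finset.univ ε| ≤
          ((12 * n ^ 2 + 3 * n + 2 : ℕ) : ℝ) * (k + 1) + θ' ^ 2 / 2 *
            (((2 : ℕ) * (4 / 2 ^ (n * (k + 1)) * (2 ^ k) ^ 2)) *
              ∫ z, |chaosWeight n k ρ (fun i => gridPoint _ (P i)) Finset.univ z|) := by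
  classical
  set q := gridSize n k with hq
  have hbox : ∀ a, (gridPoint q a).2 ∈ Icc (1 : ℝ) 2 := fun a => (gridPoint_mem q a).2
  have hzero : IsChaos (2 ^ (n * (k + 1))) (fun _ => 0) 0 :=
    ⟨fun _ _ => 0, fun _ => 0, by simp, by simp, by simp, by simp⟩
  obtain ⟨ε, hε, hb⟩ := exists_signs_forall_abs_le
    (ι := ((Fin n → Fin (q + 1) × Fin (q + 1)) × Finset (Fin n)) ⊕
      (Fin 2 → Fin (q + 1) × Fin (q + 1))) (2 ^ (n * (k + 1)))
    (Sum.elim (fun c => if c.2.Nonempty then chaos n k ρ (fun i => gridPoint q (c.1 i)) c.2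
      else fun _ => 0) fun P => chaos n k ρ (fun i => gridPoint q (P i)) Finset.univ)
    (Sum.elim (fun c => if c.2.Nonempty then (n * (4 / 2 ^ (n * (k + 1)) * (2 ^ k) ^ n)) *
      ∫ z, |chaosWeight n k ρ (fun i => gridPoint q (c.1 i)) c.2 z| else 0)
      fun P => ((2 : ℕ) * (4 / 2 ^ (n * (k + 1)) * (2 ^ k) ^ 2)) *
        ∫ z, |chaosWeight n k ρ (fun i => gridPoint q (P i)) Finset.univ z|)
    (Sum.elim (fun _ => θ) fun _ => θ') (by
      rintro (⟨P, S⟩ | P)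
      · by_cases hS : S.Nonempty
        · simp only [Sum.elim_inl, hS, if_true]
          exact h.isChaos_chaos (fun i => hbox _) (by omega) hS
        · simpa only [Sum.elim_inl, hS, if_false] using hzero
      · exact h.isChaos_chaos (fun i => hbox _) (by omega) Finset.univ_nonempty)
  have hcard : Real.log (2 * (Fintype.card (((Fin n → Fin (q + 1) × Fin (q + 1)) ×
      Finset (Fin n)) ⊕ (Fin 2 → Fin (q + 1) × Fin (q + 1))) : ℝ)) ≤
      ((12 * n ^ 2 + 3 * n + 2 : ℕ) : ℝ) * (k + 1) := by
    have := log_card_le n k hn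
    simpa [Fintype.card_sum, Fintype.card_prod] using this
  refine ⟨ε, hε, fun P S hS => ?_, fun P => ?_⟩
  · have := hb (Sum.inl (P, S))
    simp only [Sum.elim_inl, hS, if_true] at this
    linarith
  · have := hb (Sum.inr P)
    simp only [Sum.elim_inr] at this
    linarith

theorem perturbation_le {n k m : ℕ} (hn : 4 ≤ n) (hm : m ≤ n) {η : ℝ}
    (hη : η = ((gridSize n k : ℕ) : ℝ)⁻¹) :
    ((2 : ℝ) ^ (k + 1)) ^ m * (m * (2 * 2 ^ (k + 1) *
      (((2 ^ (n * (k + 1)) : ℕ) + 1) * (3 * η)))) ≤ (2 ^ (k + 1))⁻¹ := by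
  have h1 : ((2 : ℝ) ^ (k + 1)) ^ m ≤ 2 ^ (n * (k + 1)) := by
    rw [← pow_mul]
    exact pow_le_pow_right₀ (by norm_num) (by rw [mul_comm]; exact Nat.mul_le_mul_right _ hm)
  have h2 : (12 * m : ℝ) ≤ 2 ^ (2 * n) := by
    have a : m < 2 ^ n := lt_of_le_of_lt hm Nat.lt_two_pow_self
    have b : 12 ≤ 2 ^ n := le_trans (by norm_num) (Nat.pow_le_pow_right (by norm_num) hn)
    have : 12 * m ≤ 2 ^ (2 * n) := by
      rw [two_mul, pow_add]; exact Nat.mul_le_mul b a.le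
    exact_mod_cast this
  have h3 : (((2 ^ (n * (k + 1)) : ℕ) : ℝ) + 1) ≤ 2 * 2 ^ (n * (k + 1)) := by
    have : (1 : ℝ) ≤ 2 ^ (n * (k + 1)) := one_le_pow₀ (by norm_num)
    push_cast
    linarith
  have hη0 : 0 ≤ η := by rw [hη]; positivity
  calc _ ≤ (2 : ℝ) ^ (n * (k + 1)) * (m * (2 * 2 ^ (k + 1) *
      ((2 * 2 ^ (n * (k + 1))) * (3 * η)))) := by gcongr
    _ = (12 * m : ℝ) * (2 ^ (n * (k + 1)) * 2 ^ (n * (k + 1)) * 2 ^ (k + 1)) * η := by ring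
    _ ≤ 2 ^ (2 * n) * (2 ^ (n * (k + 1)) * 2 ^ (n * (k + 1)) * 2 ^ (k + 1)) * η := by gcongr
    _ ≤ _ := by
      rw [hη, gridSize]
      push_cast
      rw [← div_eq_mul_inv, div_le_iff₀ (by positivity), ← pow_add, ← pow_add, ← pow_add,
        ← div_eq_inv_mul, le_div_iff₀ (by positivity), ← pow_add]
      exact pow_le_pow_right₀ (by norm_num) (by nlinarith [Nat.zero_le (n * k)])

theorem abs_correlation_sub_grid_le {n k m : ℕ} (hn : 4 ≤ n) (hm0 : 0 < m) (hm : m ≤ n)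
    {g : ℝ → ℝ}
    (hconst : ∀ y y', ⌊y * 2 ^ (n * (k + 1))⌋₊ = ⌊y' * 2 ^ (n * (k + 1))⌋₊ → g y = g y')
    (hsupp : ∀ y, y ∉ Ico (1 : ℝ) 2 → g y = 0) (hB : ∀ y, |g y| ≤ 2 ^ (k + 1))
    (hg : Integrable g) {P : Fin m → ℝ × ℝ} (hP : ∀ i, P i ∈ paramBox)
    {a : Fin m → Fin (gridSize n k + 1) × Fin (gridSize n k + 1)}
    (h1 : ∀ i, |(P i).1 - (gridPoint _ (a i)).1| ≤ ((gridSize n k : ℕ) : ℝ)⁻¹)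
    (h2 : ∀ i, |(P i).2 - (gridPoint _ (a i)).2| ≤ ((gridSize n k : ℕ) : ℝ)⁻¹) :
    |correlation g P - correlation g fun i => gridPoint _ (a i)| ≤ (2 ^ (k + 1))⁻¹ := by
  refine (abs_correlation_sub_le (Q := 2 ^ (n * (k + 1))) (by positivity) ?_ hsupp
    (one_le_pow₀ (by norm_num)) hB hg (fun i => by linarith [(hP i).2.1])
    (fun i => by linarith [(gridPoint_mem _ (a i)).2.1]) hm0 h1 h2).trans
    (perturbation_le hn hm rfl)
  intro y y' hy
  push_cast at hy
  exact hconst y y' hy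

/-- The bound for correlations of separated copies that is propagated through the construction. -/
def CorrelationBound (n k : ℕ) (K : ℝ) (ρ : ℝ → ℝ) : Prop :=
  ∀ P : Fin n → ℝ × ℝ, (∀ i, P i ∈ paramBox) → ∀ τ : ℝ, 0 < τ → τ ≤ 1 →
    (∀ i j, i ≠ j → τ ≤ |(P i).1 - (P j).1|) →
      correlation ρ P ≤ K * ((k : ℝ) + 1) ^ 3 * τ ^ (-(1 - 1 / (n : ℝ)))

theorem IsLevel.correlation_le {n k m : ℕ} {ρ : ℝ → ℝ} (h : IsLevel n k ρ) {P : Fin m → ℝ × ℝ}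
    (hP : ∀ i, P i ∈ paramBox) (hm : 0 < m) : correlation ρ P ≤ 2 * (2 ^ k) ^ (m - 1) := by
  obtain ⟨m, rfl⟩ : ∃ l, m = l + 1 := ⟨m - 1, by omega⟩
  have h0 : 0 < (P 0).2 := by linarith [(hP 0).2.1]
  have hi := integrable_comp_affineCoord h0 h.integrable
  calc correlation ρ P ≤ ∫ z, (2 ^ k) ^ m * ρ (affineCoord (P 0) z) := by
        refine integral_mono (h.integrable_prod (fun i => (hP i).2) hm) (hi.const_mul _)
          fun z => ?_
        simp only [Fin.prod_univ_succ]
        rw [mul_comm]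
        refine mul_le_mul_of_nonneg_right ?_ (h.nonneg _)
        exact (Finset.prod_le_prod (fun _ _ => h.nonneg _) fun i _ => h.le _).trans (by simp)
    _ = (2 ^ k) ^ m * ((P 0).2 * 1) := by
        rw [integral_const_mul, integral_comp_affineCoord h0, h.total]
    _ ≤ (2 ^ k) ^ m * 2 := by
        rw [mul_one]
        gcongr
        exact (hP 0).2.2
    _ = _ := by rw [Nat.add_sub_cancel, mul_comm]

theorem inv_two_pow_rpow {n : ℕ} (hn : 1 ≤ n) (l : ℕ) :
    (((2 : ℝ) ^ (n * l))⁻¹) ^ (1 - 1 / (n : ℝ)) = ((2 ^ l) ^ (n - 1))⁻¹ := by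
  have hn0 : (n : ℝ) ≠ 0 := by positivity
  rw [← Real.rpow_natCast, ← Real.rpow_neg (by norm_num), ← Real.rpow_mul (by norm_num),
    ← pow_mul, ← Real.rpow_natCast, ← Real.rpow_neg (by norm_num)]
  congr 1
  push_cast [Nat.cast_sub hn]
  field_simp

theorem one_sub_inv_mem {n : ℕ} (hn : 1 ≤ n) : 0 ≤ 1 - 1 / (n : ℝ) ∧ 1 - 1 / (n : ℝ) ≤ 1 := by
  have h1 : (1 : ℝ) ≤ n := by exact_mod_cast hn
  have h2 : 1 / (n : ℝ) ≤ 1 := by rw [div_le_one (by linarith)]; exact h1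
  have h3 : 0 ≤ 1 / (n : ℝ) := by positivity
  constructor <;> linarith

/-- The constant in `CorrelationBound` that reproduces itself. -/
noncomputable def corrConst (n : ℕ) : ℝ :=
  128 * n ^ 2 * 2 ^ (n + 2) + 4 ^ n * (2 * n) * ((12 * n ^ 2 + 3 * n + 2 : ℕ) : ℝ) + 4

theorem correlationBound_zero {n : ℕ} (hn : 1 ≤ n) :
    CorrelationBound n 0 (corrConst n) (indicator (Ico (1 : ℝ) 2) 1) := by
  intro P hP τ hτ hτ1 hsep
  have h1 := (isLevel_zero n).correlation_le hP (by omega)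
  have h2 : 1 ≤ τ ^ (-(1 - 1 / (n : ℝ))) :=
    Real.one_le_rpow_of_pos_of_le_one_of_nonpos hτ hτ1 (by linarith [(one_sub_inv_mem hn).1])
  have h3 : (4 : ℝ) ≤ corrConst n := by
    have : (0 : ℝ) ≤ 128 * n ^ 2 * 2 ^ (n + 2) +
      4 ^ n * (2 * n) * ((12 * n ^ 2 + 3 * n + 2 : ℕ) : ℝ) := by positivity
    unfold corrConst
    linarith
  simp only [pow_zero, one_pow, mul_one] at h1
  push_cast
  rw [zero_add, one_pow, mul_one]
  nlinarith

set_option maxHeartbeats 1000000 in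
theorem correlationBound_subdivide {n k : ℕ} {ρ : ℝ → ℝ} (hn : 4 ≤ n) (h : IsLevel n k ρ)
    (hZ : CorrelationBound n k (corrConst n) ρ) {ε : ℕ → ℝ} (hε : IsSigns ε)
    (hch : ∀ (P : Fin n → Fin (gridSize n k + 1) × Fin (gridSize n k + 1)) (S : Finset (Fin n)),
        S.Nonempty → (2 ^ n * (2 * n) * ((k : ℝ) + 1))⁻¹ *
          |chaos n k ρ (fun i => gridPoint _ (P i)) S ε| ≤
          ((12 * n ^ 2 + 3 * n + 2 : ℕ) : ℝ) * (k + 1) +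
          ((2 ^ n * (2 * n) * ((k : ℝ) + 1))⁻¹) ^ 2 / 2 *
            ((n * (4 / 2 ^ (n * (k + 1)) * (2 ^ k) ^ n)) *
              ∫ z, |chaosWeight n k ρ (fun i => gridPoint _ (P i)) S z|)) :
    CorrelationBound n (k + 1) (corrConst n) (subdivide n k ρ ε) := by
  intro P hP τ hτ hτ1 hsep
  have hn0 : 0 < n := by omega
  have hn1 : (1 : ℝ) ≤ n := by exact_mod_cast hn0
  have h' := isLevel_subdivide (by omega) h hε
  obtain ⟨hs0, hs1⟩ := one_sub_inv_mem (n := n) hn0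
  set s : ℝ := 1 - 1 / (n : ℝ) with hs
  set T : ℝ := τ ^ (-s) with hT
  have hT1 : 1 ≤ T := Real.one_le_rpow_of_pos_of_le_one_of_nonpos hτ hτ1 (by linarith)
  set K := corrConst n with hK
  set C₁ : ℝ := ((12 * n ^ 2 + 3 * n + 2 : ℕ) : ℝ) with hC₁
  have hC₁0 : 0 ≤ C₁ := by positivity
  have hKe : K = 128 * n ^ 2 * 2 ^ (n + 2) + 4 ^ n * (2 * n) * C₁ + 4 := rfl
  have hK4 : 4 ≤ K := by
    have : 0 ≤ 128 * (n : ℝ) ^ 2 * 2 ^ (n + 2) + 4 ^ n * (2 * n) * C₁ := by positivity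
    linarith
  set L : ℝ := (k : ℝ) + 1 with hL
  have hL1 : 1 ≤ L := by rw [hL]; linarith [Nat.cast_nonneg (α := ℝ) k]
  push_cast
  rw [← hL]
  set Q : ℝ := 2 ^ (n * (k + 1)) with hQ
  have hQ0 : 0 < Q := by positivity
  by_cases hτQ : τ < Q⁻¹
  · have h1 := h'.correlation_le hP hn0
    have h2 : ((2 : ℝ) ^ (k + 1)) ^ (n - 1) ≤ T := by
      calc ((2 : ℝ) ^ (k + 1)) ^ (n - 1) = (Q⁻¹) ^ (-s) := by
            rw [Real.rpow_neg (by positivity), inv_two_pow_rpow hn0, inv_inv]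
        _ ≤ T := Real.rpow_le_rpow_of_nonpos hτ hτQ.le (by linarith)
    have h3 : 1 ≤ (L + 1) ^ 3 := one_le_pow₀ (by linarith)
    calc _ ≤ 2 * T := by linarith
      _ ≤ K * 1 * T := by nlinarith
      _ ≤ _ := by gcongr
  push Not at hτQ
  have hq : 0 < gridSize n k := by unfold gridSize; positivity
  choose a ha1 ha2 using fun i => exists_gridPoint hq (hP i)
  set P' : Fin n → ℝ × ℝ := fun i => gridPoint _ (a i) with hP'
  have hP'b : ∀ i, P' i ∈ paramBox := fun i => gridPoint_mem _ _
  have hP'2 : ∀ i, (P' i).2 ∈ Icc (1 : ℝ) 2 := fun i => (hP'b i).2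
  have hinv1 : ((2 : ℝ) ^ (k + 1))⁻¹ ≤ 1 := inv_le_one_of_one_le₀ (one_le_pow₀ (by norm_num))
  have he1 : |correlation (subdivide n k ρ ε) P - correlation (subdivide n k ρ ε) P'| ≤ 1 :=
    (abs_correlation_sub_grid_le hn hn0 le_rfl h'.const h'.supp h'.abs_le h'.integrable hP
      ha1 ha2).trans hinv1
  have he2 : |correlation ρ P - correlation ρ P'| ≤ 1 :=
    (abs_correlation_sub_grid_le hn hn0 le_rfl
      (fun y y' hy => h.const y y' (floor_eq_of_floor_succ_eq hy)) h.supp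
      (fun y => (h.abs_le y).trans (pow_le_pow_right₀ (by norm_num) (by omega))) h.integrable hP
      ha1 ha2).trans hinv1
  have hsep' : ∀ i j, i ≠ j → τ / 2 ≤ |(P' i).1 - (P' j).1| := by
    intro i j hij
    have h1 := hsep i j hij
    have h4 : 4 * ((gridSize n k : ℕ) : ℝ)⁻¹ ≤ τ := by
      refine le_trans ?_ hτQ
      unfold gridSize
      push_cast
      rw [← div_eq_mul_inv, div_le_iff₀ (by positivity), ← div_eq_inv_mul,
        le_div_iff₀ (by positivity), show (4 : ℝ) = 2 ^ 2 by norm_num, ← pow_add]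
      exact pow_le_pow_right₀ (by norm_num) (by nlinarith [Nat.zero_le (n * k)])
    have h5 := abs_le.1 (ha1 i)
    have h6 := abs_le.1 (ha1 j)
    have h7 : |(P i).1 - (P j).1| ≤ |(P' i).1 - (P' j).1| + 2 * ((gridSize n k : ℕ) : ℝ)⁻¹ := by
      calc _ = |((P' i).1 - (P' j).1) + (((P i).1 - (P' i).1) - ((P j).1 - (P' j).1))| := by
            congr 1; ring
        _ ≤ _ := by
            refine (abs_add_le _ _).trans (add_le_add le_rfl ?_)
            refine (abs_sub _ _).trans ?_
            linarith [ha1 i, ha1 j]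
    linarith
  have hsplit : correlation (subdivide n k ρ ε) P' =
      (∑ S : Finset (Fin n), chaos n k ρ P' S ε) + ∫ z, (distinctBlocks n k P')ᶜ.indicator
        (fun z => ∏ i, subdivide n k ρ ε (affineCoord (P' i) z)) z := by
    have hi := h'.integrable_prod hP'2 hn0
    have hm := measurableSet_distinctBlocks n k P'
    rw [← h.integral_indicator_subdivide_eq hP'2 hn0 hε,
      ← integral_add (hi.indicator hm) (hi.indicator hm.compl)]
    unfold correlation
    congr 1
    ext z
    by_cases hz : z ∈ distinctBlocks n k P' <;> simp [hz]
  have hbad : ∫ z, (distinctBlocks n k P')ᶜ.indicator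
        (fun z => ∏ i, subdivide n k ρ ε (affineCoord (P' i) z)) z ≤
        128 * n ^ 2 * 2 ^ (n + 2) * T := by
    have h1 := h'.integral_indicator_compl_le (j := k) (R := 128 * Q⁻¹ * τ⁻¹) (by omega) hP'2 hn0
      (half_pos hτ) (by
        have : 1 ≤ τ⁻¹ := (one_le_inv₀ hτ).2 hτ1
        have : 0 < Q⁻¹ := by positivity
        nlinarith) (le_of_eq (by rw [← hQ]; field_simp; norm_num)) hsep'
    refine h1.trans ?_
    have h2 : (128 * Q⁻¹ * τ⁻¹) ^ s ≤ 128 * ((2 ^ (k + 1)) ^ (n - 1))⁻¹ * T := by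
      rw [Real.mul_rpow (by positivity) (by positivity), Real.mul_rpow (by positivity)
        (by positivity), inv_two_pow_rpow hn0, hT, Real.rpow_neg hτ.le, Real.inv_rpow hτ.le]
      gcongr
      exact Real.rpow_le_self_of_one_le (by norm_num) hs1
    calc _ ≤ n * n * ((2 ^ (k + 1)) ^ (n - 1) *
          (2 ^ (n + 2) * (128 * ((2 ^ (k + 1)) ^ (n - 1))⁻¹ * T))) := by gcongr
      _ = _ := by field_simp
  set Zp := correlation ρ P' with hZp
  have hZp0 : 0 ≤ Zp := integral_nonneg fun z => h.prod_nonneg P' z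
  have hZpP : Zp ≤ K * L ^ 3 * T + 1 := by
    have h1 := hZ P hP τ hτ hτ1 hsep
    rw [← hs, ← hL] at h1
    linarith [(abs_le.1 he2).1]
  have hS : ∀ S : Finset (Fin n), S.Nonempty →
      |chaos n k ρ P' S ε| ≤ 2 ^ n * (2 * n) * C₁ * L ^ 2 + Zp / (2 ^ n * L) := by
    intro S hS
    have h1 := hch a S hS
    have h2 := h.integral_abs_chaosWeight_le hP'2 hn0 S
    have h2' : 0 ≤ ∫ z, |chaosWeight n k ρ P' S z| := integral_nonneg fun z => abs_nonneg _
    have h3 : (n : ℝ) * (4 / Q * (2 ^ k) ^ n) ≤ 4 * n := by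
      have : ((2 : ℝ) ^ k) ^ n ≤ Q := by
        rw [← pow_mul, hQ, mul_comm]
        exact pow_le_pow_right₀ (by norm_num) (Nat.mul_le_mul_left _ (by omega))
      have : 4 / Q * (2 ^ k) ^ n ≤ 4 := by
        rw [div_mul_eq_mul_div, div_le_iff₀ hQ0]; linarith
      nlinarith
    set θi : ℝ := 2 ^ n * (2 * n) * L with hθi
    have hθ0 : 0 < θi := by positivity
    have h4 : (n * (4 / Q * (2 ^ k) ^ n)) * ∫ z, |chaosWeight n k ρ P' S z| ≤ 4 * n * Zp :=
      mul_le_mul h3 h2 h2' (by positivity)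
    have h5 : θi⁻¹ * |chaos n k ρ P' S ε| ≤ C₁ * L + θi⁻¹ ^ 2 / 2 * (4 * n * Zp) :=
      h1.trans (by gcongr)
    rw [← div_eq_inv_mul, div_le_iff₀ hθ0] at h5
    refine h5.trans (le_of_eq ?_)
    rw [hθi]
    field_simp
    ring
  have hempty : |chaos n k ρ P' ∅ ε| ≤ Zp := by
    unfold chaos
    simp only [Finset.prod_empty, mul_one]
    exact (abs_integral_le_integral_abs).trans (h.integral_abs_chaosWeight_le hP'2 hn0 ∅)
  have hsum : ∑ S : Finset (Fin n), chaos n k ρ P' S ε ≤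
      Zp + 2 ^ n * (2 ^ n * (2 * n) * C₁ * L ^ 2 + Zp / (2 ^ n * L)) := by
    set E : ℝ := 2 ^ n * (2 * n) * C₁ * L ^ 2 + Zp / (2 ^ n * L) with hE
    have hE0 : 0 ≤ E := by positivity
    calc _ ≤ ∑ S : Finset (Fin n), ((if S = ∅ then Zp else 0) + E) := by
          refine Finset.sum_le_sum fun S _ => ?_
          by_cases hSe : S = ∅
          · subst hSe
            simp only [if_true]
            linarith [le_abs_self (chaos n k ρ P' ∅ ε)]
          · simp only [hSe, if_false, zero_add]
            exact (le_abs_self _).trans (hS S (Finset.nonempty_iff_ne_empty.2 hSe))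
      _ = _ := by
          rw [Finset.sum_add_distrib]
          simp
  have e1 : 2 ^ n * (2 ^ n * (2 * n) * C₁ * L ^ 2 + Zp / (2 ^ n * L)) =
      4 ^ n * (2 * n) * C₁ * L ^ 2 + Zp / L := by
    have : (4 : ℝ) ^ n = 2 ^ n * 2 ^ n := by rw [← mul_pow]; norm_num
    rw [this, mul_add, mul_div_assoc', mul_div_mul_left _ _ (by positivity)]
    ring
  have e2 : Zp / L ≤ K * L ^ 2 * T + 1 := by
    rw [div_le_iff₀ (by linarith)]
    have : (K * L ^ 2 * T + 1) * L = K * L ^ 3 * T + L := by ring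
    linarith
  rw [e1] at hsum
  have hL2 : 1 ≤ L ^ 2 := one_le_pow₀ hL1
  have hL2T : 1 ≤ L ^ 2 * T := by nlinarith
  have f1 : 128 * (n : ℝ) ^ 2 * 2 ^ (n + 2) * T ≤ 128 * n ^ 2 * 2 ^ (n + 2) * (L ^ 2 * T) := by
    have : T ≤ L ^ 2 * T := by nlinarith
    gcongr
  have f2 : 4 ^ n * (2 * n) * C₁ * L ^ 2 ≤ 4 ^ n * (2 * n) * C₁ * (L ^ 2 * T) := by
    have : L ^ 2 ≤ L ^ 2 * T := by nlinarith
    gcongr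
  have f3 : correlation (subdivide n k ρ ε) P ≤ K * L ^ 3 * T + 2 * K * (L ^ 2 * T) := by
    have := (abs_le.1 he1).2
    rw [hsplit] at this
    have e3 : K * (L ^ 2 * T) = 128 * n ^ 2 * 2 ^ (n + 2) * (L ^ 2 * T) +
      4 ^ n * (2 * n) * C₁ * (L ^ 2 * T) + 4 * (L ^ 2 * T) := by rw [hKe]; ring
    linarith
  refine f3.trans ?_
  have : K * (L + 1) ^ 3 * T = K * L ^ 3 * T + 3 * K * (L ^ 2 * T) + K * T * (3 * L + 1) := by ring
  rw [this]
  have g1 : 0 ≤ K * (L ^ 2 * T) := by positivity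
  have g2 : 0 ≤ K * T * (3 * L + 1) := by positivity
  linarith

/-- The constant in the decay of the correlation of two separated copies of a martingale
difference. -/
noncomputable def pairConst (n : ℕ) : ℝ :=
  ((12 * n ^ 2 + 3 * n + 2 : ℕ) : ℝ) + 2 + 512 * 2 ^ (n + 2)

theorem abs_subdivide_sub {n k : ℕ} {ρ : ℝ → ℝ} (h : IsLevel n k ρ) {ε : ℕ → ℝ} (hε : IsSigns ε)
    (y : ℝ) : |subdivide n k ρ ε y - ρ y| = ρ y := by
  unfold subdivide
  rw [show ρ y * (1 + ε (block n k y) * haar n k y) - ρ y =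
    ρ y * (ε (block n k y) * haar n k y) by ring, abs_mul, abs_mul, hε.abs_eq, abs_haar,
    abs_of_nonneg (h.nonneg y)]
  ring

theorem abs_correlation_pair_le {n k : ℕ} {ρ : ℝ → ℝ} (hn : 4 ≤ n) (h : IsLevel n k ρ)
    {ε : ℕ → ℝ} (hε : IsSigns ε)
    (hch : ∀ P : Fin 2 → Fin (gridSize n k + 1) × Fin (gridSize n k + 1),
        (2 : ℝ) ^ ((k : ℝ) / 2) * |chaos n k ρ (fun i => gridPoint _ (P i)) Finset.univ ε| ≤
          ((12 * n ^ 2 + 3 * n + 2 : ℕ) : ℝ) * (k + 1) + ((2 : ℝ) ^ ((k : ℝ) / 2)) ^ 2 / 2 *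
            (((2 : ℕ) * (4 / 2 ^ (n * (k + 1)) * (2 ^ k) ^ 2)) *
              ∫ z, |chaosWeight n k ρ (fun i => gridPoint _ (P i)) Finset.univ z|))
    {P : Fin 2 → ℝ × ℝ} (hP : ∀ i, P i ∈ paramBox)
    (hsep : ((4 : ℝ) ^ k)⁻¹ ≤ |(P 0).1 - (P 1).1|) :
    |correlation (fun y => subdivide n k ρ ε y - ρ y) P| ≤
      pairConst n * (k + 1) * (2 : ℝ) ^ (-(k : ℝ) / 2) := by
  have hn0 : 0 < n := by omega
  have hn4 : (4 : ℝ) ≤ n := by exact_mod_cast hn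
  have h' := isLevel_subdivide (by omega) h hε
  obtain ⟨hs0, hs1⟩ := one_sub_inv_mem (n := n) hn0
  set σ : ℝ → ℝ := fun y => subdivide n k ρ ε y - ρ y with hσ
  have habs : ∀ y, |σ y| = ρ y := abs_subdivide_sub h hε
  set s : ℝ := 1 - 1 / (n : ℝ) with hs
  set C₁ : ℝ := ((12 * n ^ 2 + 3 * n + 2 : ℕ) : ℝ) with hC₁
  have hC₁0 : 0 ≤ C₁ := by positivity
  set L : ℝ := (k : ℝ) + 1 with hL
  have hL1 : 1 ≤ L := by rw [hL]; linarith [Nat.cast_nonneg (α := ℝ) k]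
  set b : ℝ := (2 : ℝ) ^ ((k : ℝ) / 2) with hb
  have hb0 : 0 < b := by positivity
  have hbi : (2 : ℝ) ^ (-(k : ℝ) / 2) = b⁻¹ := by
    rw [hb, ← Real.rpow_neg (by norm_num)]; congr 1; ring
  have hb2 : b ^ 2 = 2 ^ k := by
    rw [hb, ← Real.rpow_natCast, ← Real.rpow_mul (by norm_num), ← Real.rpow_natCast]
    congr 1; push_cast; ring
  rw [hbi]
  set Q : ℝ := 2 ^ (n * (k + 1)) with hQ
  have hQ0 : 0 < Q := by positivity
  have hq : 0 < gridSize n k := by unfold gridSize; positivity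
  choose a ha1 ha2 using fun i => exists_gridPoint hq (hP i)
  set P' : Fin 2 → ℝ × ℝ := fun i => gridPoint _ (a i) with hP'
  have hP'b : ∀ i, P' i ∈ paramBox := fun i => gridPoint_mem _ _
  have hP'2 : ∀ i, (P' i).2 ∈ Icc (1 : ℝ) 2 := fun i => (hP'b i).2
  have hσi : Integrable σ := h'.integrable.sub h.integrable
  have he : |correlation σ P - correlation σ P'| ≤ b⁻¹ := by
    refine (abs_correlation_sub_grid_le hn (by norm_num) (by omega) ?_ ?_ ?_ hσi hP
      ha1 ha2).trans ?_
    · intro y y' hy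
      simp only [hσ, h'.const y y' hy, h.const y y' (floor_eq_of_floor_succ_eq hy)]
    · intro y hy
      simp only [hσ, h'.supp y hy, h.supp y hy, sub_zero]
    · intro y
      rw [habs]
      exact (h.le y).trans (pow_le_pow_right₀ (by norm_num) (by omega))
    · gcongr
      rw [hb, ← Real.rpow_natCast]
      apply Real.rpow_le_rpow_of_exponent_le (by norm_num)
      push_cast
      linarith [Nat.cast_nonneg (α := ℝ) k]
  have hsep' : ∀ i j, i ≠ j → ((4 : ℝ) ^ k)⁻¹ / 2 ≤ |(P' i).1 - (P' j).1| := by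
    have h4 : 4 * ((gridSize n k : ℕ) : ℝ)⁻¹ ≤ (4 ^ k)⁻¹ := by
      unfold gridSize
      push_cast
      rw [← div_eq_mul_inv, div_le_iff₀ (by positivity), ← div_eq_inv_mul,
        le_div_iff₀ (by positivity), show (4 : ℝ) = 2 ^ 2 by norm_num, ← pow_mul, ← pow_add]
      exact pow_le_pow_right₀ (by norm_num) (by nlinarith [Nat.zero_le (n * k)])
    have h7 : |(P 0).1 - (P 1).1| ≤ |(P' 0).1 - (P' 1).1| + 2 * ((gridSize n k : ℕ) : ℝ)⁻¹ := by
      calc _ = |((P' 0).1 - (P' 1).1) + (((P 0).1 - (P' 0).1) - ((P 1).1 - (P' 1).1))| := by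
            congr 1; ring
        _ ≤ _ := by
            refine (abs_add_le _ _).trans (add_le_add le_rfl ?_)
            refine (abs_sub _ _).trans ?_
            linarith [ha1 0, ha1 1]
    have h8 : ((4 : ℝ) ^ k)⁻¹ / 2 ≤ |(P' 0).1 - (P' 1).1| := by linarith
    intro i j hij
    fin_cases i <;> fin_cases j
    · exact absurd rfl hij
    · exact h8
    · rw [abs_sub_comm]; exact h8
    · exact absurd rfl hij
  have hprod : ∀ z, ∏ i, |σ (affineCoord (P' i) z)| = ∏ i, ρ (affineCoord (P' i) z) := fun z =>
    Finset.prod_congr rfl fun i _ => habs _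
  have hip : Integrable fun z => ∏ i, σ (affineCoord (P' i) z) :=
    integrable_prod_affineCoord hσi (h'.measurable.sub h.measurable)
      (fun y => (habs y).le.trans (h.le y)) (fun i => by linarith [(hP'2 i).1]) (by norm_num)
  have hm := measurableSet_distinctBlocks n k P'
  have hsplit : correlation σ P' = chaos n k ρ P' Finset.univ ε +
      ∫ z, (distinctBlocks n k P')ᶜ.indicator (fun z => ∏ i, σ (affineCoord (P' i) z)) z := by
    have e : chaos n k ρ P' Finset.univ ε =
        ∫ z, (distinctBlocks n k P').indicator (fun z => ∏ i, σ (affineCoord (P' i) z)) z := by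
      unfold chaos chaosWeight
      congr 1
      ext z
      by_cases hz : z ∈ distinctBlocks n k P'
      · simp only [indicator_of_mem hz, hσ, subdivide]
        rw [← Finset.prod_mul_distrib, ← Finset.prod_mul_distrib]
        exact Finset.prod_congr rfl fun i _ => by ring
      · simp [indicator_of_notMem hz]
    rw [e, ← integral_add (hip.indicator hm) (hip.indicator hm.compl)]
    unfold correlation
    congr 1
    ext z
    by_cases hz : z ∈ distinctBlocks n k P' <;> simp [hz]
  have hbad : |∫ z, (distinctBlocks n k P')ᶜ.indicator
      (fun z => ∏ i, σ (affineCoord (P' i) z)) z| ≤ 512 * 2 ^ (n + 2) * b⁻¹ := by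
    refine (abs_integral_le_integral_abs).trans ?_
    have e : (fun z => |(distinctBlocks n k P')ᶜ.indicator
        (fun z => ∏ i, σ (affineCoord (P' i) z)) z|) = fun z =>
        (distinctBlocks n k P')ᶜ.indicator (fun z => ∏ i, ρ (affineCoord (P' i) z)) z := by
      ext z
      by_cases hz : z ∈ distinctBlocks n k P'
      · simp [hz]
      · rw [indicator_of_mem (by exact hz), indicator_of_mem (by exact hz), Finset.abs_prod, hprod]
    rw [e]
    have h1 := h.integral_indicator_compl_le (j := k) (R := 128 * (4 ^ k * (2 ^ (n * k))⁻¹))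
      (by omega) hP'2 (by norm_num) (τ := ((4 : ℝ) ^ k)⁻¹ / 2) (by positivity) (by
        have : (1 : ℝ) ≤ 4 ^ k := one_le_pow₀ (by norm_num)
        have : (0 : ℝ) < (2 ^ (n * k))⁻¹ := by positivity
        nlinarith) (by
        have : ((2 : ℝ) ^ (n * (k + 1)))⁻¹ ≤ (2 ^ (n * k))⁻¹ := by
          gcongr
          · norm_num
          · omega
        calc _ = 128 * (4 ^ k * ((2 : ℝ) ^ (n * (k + 1)))⁻¹) := by field_simp; norm_num
          _ ≤ _ := by gcongr) hsep'
    refine h1.trans ?_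
    have h2 : (4 : ℝ) ^ k * (2 ^ (n * k))⁻¹ = 2 ^ ((2 - n : ℝ) * k) := by
      rw [show (4 : ℝ) = 2 ^ 2 by norm_num, ← pow_mul, ← Real.rpow_natCast, ← Real.rpow_natCast,
        ← Real.rpow_neg (by norm_num), ← Real.rpow_add (by norm_num)]
      congr 1; push_cast; ring
    have h3 : (2 : ℝ) ^ k * (4 ^ k * (2 ^ (n * k))⁻¹) ^ s ≤ b⁻¹ := by
      rw [h2, ← hbi, ← Real.rpow_mul (by norm_num), ← Real.rpow_natCast,
        ← Real.rpow_add (by norm_num)]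
      apply Real.rpow_le_rpow_of_exponent_le (by norm_num)
      have h5 : 1 + (2 - (n : ℝ)) * s ≤ -1 / 2 := by
        rw [hs]
        have : 1 + (2 - (n : ℝ)) * (1 - 1 / n) - (-1 / 2) = -((n - 4) * (n - 1 / 2)) / n := by
          field_simp; ring
        have h6 : 0 ≤ (n - 4) * ((n : ℝ) - 1 / 2) / n := by
          apply div_nonneg (mul_nonneg _ _) <;> linarith
        have h7 : -((n - 4) * ((n : ℝ) - 1 / 2)) / n = -((n - 4) * ((n : ℝ) - 1 / 2) / n) := by ring
        linarith
      have hk0 := Nat.cast_nonneg (α := ℝ) k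
      nlinarith
    rw [Real.mul_rpow (by norm_num) (by positivity)]
    have h4 : (128 : ℝ) ^ s ≤ 128 := Real.rpow_le_self_of_one_le (by norm_num) hs1
    set X := ((4 : ℝ) ^ k * (2 ^ (n * k))⁻¹) ^ s with hX
    have hX0 : 0 ≤ X := by positivity
    calc _ ≤ ((2 : ℕ) : ℝ) * (2 : ℕ) * ((2 ^ k) ^ (2 - 1) * (2 ^ (n + 2) * (128 * X))) := by
          gcongr
      _ = 512 * 2 ^ (n + 2) * (2 ^ k * X) := by push_cast; norm_num; ring
      _ ≤ _ := by gcongr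
  have hgood : |chaos n k ρ P' Finset.univ ε| ≤ (C₁ * L + 1) * b⁻¹ := by
    have h1 := hch a
    have h2 := h.integral_abs_chaosWeight_le hP'2 (by norm_num) Finset.univ
    have h3 := h.correlation_le hP'b (by norm_num)
    have h4 : b ^ 2 / 2 * (((2 : ℕ) * (4 / Q * (2 ^ k) ^ 2)) *
        ∫ z, |chaosWeight n k ρ P' Finset.univ z|) ≤ 1 := by
      calc _ ≤ b ^ 2 / 2 * (((2 : ℕ) * (4 / Q * (2 ^ k) ^ 2)) * (2 * 2 ^ k)) := by
            gcongr
            exact h2.trans (h3.trans (by simp))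
        _ = 2 ^ 3 * (2 ^ k) ^ 4 / Q := by rw [hb2]; push_cast; ring
        _ ≤ 1 := by
            rw [div_le_one hQ0, hQ, ← pow_mul, ← pow_add]
            exact pow_le_pow_right₀ (by norm_num) (by nlinarith)
    rw [← div_eq_mul_inv, le_div_iff₀ hb0]
    linarith
  have hbi0 : 0 < b⁻¹ := by positivity
  have hfin : |correlation σ P| ≤ (C₁ * L + 1) * b⁻¹ + 512 * 2 ^ (n + 2) * b⁻¹ + b⁻¹ := by
    rw [hsplit] at he
    calc _ = |(correlation σ P - (chaos n k ρ P' Finset.univ ε +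
          ∫ z, (distinctBlocks n k P')ᶜ.indicator (fun z => ∏ i, σ (affineCoord (P' i) z)) z)) +
          (chaos n k ρ P' Finset.univ ε + ∫ z, (distinctBlocks n k P')ᶜ.indicator
            (fun z => ∏ i, σ (affineCoord (P' i) z)) z)| := by congr 1; ring
      _ ≤ _ := (abs_add_le _ _).trans (by
          have := abs_add_le (chaos n k ρ P' Finset.univ ε)
            (∫ z, (distinctBlocks n k P')ᶜ.indicator (fun z => ∏ i, σ (affineCoord (P' i) z)) z)
          linarith)
  refine hfin.trans ?_
  have e : (C₁ * L + 1) * b⁻¹ + 512 * 2 ^ (n + 2) * b⁻¹ + b⁻¹ =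
      (C₁ * L + (2 + 512 * 2 ^ (n + 2))) * b⁻¹ := by ring
  rw [e]
  have e2 : pairConst n * L = C₁ * L + (2 + 512 * 2 ^ (n + 2)) * L := by
    unfold pairConst; ring
  rw [e2]
  gcongr
  exact le_mul_of_one_le_right (by positivity) hL1

theorem exists_level_succ {n k : ℕ} (hn : 4 ≤ n) {ρ : ℝ → ℝ} (h : IsLevel n k ρ)
    (hZ : CorrelationBound n k (corrConst n) ρ) :
    ∃ ρ', IsLevel n (k + 1) ρ' ∧ CorrelationBound n (k + 1) (corrConst n) ρ' ∧
      (∀ a : ℕ, ∫ y in (0 : ℝ)..(a / 2 ^ (n * k)), ρ' y =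
        ∫ y in (0 : ℝ)..(a / 2 ^ (n * k)), ρ y) ∧ (∀ y, |ρ' y - ρ y| = ρ y) ∧
      ∀ P : Fin 2 → ℝ × ℝ, (∀ i, P i ∈ paramBox) → ((4 : ℝ) ^ k)⁻¹ ≤ |(P 0).1 - (P 1).1| →
        |correlation (fun y => ρ' y - ρ y) P| ≤
          pairConst n * (k + 1) * (2 : ℝ) ^ (-(k : ℝ) / 2) := by
  obtain ⟨ε, hε, h1, h2⟩ := exists_signs_grid h (by omega)
    (2 ^ n * (2 * n) * ((k : ℝ) + 1))⁻¹ ((2 : ℝ) ^ ((k : ℝ) / 2))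
  exact ⟨subdivide n k ρ ε, isLevel_subdivide (by omega) h hε,
    correlationBound_subdivide hn h hZ hε h1, integral_subdivide (by omega) h hε,
    abs_subdivide_sub h hε, fun P hP hsep => abs_correlation_pair_le hn h hε h2 hP hsep⟩

/-- A sequence of densities as produced by the random construction. -/
structure IsCantorSequence (n : ℕ) (ρ : ℕ → ℝ → ℝ) : Prop where
  level : ∀ k, IsLevel n k (ρ k)
  correlation : ∀ k, CorrelationBound n k (corrConst n) (ρ k)
  integral_succ : ∀ k (a : ℕ), ∫ y in (0 : ℝ)..(a / 2 ^ (n * k)), ρ (k + 1) y =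
    ∫ y in (0 : ℝ)..(a / 2 ^ (n * k)), ρ k y
  abs_sub : ∀ k y, |ρ (k + 1) y - ρ k y| = ρ k y
  pair : ∀ k, ∀ P : Fin 2 → ℝ × ℝ, (∀ i, P i ∈ paramBox) →
    ((4 : ℝ) ^ k)⁻¹ ≤ |(P 0).1 - (P 1).1| →
      |_root_.correlation (fun y => ρ (k + 1) y - ρ k y) P| ≤
        pairConst n * (k + 1) * (2 : ℝ) ^ (-(k : ℝ) / 2)

theorem exists_isCantorSequence {n : ℕ} (hn : 4 ≤ n) : ∃ ρ, IsCantorSequence n ρ := by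
  choose! next h1 h2 h3 h4 h5 using fun k ρ (h : IsLevel n k ρ ∧
    CorrelationBound n k (corrConst n) ρ) => exists_level_succ hn h.1 h.2
  set ρ : ℕ → ℝ → ℝ := fun k => Nat.rec (indicator (Ico (1 : ℝ) 2) 1) (fun k ρ => next k ρ) k
    with hρ
  have hk : ∀ k, IsLevel n k (ρ k) ∧ CorrelationBound n k (corrConst n) (ρ k) := by
    intro k
    induction k with
    | zero => exact ⟨isLevel_zero n, correlationBound_zero (by omega)⟩
    | succ k ih => exact ⟨h1 k _ ih, h2 k _ ih⟩
  exact ⟨ρ, fun k => (hk k).1, fun k => (hk k).2, fun k => h3 k _ (hk k), fun k => h4 k _ (hk k),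
    fun k => h5 k _ (hk k)⟩

/-- A limit measure of a sequence of densities. -/
structure IsCantorMeasure (n : ℕ) (ρ : ℕ → ℝ → ℝ) (ν : Measure ℝ) : Prop where
  univ_eq : ν univ = 1
  Icc_le : ∀ u v, u ≤ v → ν (Icc u v) ≤
    ENNReal.ofReal (2 ^ (n + 1) * (v - u) ^ (1 - 1 / (n : ℝ)))
  cell : ∀ j (a : ℕ), ν (Ico (a / 2 ^ (n * j)) ((a + 1) / 2 ^ (n * j))) =
    ENNReal.ofReal (∫ y in (a / 2 ^ (n * j) : ℝ)..((a + 1) / 2 ^ (n * j)), ρ j y)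
  compl_eq : ν (Icc 1 2)ᶜ = 0

theorem tendsto_inv_two_pow {n : ℕ} (hn : 1 ≤ n) :
    Filter.Tendsto (fun k : ℕ => ((2 : ℝ) ^ (n * k))⁻¹) Filter.atTop (nhds 0) := by
  have : (fun k : ℕ => ((2 : ℝ) ^ (n * k))⁻¹) = fun k => (((2 : ℝ) ^ n)⁻¹) ^ k := by
    ext k; rw [pow_mul, inv_pow]
  rw [this]
  exact tendsto_pow_atTop_nhds_zero_of_lt_one (by positivity)
    (inv_lt_one_of_one_lt₀ (one_lt_pow₀ (by norm_num) (by omega)))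

namespace IsCantorSequence

variable {n : ℕ} {ρ : ℕ → ℝ → ℝ}

theorem integral_eq_of_le (h : IsCantorSequence n ρ) {i j : ℕ} (hij : j ≤ i) (a : ℕ) :
    ∫ y in (0 : ℝ)..(a / 2 ^ (n * j)), ρ i y = ∫ y in (0 : ℝ)..(a / 2 ^ (n * j)), ρ j y := by
  induction i, hij using Nat.le_induction with
  | base => rfl
  | succ i hi ih =>
    rw [← ih]
    have := h.integral_succ i (a * 2 ^ (n * (i - j)))
    have e : ((a * 2 ^ (n * (i - j)) : ℕ) : ℝ) / 2 ^ (n * i) = a / 2 ^ (n * j) := by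
      obtain ⟨m, rfl⟩ := Nat.exists_eq_add_of_le hi
      rw [Nat.add_sub_cancel_left, mul_add, pow_add]
      push_cast
      field_simp
    rwa [e] at this

theorem integral_mono (h : IsCantorSequence n ρ) (k : ℕ) :
    Monotone fun x => ∫ y in (0 : ℝ)..x, ρ k y := by
  intro u v huv
  have hi := (h.level k).integrable
  have := intervalIntegral.integral_add_adjacent_intervals (hi.intervalIntegrable (a := 0) (b := u))
    (hi.intervalIntegrable (a := u) (b := v))
  have h0 := intervalIntegral.integral_nonneg (μ := volume) huv fun y _ => (h.level k).nonneg y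
  simp only
  linarith

theorem integral_of_le_one (h : IsCantorSequence n ρ) (k : ℕ) {x : ℝ} (hx : x ≤ 1) :
    ∫ y in (0 : ℝ)..x, ρ k y = 0 := by
  rw [intervalIntegral.integral_congr_ae (g := fun _ => 0)]
  · simp
  · have : ∀ᵐ y : ℝ, y ≠ 1 := by simp [ae_iff]
    filter_upwards [this] with y hy1 hy
    refine (h.level k).supp y fun hy' => ?_
    have h2 : y ≤ max 0 x := hy.2
    exact hy1 (le_antisymm (h2.trans (max_le zero_le_one hx)) hy'.1)

theorem integral_of_two_le (h : IsCantorSequence n ρ) (k : ℕ) {x : ℝ} (hx : 2 ≤ x) :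
    ∫ y in (0 : ℝ)..x, ρ k y = 1 := by
  rw [← (h.level k).total, intervalIntegral.integral_of_le (by linarith)]
  refine setIntegral_eq_integral_of_forall_compl_eq_zero fun y hy =>
    (h.level k).supp y fun hy' => ?_
  exact hy ⟨by linarith [hy'.1], by linarith [hy'.2]⟩

theorem abs_integral_sub_le (h : IsCantorSequence n ρ) {i j : ℕ} (hij : j ≤ i) (x : ℝ) :
    |(∫ y in (0 : ℝ)..x, ρ i y) - ∫ y in (0 : ℝ)..x, ρ j y| ≤ 2 ^ j / 2 ^ (n * j) := by
  have hQ : (0 : ℝ) < 2 ^ (n * j) := by positivity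
  rcases lt_or_ge x 0 with hx | hx
  · rw [h.integral_of_le_one i (by linarith), h.integral_of_le_one j (by linarith)]
    simp only [sub_self, abs_zero]
    positivity
  set a := ⌊x * 2 ^ (n * j)⌋₊ with ha
  have h1 : (a : ℝ) / 2 ^ (n * j) ≤ x := by
    rw [div_le_iff₀ hQ]; exact Nat.floor_le (by positivity)
  have h2 : x ≤ ((a + 1 : ℕ) : ℝ) / 2 ^ (n * j) := by
    rw [le_div_iff₀ hQ]; push_cast; exact (Nat.lt_floor_add_one _).le
  have h3 := h.integral_mono i h1
  have h4 := h.integral_mono i h2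
  have h5 := h.integral_mono j h1
  have h6 := h.integral_mono j h2
  simp only [h.integral_eq_of_le hij] at h3 h4 h5 h6
  have h7 := (h.level j).mass j le_rfl a
  have hi := (h.level j).integrable
  have h8 := intervalIntegral.integral_add_adjacent_intervals
    (hi.intervalIntegrable (a := 0) (b := a / 2 ^ (n * j)))
    (hi.intervalIntegrable (a := a / 2 ^ (n * j)) (b := (a + 1) / 2 ^ (n * j)))
  push_cast at h4 h6
  rw [abs_le]
  constructor <;> linarith

theorem exists_tendsto (hn : 2 ≤ n) (h : IsCantorSequence n ρ) (x : ℝ) :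
    ∃ l, Filter.Tendsto (fun k => ∫ y in (0 : ℝ)..x, ρ k y) Filter.atTop (nhds l) := by
  apply cauchySeq_tendsto_of_complete
  refine cauchySeq_of_le_geometric (1 / 2) 1 (by norm_num) fun k => ?_
  rw [dist_comm, Real.dist_eq]
  refine (h.abs_integral_sub_le (Nat.le_succ k) x).trans ?_
  rw [one_mul, div_pow, one_pow, div_le_div_iff₀ (by positivity) (by positivity),
    one_mul, ← pow_add]
  exact pow_le_pow_right₀ (by norm_num) (by nlinarith)

theorem exists_isCantorMeasure (hn : 2 ≤ n) (h : IsCantorSequence n ρ) :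
    ∃ ν, IsCantorMeasure n ρ ν := by
  choose F hF using h.exists_tendsto hn
  have hn0 : (2 : ℝ) ≤ n := by exact_mod_cast hn
  have hs : 0 < 1 - 1 / (n : ℝ) := by
    rw [sub_pos, div_lt_one (by linarith)]; linarith
  have hmono : Monotone F := fun u v huv =>
    le_of_tendsto_of_tendsto' (hF u) (hF v) fun k => h.integral_mono k huv
  have hhol : ∀ u v, u ≤ v → F v - F u ≤ 2 ^ (n + 1) * (v - u) ^ (1 - 1 / (n : ℝ)) := by
    intro u v huv
    rcases huv.eq_or_lt with rfl | huv
    · simp only [sub_self]; positivity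
    refine le_of_tendsto ((hF v).sub (hF u)) ?_
    have hev : ∀ᶠ k : ℕ in Filter.atTop, ((2 : ℝ) ^ (n * k))⁻¹ < v - u :=
      (tendsto_inv_two_pow (by omega)).eventually_lt_const (by linarith)
    filter_upwards [hev] with k hk
    have h1 := (h.level k).setIntegral_Icc_le (by omega) u v
    rw [max_eq_left hk.le, integral_Icc_eq_integral_Ioc,
      ← intervalIntegral.integral_of_le huv.le] at h1
    have hi := (h.level k).integrable
    have := intervalIntegral.integral_add_adjacent_intervals
      (hi.intervalIntegrable (a := 0) (b := u)) (hi.intervalIntegrable (a := u) (b := v))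
    linarith
  have hcont : Continuous F := by
    rw [continuous_iff_continuousAt]
    intro x
    rw [ContinuousAt, tendsto_iff_dist_tendsto_zero]
    have hlim : Filter.Tendsto (fun y => 2 ^ (n + 1) * |y - x| ^ (1 - 1 / (n : ℝ))) (nhds x)
        (nhds 0) := by
      have : ContinuousAt (fun y => 2 ^ (n + 1) * |y - x| ^ (1 - 1 / (n : ℝ))) x :=
        continuousAt_const.mul (ContinuousAt.rpow_const (by fun_prop) (Or.inr hs.le))
      have := this.tendsto
      simpa only [sub_self, abs_zero, Real.zero_rpow hs.ne', mul_zero] using this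
    refine squeeze_zero (fun y => dist_nonneg) (fun y => ?_) hlim
    rw [Real.dist_eq]
    rcases le_total x y with hxy | hxy
    · rw [abs_of_nonneg (sub_nonneg.2 (hmono hxy)), abs_of_nonneg (sub_nonneg.2 hxy)]
      exact hhol x y hxy
    · rw [abs_sub_comm, abs_of_nonneg (sub_nonneg.2 (hmono hxy)), abs_sub_comm y,
        abs_of_nonneg (sub_nonneg.2 hxy)]
      exact hhol y x hxy
  have h0 : ∀ x ≤ 1, F x = 0 := fun x hx => tendsto_nhds_unique (hF x)
    (tendsto_const_nhds.congr fun k => (h.integral_of_le_one k hx).symm)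
  have h1 : ∀ x, 2 ≤ x → F x = 1 := fun x hx => tendsto_nhds_unique (hF x)
    (tendsto_const_nhds.congr fun k => (h.integral_of_two_le k hx).symm)
  have hgrid : ∀ j (a : ℕ), F (a / 2 ^ (n * j)) = ∫ y in (0 : ℝ)..(a / 2 ^ (n * j)), ρ j y := by
    intro j a
    refine tendsto_nhds_unique (hF _) (tendsto_const_nhds.congr' ?_)
    filter_upwards [Filter.eventually_ge_atTop j] with i hi
    exact (h.integral_eq_of_le hi a).symm
  let G : StieltjesFunction ℝ := ⟨F, hmono, fun x => hcont.continuousWithinAt⟩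
  have hGF : ∀ x, G x = F x := fun x => rfl
  have hleft : ∀ x, Function.leftLim G x = F x := fun x => hcont.continuousWithinAt.leftLim_eq
  have hbot : Filter.Tendsto G Filter.atBot (nhds 0) := by
    refine tendsto_const_nhds.congr' ?_
    filter_upwards [Filter.eventually_le_atBot 1] with x hx
    exact (h0 x hx).symm
  have htop : Filter.Tendsto G Filter.atTop (nhds 1) := by
    refine tendsto_const_nhds.congr' ?_
    filter_upwards [Filter.eventually_ge_atTop 2] with x hx
    exact (h1 x hx).symm
  refine ⟨G.measure, ?_, ?_, ?_, ?_⟩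
  · rw [G.measure_univ hbot htop]; simp
  · intro u v huv
    rw [G.measure_Icc, hleft, hGF]
    exact ENNReal.ofReal_le_ofReal (hhol u v huv)
  · intro j a
    rw [G.measure_Ico, hleft, hleft]
    have hi := (h.level j).integrable
    have := intervalIntegral.integral_add_adjacent_intervals
      (hi.intervalIntegrable (a := 0) (b := a / 2 ^ (n * j)))
      (hi.intervalIntegrable (a := a / 2 ^ (n * j)) (b := (a + 1) / 2 ^ (n * j)))
    have e := hgrid j (a + 1)
    push_cast at e
    rw [e, hgrid j a, ← this, add_sub_cancel_left]
  · have : (Icc (1 : ℝ) 2)ᶜ = Iio 1 ∪ Ioi 2 := by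
      ext x; simp only [mem_compl_iff, mem_Icc, mem_union, mem_Iio, mem_Ioi, not_and_or, not_le]
    rw [this]
    refine measure_union_null ?_ ?_
    · rw [G.measure_Iio hbot, hleft, h0 1 le_rfl]; simp
    · rw [G.measure_Ioi htop, hGF, h1 2 le_rfl]; simp

end IsCantorSequence

theorem isClosed_msupport (ν : Measure ℝ) : IsClosed (msupport ν) := by
  rw [← isOpen_compl_iff, Metric.isOpen_iff]
  intro x hx
  simp only [msupport, mem_compl_iff, mem_ofPred_eq, not_forall, not_lt, exists_prop] at hx
  obtain ⟨ε, hε, h0⟩ := hx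
  refine ⟨ε / 2, half_pos hε, fun y hy hy' => ?_⟩
  refine (hy' (ε / 2) (half_pos hε)).not_ge ((measure_mono ?_).trans h0)
  refine Metric.ball_subset_ball' ?_
  have := Metric.mem_ball.1 hy
  linarith

theorem msupport_subset {ν : Measure ℝ} {K : Set ℝ} (hK : IsClosed K) (h : ν Kᶜ = 0) :
    msupport ν ⊆ K := by
  intro x hx
  by_contra hxK
  obtain ⟨ε, hε, hb⟩ := Metric.isOpen_iff.1 hK.isOpen_compl x hxK
  exact (hx ε hε).ne' (measure_mono_null hb h)

theorem msupport_nonempty {ν : Measure ℝ} (h : ν univ ≠ 0) : (msupport ν).Nonempty := by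
  by_contra hne
  rw [not_nonempty_iff_eq_empty] at hne
  apply h
  refine measure_null_of_locally_null _ fun x _ => ?_
  have hx : x ∉ msupport ν := by rw [hne]; exact notMem_empty x
  simp only [msupport, mem_ofPred_eq, not_forall, not_lt, exists_prop] at hx
  obtain ⟨ε, hε, h0⟩ := hx
  exact ⟨Metric.ball x ε, mem_nhdsWithin_of_mem_nhds (Metric.ball_mem_nhds x hε),
    le_antisymm h0 (zero_le)⟩

theorem mem_cell_floor {Q y : ℝ} (hQ : 0 < Q) (hy : 0 ≤ y) :
    y ∈ Ico ((⌊y * Q⌋₊ : ℝ) / Q) ((⌊y * Q⌋₊ + 1) / Q) := by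
  constructor
  · rw [div_le_iff₀ hQ]; exact Nat.floor_le (by positivity)
  · rw [lt_div_iff₀ hQ]; exact Nat.lt_floor_add_one _

theorem floor_eq_of_mem_cell {Q y : ℝ} (hQ : 0 < Q) {a : ℕ}
    (hy : y ∈ Ico ((a : ℝ) / Q) ((a + 1) / Q)) : ⌊y * Q⌋₊ = a := by
  have h1 := (div_le_iff₀ hQ).1 hy.1
  have h2 := (lt_div_iff₀ hQ).1 hy.2
  rw [Nat.floor_eq_iff (le_trans (by positivity) h1)]
  exact ⟨h1, h2⟩

theorem pairwise_disjoint_cell {Q : ℝ} (hQ : 0 < Q) :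
    Pairwise (Function.onFun Disjoint fun a : ℕ => Ico ((a : ℝ) / Q) ((a + 1) / Q)) := by
  intro a b hab
  rw [Function.onFun, Set.disjoint_left]
  intro y hy hy'
  exact hab ((floor_eq_of_mem_cell hQ hy).symm.trans (floor_eq_of_mem_cell hQ hy'))

namespace IsCantorMeasure

variable {n : ℕ} {ρ : ℕ → ℝ → ℝ} {ν : Measure ℝ}

theorem Iio_eq (hν : IsCantorMeasure n ρ ν) : ν (Iio 0) = 0 :=
  measure_mono_null (show Iio (0 : ℝ) ⊆ (Icc 1 2)ᶜ from fun y hy hy' => by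
    linarith [hy'.1, mem_Iio.1 hy]) hν.compl_eq

theorem le_measure (hn : 1 ≤ n) (h : IsCantorSequence n ρ) (hν : IsCantorMeasure n ρ ν) {x r : ℝ}
    (hx : x ∈ msupport ν) (hr : 0 < r) (hr1 : r ≤ 1) :
    ENNReal.ofReal ((2 ^ (n + 2))⁻¹ * r ^ (1 - 1 / (n : ℝ))) ≤ ν (Icc (x - r) (x + r)) := by
  obtain ⟨hs0, hs1⟩ := one_sub_inv_mem (n := n) hn
  set s : ℝ := 1 - 1 / (n : ℝ) with hs
  have hex : ∃ j : ℕ, ((2 : ℝ) ^ (n * j))⁻¹ ≤ r / 2 :=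
    (((tendsto_inv_two_pow hn).eventually_lt_const (half_pos hr)).mono fun k hk => hk.le).exists
  classical
  set j := Nat.find hex with hj
  have hj1 : ((2 : ℝ) ^ (n * j))⁻¹ ≤ r / 2 := Nat.find_spec hex
  have hj0 : j ≠ 0 := by
    intro h0
    rw [h0] at hj1
    norm_num at hj1
    linarith
  have hj2 : r / 2 < ((2 : ℝ) ^ (n * (j - 1)))⁻¹ :=
    not_le.1 (Nat.find_min hex (Nat.sub_lt (Nat.pos_of_ne_zero hj0) one_pos))
  set Q : ℝ := 2 ^ (n * j) with hQ
  have hQ0 : 0 < Q := by positivity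
  have hQ2 : r / 2 < 2 ^ n * Q⁻¹ := by
    refine hj2.trans_eq ?_
    obtain ⟨i, hi⟩ := Nat.exists_eq_succ_of_ne_zero hj0
    rw [hQ, hi, Nat.succ_sub_one, Nat.mul_succ, pow_add]
    field_simp
  obtain ⟨a, ha⟩ : ∃ a : ℕ,
      ν (Metric.ball x (r / 2) ∩ Ico ((a : ℝ) / Q) ((a + 1) / Q)) ≠ 0 := by
    by_contra! hall
    refine (hx (r / 2) (half_pos hr)).ne' ?_
    refine measure_mono_null (t := Iio 0 ∪ ⋃ a : ℕ,
      (Metric.ball x (r / 2) ∩ Ico ((a : ℝ) / Q) ((a + 1) / Q))) (fun y hy => ?_)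
      (measure_union_null hν.Iio_eq (measure_iUnion_null hall))
    rcases lt_or_ge y 0 with hy0 | hy0
    · exact Or.inl hy0
    · exact Or.inr (mem_iUnion.2 ⟨_, hy, mem_cell_floor hQ0 hy0⟩)
  obtain ⟨y, hy, hya⟩ : (Metric.ball x (r / 2) ∩ Ico ((a : ℝ) / Q) ((a + 1) / Q)).Nonempty :=
    nonempty_of_measure_ne_zero ha
  have hcell : ν (Ico ((a : ℝ) / Q) ((a + 1) / Q)) = ENNReal.ofReal (ρ j (a / Q) / Q) := by
    rw [← integral_cell hQ0 (h.level j).const]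
    exact hν.cell j a
  have hpos : ρ j (a / Q) = 2 ^ j := by
    refine ((h.level j).eq_or _).resolve_left fun h0 => ?_
    rw [h0, zero_div, ENNReal.ofReal_zero] at hcell
    exact ha (measure_mono_null inter_subset_right hcell)
  have hsub : Ico ((a : ℝ) / Q) ((a + 1) / Q) ⊆ Icc (x - r) (x + r) := by
    intro z hz
    have h1 := abs_lt.1 (by simpa [Real.dist_eq] using hy : |y - x| < r / 2)
    have h2 : ((a : ℝ) + 1) / Q = a / Q + Q⁻¹ := by rw [add_div, one_div]
    have h3 := hz.2
    have h4 := hya.2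
    rw [h2] at h3 h4
    exact ⟨by linarith [hz.1, hya.1], by linarith [hz.1, hya.1]⟩
  refine le_trans ?_ (measure_mono hsub)
  rw [hcell, hpos]
  apply ENNReal.ofReal_le_ofReal
  have e : (2 : ℝ) ^ j / Q = Q⁻¹ ^ s := by
    rw [hQ, hs, inv_two_pow_rpow hn]
    obtain ⟨m, rfl⟩ := Nat.exists_eq_add_of_le hn
    rw [Nat.add_sub_cancel_left, ← pow_mul, add_mul, one_mul, pow_add, mul_comm m]
    field_simp
  rw [e]
  have h1 : r ^ s ≤ (2 ^ (n + 1) * Q⁻¹) ^ s := by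
    apply Real.rpow_le_rpow hr.le _ hs0
    rw [pow_succ]; linarith
  rw [Real.mul_rpow (by positivity) (by positivity)] at h1
  have h2 : ((2 : ℝ) ^ (n + 1)) ^ s ≤ 2 ^ (n + 1) :=
    Real.rpow_le_self_of_one_le (one_le_pow₀ (by norm_num)) hs1
  have h3 : 0 ≤ Q⁻¹ ^ s := by positivity
  rw [inv_mul_le_iff₀ (by positivity)]
  calc r ^ s ≤ 2 ^ (n + 1) * Q⁻¹ ^ s := h1.trans (by gcongr)
    _ ≤ _ := by gcongr <;> norm_num

theorem isAhlforsRegular (hn : 1 ≤ n) (h : IsCantorSequence n ρ) (hν : IsCantorMeasure n ρ ν) :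
    IsAhlforsRegular ν (1 - 1 / (n : ℝ)) := by
  obtain ⟨hs0, hs1⟩ := one_sub_inv_mem (n := n) hn
  refine ⟨2 ^ (n + 2), one_le_pow₀ (by norm_num), fun x hx r hr hr1 =>
    ⟨hν.le_measure hn h hx hr hr1, (hν.Icc_le _ _ (by linarith)).trans
      (ENNReal.ofReal_le_ofReal ?_)⟩⟩
  rw [show x + r - (x - r) = 2 * r by ring, Real.mul_rpow (by norm_num) hr.le, ← mul_assoc,
    pow_succ _ (n + 1)]
  gcongr
  exact Real.rpow_le_self_of_one_le (by norm_num) hs1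

/-- The measure of an open set is controlled by the densities. -/
theorem measure_le_iSup (hn : 1 ≤ n) (h : IsCantorSequence n ρ) (hν : IsCantorMeasure n ρ ν)
    {V : Set ℝ} (hV : IsOpen V) : ν V ≤ ⨆ j, ∫⁻ y in V, ENNReal.ofReal (ρ j y) := by
  set cell : ℕ → ℕ → Set ℝ := fun j a => Ico ((a : ℝ) / 2 ^ (n * j)) ((a + 1) / 2 ^ (n * j))
    with hcell
  set W : ℕ → Set ℝ := fun j => ⋃ a ∈ {a : ℕ | cell j a ⊆ V}, cell j a with hW
  have hQ : ∀ j, (0 : ℝ) < 2 ^ (n * j) := fun j => by positivity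
  have hm : ∀ j a, MeasurableSet (cell j a) := fun j a => measurableSet_Ico
  have hWm : ∀ j, MeasurableSet (W j) := fun j =>
    MeasurableSet.biUnion (to_countable _) fun a _ => hm j a
  have hWV : ∀ j, W j ⊆ V := fun j => iUnion₂_subset fun a ha => ha
  have hdisj : ∀ j, {a : ℕ | cell j a ⊆ V}.PairwiseDisjoint (cell j) := fun j a _ b _ hab =>
    pairwise_disjoint_cell (hQ j) hab
  have hνW : ∀ j, ν (W j) = ∫⁻ y in W j, ENNReal.ofReal (ρ j y) := by
    intro j
    rw [hW, measure_biUnion (to_countable _) (hdisj j) fun a _ => hm j a]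
    simp only
    rw [lintegral_biUnion (to_countable _) (fun a _ => hm j a) (hdisj j)]
    congr 1
    ext a
    rw [hν.cell j a, intervalIntegral.integral_of_le (by gcongr; linarith),
      ← integral_Ico_eq_integral_Ioc,
      ofReal_integral_eq_lintegral_ofReal (h.level j).integrable.integrableOn
        (ae_of_all _ (h.level j).nonneg)]
  have hmem : ∀ y ∈ V, 0 ≤ y → ∀ᶠ j in Filter.atTop, y ∈ W j := by
    intro y hy hy0
    obtain ⟨ε, hε, hb⟩ := Metric.isOpen_iff.1 hV y hy
    filter_upwards [(tendsto_inv_two_pow hn).eventually_lt_const hε] with j hj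
    have hyc := mem_cell_floor (hQ j) hy0
    refine mem_iUnion₂.2 ⟨_, fun z hz => hb ?_, hyc⟩
    rw [Metric.mem_ball, Real.dist_eq, abs_lt]
    have h2 : ∀ b : ℝ, (b + 1) / 2 ^ (n * j) = b / 2 ^ (n * j) + ((2 : ℝ) ^ (n * j))⁻¹ :=
        fun b => by
      rw [add_div, one_div]
    have h3 := hz.2
    have h4 := hyc.2
    rw [h2] at h3 h4
    exact ⟨by linarith [hz.1, hyc.1], by linarith [hz.1, hyc.1]⟩
  calc ν V ≤ ν (V ∩ Ici 0) := by
        have := measure_le_inter_add_sdiff ν V (Ici 0)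
        have h0 : ν (V \ Ici 0) = 0 :=
          measure_mono_null (show V \ Ici 0 ⊆ Iio 0 from fun y hy => by simpa using hy.2) hν.Iio_eq
        rwa [h0, add_zero] at this
    _ = ∫⁻ y, (V ∩ Ici 0).indicator 1 y ∂ν := by
        rw [lintegral_indicator_one (hV.measurableSet.inter measurableSet_Ici)]
    _ ≤ ∫⁻ y, Filter.liminf (fun j => (W j).indicator (1 : ℝ → ℝ≥0∞) y) Filter.atTop ∂ν := by
        refine lintegral_mono fun y => ?_
        by_cases hy : y ∈ V ∩ Ici 0
        · rw [indicator_of_mem hy]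
          refine Filter.le_liminf_of_le (by isBoundedDefault) ?_
          filter_upwards [hmem y hy.1 hy.2] with j hj
          rw [indicator_of_mem hj]
        · rw [indicator_of_notMem hy]; exact zero_le
    _ ≤ Filter.liminf (fun j => ∫⁻ y, (W j).indicator (1 : ℝ → ℝ≥0∞) y ∂ν) Filter.atTop :=
        lintegral_liminf_le fun j => measurable_one.indicator (hWm j)
    _ = Filter.liminf (fun j => ν (W j)) Filter.atTop := by
        simp_rw [lintegral_indicator_one (hWm _)]
    _ ≤ ⨆ j, ν (W j) := by
        refine Filter.liminf_le_of_frequently_le' (Filter.Frequently.of_forall fun j =>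
          le_iSup (fun j => ν (W j)) j)
    _ ≤ _ := by
        refine iSup_mono fun j => ?_
        rw [hνW j]
        exact lintegral_mono_set (hWV j)

end IsCantorMeasure

theorem pow_setIntegral_le {h : ℝ → ℝ} (h0 : ∀ z, 0 ≤ h z) (hi : Integrable h) {m : ℕ}
    (hm : 1 ≤ m) (him : Integrable fun z => h z ^ m) {U : Set ℝ}
    (hUf : volume U ≠ ∞) :
    (∫ z in U, h z) ^ m ≤ volume.real U ^ (m - 1) * ∫ z, h z ^ m := by
  set I := ∫ z in U, h z with hI
  have hI0 : 0 ≤ I := integral_nonneg h0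
  have hR0 : 0 ≤ ∫ z, h z ^ m := integral_nonneg fun z => pow_nonneg (h0 z) m
  rcases hI0.eq_or_lt with hIz | hIp
  · rw [← hIz, zero_pow (by omega)]; positivity
  have hV : 0 < volume.real U := by
    refine lt_of_le_of_ne measureReal_nonneg fun hz => hIp.ne' ?_
    have : volume U = 0 := (measureReal_eq_zero_iff hUf).1 hz.symm
    rw [hI, Measure.restrict_eq_zero.2 this, integral_zero_measure]
  set V := volume.real U with hVd
  set t := I / V with ht
  have ht0 : 0 < t := by positivity
  have htan : ∀ z, t ^ m + m * t ^ (m - 1) * (h z - t) ≤ h z ^ m := by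
    intro z
    have hb := one_add_mul_le_pow (a := h z / t - 1) (by
      have : 0 ≤ h z / t := div_nonneg (h0 z) ht0.le
      linarith) m
    have e : h z ^ m = t ^ m * (1 + (h z / t - 1)) ^ m := by
      rw [← mul_pow]; congr 1; field_simp; ring
    rw [e]
    refine le_trans (le_of_eq ?_) (mul_le_mul_of_nonneg_left hb (by positivity))
    obtain ⟨l, rfl⟩ := Nat.exists_eq_add_of_le hm
    rw [Nat.add_sub_cancel_left, pow_add, pow_one]
    field_simp
  have : IsFiniteMeasure (volume.restrict U) := ⟨by simpa using hUf.lt_top⟩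
  have hsub : Integrable (fun z => h z - t) (volume.restrict U) :=
    hi.integrableOn.sub (integrable_const _)
  have h1 : ∫ z in U, (t ^ m + m * t ^ (m - 1) * (h z - t)) ≤ ∫ z in U, h z ^ m :=
    integral_mono ((integrable_const _).add (hsub.const_mul _)) him.integrableOn htan
  rw [integral_add (integrable_const _) (hsub.const_mul _),
    integral_const_mul, integral_sub hi.integrableOn (integrable_const _)] at h1
  simp only [integral_const, measureReal_restrict_apply_univ, smul_eq_mul] at h1
  rw [← hVd, ← hI, show I - V * t = 0 by rw [ht]; field_simp; ring, mul_zero, add_zero] at h1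
  have h2 : ∫ z in U, h z ^ m ≤ ∫ z, h z ^ m :=
    setIntegral_le_integral him (ae_of_all _ fun z => pow_nonneg (h0 z) m)
  calc I ^ m = V ^ (m - 1) * (V * t ^ m) := by
        rw [← mul_assoc, ← pow_succ, Nat.sub_add_cancel hm, ← mul_pow, ht]
        congr 1; field_simp
    _ ≤ _ := by gcongr; exact h1.trans h2

section Duality

variable {ι : Type*} [Fintype ι] {P : ι → ℝ × ℝ} {g : ℝ → ℝ} {B : ℝ} {U : Set ℝ}

theorem integrable_pow_sum_affineCoord (hP : ∀ c, P c ∈ paramBox) (hg : Integrable g)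
    (hgm : Measurable g) (hB : ∀ y, |g y| ≤ B) (θ : ι → ℝ) {m : ℕ} (hm : 1 ≤ m) :
    Integrable (fun z => (∑ c, θ c * g (affineCoord (P c) z)) ^ m) ∧
      ∫ z, (∑ c, θ c * g (affineCoord (P c) z)) ^ m =
        ∑ p : Fin m → ι, (∏ i, θ (p i)) * correlation g (fun i => P (p i)) := by
  have e : ∀ z, (∑ c, θ c * g (affineCoord (P c) z)) ^ m =
      ∑ p : Fin m → ι, (∏ i, θ (p i)) * ∏ i, g (affineCoord (P (p i)) z) := by
    intro z
    rw [Fintype.sum_pow]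
    simp_rw [Finset.prod_mul_distrib]
  have hi : ∀ p : Fin m → ι, Integrable fun z =>
      (∏ i, θ (p i)) * ∏ i, g (affineCoord (P (p i)) z) := fun p =>
    (integrable_prod_affineCoord (P := fun i => P (p i)) hg hgm hB
      (fun i => by linarith [(hP (p i)).2.1]) hm).const_mul _
  simp_rw [e]
  refine ⟨integrable_finsetSum _ fun p _ => hi p, ?_⟩
  rw [integral_finsetSum _ fun p _ => hi p]
  simp_rw [integral_const_mul]
  rfl

theorem pow_sum_setIntegral_le (hP : ∀ c, P c ∈ paramBox) (hg : Integrable g)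
    (hgm : Measurable g) (hB : ∀ y, |g y| ≤ B) (hg0 : ∀ y, 0 ≤ g y) {m : ℕ} (hm : 1 ≤ m)
    (hU : volume U ≠ ∞) :
    (∑ c, ∫ z in U, g (affineCoord (P c) z)) ^ m ≤
      volume.real U ^ (m - 1) * ∑ p : Fin m → ι, correlation g (fun i => P (p i)) := by
  have hi : ∀ c, Integrable fun z => g (affineCoord (P c) z) := fun c =>
    integrable_comp_affineCoord (by linarith [(hP c).2.1]) hg
  obtain ⟨h1, h2⟩ := integrable_pow_sum_affineCoord hP hg hgm hB (fun _ => 1) hm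
  simp only [one_mul, Finset.prod_const_one] at h1 h2
  rw [← h2, ← integral_finsetSum _ fun c _ => (hi c).integrableOn]
  exact pow_setIntegral_le (fun z => Finset.sum_nonneg fun c _ => hg0 _)
    (integrable_finsetSum _ fun c _ => hi c) hm h1 hU

theorem sq_sum_abs_setIntegral_le (hP : ∀ c, P c ∈ paramBox) (hg : Integrable g)
    (hgm : Measurable g) (hB : ∀ y, |g y| ≤ B) (hU : volume U ≠ ∞) :
    (∑ c, |∫ z in U, g (affineCoord (P c) z)|) ^ 2 ≤
      volume.real U * ∑ p : Fin 2 → ι, |correlation g (fun i => P (p i))| := by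
  have hi : ∀ c, Integrable fun z => g (affineCoord (P c) z) := fun c =>
    integrable_comp_affineCoord (by linarith [(hP c).2.1]) hg
  set θ : ι → ℝ := fun c => SignType.sign (∫ z in U, g (affineCoord (P c) z)) with hθ
  have hθ1 : ∀ c, |θ c| ≤ 1 := fun c => by
    simp only [hθ]
    rcases lt_trichotomy (∫ z in U, g (affineCoord (P c) z)) 0 with h | h | h
    · simp [sign_neg h]
    · simp [h]
    · simp [sign_pos h]
  obtain ⟨h1, h2⟩ := integrable_pow_sum_affineCoord hP hg hgm hB θ (m := 2) (by norm_num)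
  have his : Integrable fun z => ∑ c, θ c * g (affineCoord (P c) z) :=
    integrable_finsetSum _ fun c _ => (hi c).const_mul _
  have hs := pow_setIntegral_le (m := 2) (fun z => abs_nonneg _) his.abs (by norm_num)
    (by simpa only [sq_abs] using h1) hU
  simp only [sq_abs] at hs
  rw [h2, show 2 - 1 = 1 from rfl, pow_one] at hs
  have e : ∑ c, |∫ z in U, g (affineCoord (P c) z)| ≤
      ∫ z in U, |∑ c, θ c * g (affineCoord (P c) z)| := by
    calc _ = ∫ z in U, ∑ c, θ c * g (affineCoord (P c) z) := by
          rw [integral_finsetSum _ fun c _ => ((hi c).const_mul _).integrableOn]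
          refine Finset.sum_congr rfl fun c _ => ?_
          rw [integral_const_mul]
          exact (sign_mul_self _).symm
      _ ≤ _ := integral_mono his.integrableOn his.abs.integrableOn fun z => le_abs_self _
  refine (pow_le_pow_left₀ (Finset.sum_nonneg fun c _ => abs_nonneg _) e 2).trans
    (hs.trans ?_)
  gcongr with p
  refine (le_abs_self _).trans ?_
  rw [abs_mul, Finset.abs_prod]
  exact mul_le_of_le_one_left (abs_nonneg _)
    (Finset.prod_le_one (fun i _ => abs_nonneg _) fun i _ => hθ1 _)

end Duality

theorem abs_sub_le_of_mem_cell {Q x y : ℝ} (hQ : 0 < Q) {a b : ℕ}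
    (hx : x ∈ Ico ((a : ℝ) / Q) ((a + 1) / Q)) (hy : y ∈ Ico ((b : ℝ) / Q) ((b + 1) / Q)) :
    |(a : ℝ) - b| ≤ |x - y| * Q + 1 := by
  have h1 := (div_le_iff₀ hQ).1 hx.1
  have h2 := (lt_div_iff₀ hQ).1 hx.2
  have h3 := (div_le_iff₀ hQ).1 hy.1
  have h4 := (lt_div_iff₀ hQ).1 hy.2
  have h5 : |x - y| * Q = |x * Q - y * Q| := by
    rw [← sub_mul, abs_mul, abs_of_pos hQ]
  rw [h5, abs_le]
  have h6 := le_abs_self (x * Q - y * Q)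
  have h7 := neg_le_abs (x * Q - y * Q)
  constructor <;> linarith

theorem sum_inv_abs_sub_le {Q a : ℕ} (ha : a < Q) :
    ∑ b ∈ Finset.range Q, (|(a : ℝ) - b| + 1)⁻¹ ≤ 2 * (1 + Real.log Q) := by
  have hh : ∑ m ∈ Finset.range Q, ((m : ℝ) + 1)⁻¹ ≤ 1 + Real.log Q := by
    have := harmonic_le_one_add_log Q
    simpa [harmonic] using this
  have hsplit : ∀ b ∈ Finset.range Q, (|(a : ℝ) - b| + 1)⁻¹ ≤
      (if b ≤ a then (((a - b : ℕ) : ℝ) + 1)⁻¹ else 0) +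
        (if a ≤ b then (((b - a : ℕ) : ℝ) + 1)⁻¹ else 0) := by
    intro b _
    rcases le_total b a with h | h
    · have h0 : (0 : ℝ) ≤ if a ≤ b then (((b - a : ℕ) : ℝ) + 1)⁻¹ else 0 := by
        split_ifs <;> positivity
      rw [if_pos h, Nat.cast_sub h, abs_of_nonneg (sub_nonneg.2 (by exact_mod_cast h))]
      linarith
    · have h0 : (0 : ℝ) ≤ if b ≤ a then (((a - b : ℕ) : ℝ) + 1)⁻¹ else 0 := by
        split_ifs <;> positivity
      rw [if_pos h, Nat.cast_sub h, abs_sub_comm,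
        abs_of_nonneg (sub_nonneg.2 (by exact_mod_cast h))]
      linarith
  refine (Finset.sum_le_sum hsplit).trans ?_
  rw [Finset.sum_add_distrib, two_mul]
  refine add_le_add ?_ ?_ <;> rw [← Finset.sum_filter] <;> refine le_trans ?_ hh
  · rw [← Finset.sum_image (f := fun m : ℕ => ((m : ℝ) + 1)⁻¹) (g := fun b => a - b)]
    · refine Finset.sum_le_sum_of_subset_of_nonneg ?_ fun _ _ _ => by positivity
      intro m hm
      obtain ⟨b, hb, rfl⟩ := Finset.mem_image.1 hm
      exact Finset.mem_range.2 (by omega)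
    · intro b hb b' hb' h
      have h1 := (Finset.mem_filter.1 hb).2
      have h2 := (Finset.mem_filter.1 hb').2
      simp only at h
      omega
  · rw [← Finset.sum_image (f := fun m : ℕ => ((m : ℝ) + 1)⁻¹) (g := fun b => b - a)]
    · refine Finset.sum_le_sum_of_subset_of_nonneg ?_ fun _ _ _ => by positivity
      intro m hm
      obtain ⟨b, hb, rfl⟩ := Finset.mem_image.1 hm
      have := Finset.mem_range.1 (Finset.mem_filter.1 hb).1
      exact Finset.mem_range.2 (by omega)
    · intro b hb b' hb' h
      have h1 := (Finset.mem_filter.1 hb).2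
      have h2 := (Finset.mem_filter.1 hb').2
      simp only at h
      omega

section Counting

variable {ι : Type*} [Fintype ι] {c : ι → ℕ} {n k : ℕ} {P : ι → ℝ × ℝ} {ρ : ℕ → ℝ → ℝ}
  {U : Set ℝ} {lam : ℝ}

theorem sum_rpow_abs_sub_le (hinj : Function.Injective c) {Q a : ℕ} (hc : ∀ i, c i < Q)
    (ha : a < Q) {s : ℝ} (hs0 : 0 ≤ s) (hs1 : s ≤ 1) :
    ∑ i, (|(a : ℝ) - c i| + 1) ^ (-s) ≤
      (Fintype.card ι : ℝ) ^ (1 - s) * (1 + 2 * (1 + Real.log Q)) := by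
  set N := Fintype.card ι with hN
  rcases Nat.eq_zero_or_pos N with h0 | hNp
  · have : IsEmpty ι := Fintype.card_eq_zero_iff.1 h0
    have hQ : (1 : ℝ) ≤ Q := by exact_mod_cast (by omega : 1 ≤ Q)
    have := Real.log_nonneg hQ
    simp only [Finset.univ_eq_empty, Finset.sum_empty]
    positivity
  have hN0 : (0 : ℝ) < N := by exact_mod_cast hNp
  have hterm : ∀ i, (|(a : ℝ) - c i| + 1) ^ (-s) ≤
      (N : ℝ) ^ (1 - s) * ((N : ℝ)⁻¹ + (|(a : ℝ) - c i| + 1)⁻¹) := by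
    intro i
    set u : ℝ := |(a : ℝ) - c i| + 1 with hu
    have hu0 : 0 < u := by positivity
    rw [mul_add]
    rcases le_total u N with h | h
    · have : u ^ (-s) = u ^ (1 - s) * u⁻¹ := by
        rw [← Real.rpow_neg_one u, ← Real.rpow_add hu0]; congr 1; ring
      rw [this]
      have h2 : u ^ (1 - s) ≤ (N : ℝ) ^ (1 - s) := Real.rpow_le_rpow hu0.le h (by linarith)
      have h3 : 0 ≤ (N : ℝ) ^ (1 - s) * (N : ℝ)⁻¹ := by positivity
      have h4 : u ^ (1 - s) * u⁻¹ ≤ (N : ℝ) ^ (1 - s) * u⁻¹ := by gcongr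
      linarith
    · have : (N : ℝ) ^ (1 - s) * (N : ℝ)⁻¹ = (N : ℝ) ^ (-s) := by
        rw [← Real.rpow_neg_one (N : ℝ), ← Real.rpow_add hN0]; congr 1; ring
      rw [this]
      have h2 : u ^ (-s) ≤ (N : ℝ) ^ (-s) :=
        Real.rpow_le_rpow_of_nonpos hN0 h (by linarith)
      have h3 : 0 ≤ (N : ℝ) ^ (1 - s) * u⁻¹ := by positivity
      linarith
  refine (Finset.sum_le_sum fun i _ => hterm i).trans ?_
  rw [← Finset.mul_sum, Finset.sum_add_distrib]
  simp only [Finset.sum_const, Finset.card_univ, nsmul_eq_mul]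
  rw [← hN, mul_inv_cancel₀ hN0.ne']
  gcongr
  refine le_trans ?_ (sum_inv_abs_sub_le ha)
  rw [← Finset.sum_image (s := Finset.univ) (g := c) (f := fun b : ℕ => (|(a : ℝ) - b| + 1)⁻¹)
    hinj.injOn]
  refine Finset.sum_le_sum_of_subset_of_nonneg ?_ fun _ _ _ => by positivity
  intro m hm
  obtain ⟨i, _, rfl⟩ := Finset.mem_image.1 hm
  exact Finset.mem_range.2 (hc i)

theorem card_abs_sub_le (hinj : Function.Injective c) (a M : ℕ) [DecidablePred fun i =>
    |(a : ℝ) - c i| ≤ M] :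
    ((Finset.univ.filter fun i => |(a : ℝ) - c i| ≤ M).card : ℝ) ≤ 2 * M + 1 := by
  have : (Finset.univ.filter fun i => |(a : ℝ) - c i| ≤ M).card ≤
      (Finset.Icc (a - M) (a + M)).card := by
    refine Finset.card_le_card_of_injOn c (fun i hi => ?_) hinj.injOn
    have h := abs_le.1 (Finset.mem_filter.1 hi).2
    have h1 : c i ≤ a + M := by
      have : (c i : ℝ) ≤ ((a + M : ℕ) : ℝ) := by push_cast; linarith
      exact_mod_cast this
    have h2 : a ≤ c i + M := by
      have : (a : ℝ) ≤ ((c i + M : ℕ) : ℝ) := by push_cast; linarith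
      exact_mod_cast this
    exact Finset.mem_coe.2 (Finset.mem_Icc.2 ⟨by omega, h1⟩)
  rw [Nat.card_Icc] at this
  exact_mod_cast this.trans (by omega : a + M + 1 - (a - M) ≤ 2 * M + 1)

theorem card_div_le_one (hinj : Function.Injective c) {Q : ℕ} (hc : ∀ i, c i < Q) :
    (Fintype.card ι : ℝ) / Q ≤ 1 := by
  have : Fintype.card ι ≤ Q := by
    have := Finset.card_le_card_of_injOn (s := Finset.univ) (t := Finset.range Q) c
      (fun i _ => Finset.mem_coe.2 (Finset.mem_range.2 (hc i))) hinj.injOn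
    simpa using this
  refine div_le_one_of_le₀ (by exact_mod_cast this) (by positivity)

theorem sq_mul_card_le (hn : 4 ≤ n) (h : IsCantorSequence n ρ) (hinj : Function.Injective c)
    (hc : ∀ i, c i < 2 ^ (n * k)) (hP : ∀ i, P i ∈ paramBox)
    (hcell : ∀ i, (P i).1 ∈ Ico ((c i : ℝ) / 2 ^ (n * k)) ((c i + 1) / 2 ^ (n * k)))
    (hU : volume U ≠ ∞) (hlam : 0 ≤ lam)
    (hbig : ∀ i, lam ≤ |∫ z in U, (ρ (k + 1) (affineCoord (P i) z) - ρ k (affineCoord (P i) z))|) :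
    lam ^ 2 * ((Fintype.card ι : ℝ) / 2 ^ (n * k)) ≤
      (10 + pairConst n) * (k + 1) * (2 : ℝ) ^ (-(k : ℝ) / 2) * volume.real U := by
  classical
  set N : ℝ := (Fintype.card ι : ℝ) with hN
  set Q : ℝ := 2 ^ (n * k) with hQ
  have hQ0 : 0 < Q := by positivity
  have hN0 : 0 ≤ N := by positivity
  set V := volume.real U with hV
  have hV0 : 0 ≤ V := measureReal_nonneg
  have hK0 : 0 ≤ pairConst n := by unfold pairConst; positivity
  set b : ℝ := (2 : ℝ) ^ (-(k : ℝ) / 2) with hb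
  have hb0 : 0 < b := by positivity
  set D : ℝ := pairConst n * (k + 1) * b with hD
  have hD0 : 0 ≤ D := by positivity
  set σ : ℝ → ℝ := fun y => ρ (k + 1) y - ρ k y with hσ
  have hk := h.level k
  have hk1 := h.level (k + 1)
  have hsq := sq_sum_abs_setIntegral_le (P := P) (g := σ) (B := 2 ^ k) hP
    (hk1.integrable.sub hk.integrable) (hk1.measurable.sub hk.measurable)
    (fun y => (h.abs_sub k y).le.trans (hk.le y)) hU
  have hlow : (lam * N) ^ 2 ≤ (∑ i, |∫ z in U, σ (affineCoord (P i) z)|) ^ 2 := by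
    refine pow_le_pow_left₀ (by positivity) ?_ 2
    calc lam * N = ∑ _i : ι, lam := by simp [hN, mul_comm]
      _ ≤ _ := Finset.sum_le_sum fun i _ => hbig i
  set M : ℕ := 2 * 2 ^ ((n - 2) * k) with hM
  have hcorr : ∀ i j, |correlation σ ![P i, P j]| ≤
      (if |(c i : ℝ) - c j| ≤ M then 2 * (2 : ℝ) ^ k else 0) + D := by
    intro i j
    have hPij : ∀ l, (![P i, P j] : Fin 2 → ℝ × ℝ) l ∈ paramBox := by
      intro l; fin_cases l
      · exact hP i
      · exact hP j
    by_cases hsep : ((4 : ℝ) ^ k)⁻¹ ≤ |(P i).1 - (P j).1|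
    · have := h.pair k ![P i, P j] hPij hsep
      have h0 : (0 : ℝ) ≤ if |(c i : ℝ) - c j| ≤ M then 2 * (2 : ℝ) ^ k else 0 := by
        split_ifs <;> positivity
      linarith
    · have hnear : |(c i : ℝ) - c j| ≤ M := by
        refine (abs_sub_le_of_mem_cell hQ0 (hcell i) (hcell j)).trans ?_
        have h1 : |(P i).1 - (P j).1| * Q ≤ ((4 : ℝ) ^ k)⁻¹ * Q := by
          gcongr; exact (not_le.1 hsep).le
        have h2 : ((4 : ℝ) ^ k)⁻¹ * Q = 2 ^ ((n - 2) * k) := by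
          obtain ⟨m, rfl⟩ := Nat.exists_eq_add_of_le (show 2 ≤ n by omega)
          rw [hQ, Nat.add_sub_cancel_left, add_mul, pow_add, pow_mul 2 2 k]
          norm_num
        have h3 : (1 : ℝ) ≤ 2 ^ ((n - 2) * k) := one_le_pow₀ (by norm_num)
        rw [hM]; push_cast
        linarith
      rw [if_pos hnear]
      have h1 : |correlation σ ![P i, P j]| ≤ correlation (ρ k) ![P i, P j] := by
        refine (abs_integral_le_integral_abs).trans (le_of_eq ?_)
        unfold correlation
        congr 1
        ext z
        rw [Finset.abs_prod]
        exact Finset.prod_congr rfl fun l _ => h.abs_sub k _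
      have h2 := hk.correlation_le hPij (by norm_num)
      simp only [Nat.add_one_sub_one, pow_one] at h2
      linarith
  have hsum : ∑ p : Fin 2 → ι, |correlation σ (fun l => P (p l))| ≤
      N * (5 * 2 ^ ((n - 2) * k) * (2 * 2 ^ k) + N * D) := by
    rw [← (finTwoArrowEquiv ι).symm.sum_comp, Fintype.sum_prod_type]
    have e : ∀ i j, (fun l => P ((finTwoArrowEquiv ι).symm (i, j) l)) = ![P i, P j] := by
      intro i j; ext l <;> fin_cases l <;> rfl
    simp_rw [e]
    calc _ ≤ ∑ _i : ι, (5 * 2 ^ ((n - 2) * k) * (2 * (2 : ℝ) ^ k) + N * D) := by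
          refine Finset.sum_le_sum fun i _ => ?_
          refine (Finset.sum_le_sum fun j _ => hcorr i j).trans ?_
          rw [Finset.sum_add_distrib, ← Finset.sum_filter, Finset.sum_const, Finset.sum_const,
            nsmul_eq_mul, nsmul_eq_mul, Finset.card_univ, ← hN]
          have hcard := card_abs_sub_le hinj (c i) M
          have h3 : (1 : ℝ) ≤ 2 ^ ((n - 2) * k) := one_le_pow₀ (by norm_num)
          gcongr
          refine hcard.trans ?_
          rw [hM]; push_cast
          linarith
      _ = _ := by rw [Finset.sum_const, nsmul_eq_mul, Finset.card_univ, ← hN]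
  have hmain : (lam * N) ^ 2 ≤ V * (N * (5 * 2 ^ ((n - 2) * k) * (2 * 2 ^ k) + N * D)) :=
    hlow.trans (hsq.trans (by gcongr))
  rcases hN0.eq_or_lt with hNz | hNp
  · rw [← hNz, zero_div, mul_zero]; positivity
  have h1 : lam ^ 2 * N ≤ V * (5 * 2 ^ ((n - 2) * k) * (2 * 2 ^ k) + N * D) := by
    refine le_of_mul_le_mul_right ?_ hNp
    calc lam ^ 2 * N * N = (lam * N) ^ 2 := by ring
      _ ≤ _ := hmain
      _ = _ := by ring
  have h2 : (2 : ℝ) ^ ((n - 2) * k) * 2 ^ k / Q ≤ b := by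
    have : (2 : ℝ) ^ ((n - 2) * k) * 2 ^ k / Q = ((2 : ℝ) ^ k)⁻¹ := by
      obtain ⟨m, rfl⟩ := Nat.exists_eq_add_of_le (show 2 ≤ n by omega)
      rw [hQ, Nat.add_sub_cancel_left, add_mul, pow_add, mul_comm 2 k, pow_mul 2 k 2]
      field_simp
    rw [this, hb, ← Real.rpow_natCast, ← Real.rpow_neg (by norm_num)]
    apply Real.rpow_le_rpow_of_exponent_le (by norm_num)
    linarith [Nat.cast_nonneg (α := ℝ) k]
  have h3 : N / Q ≤ 1 := by
    have := card_div_le_one hinj hc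
    push_cast at this
    exact this
  have hL1 : (1 : ℝ) ≤ k + 1 := by linarith [Nat.cast_nonneg (α := ℝ) k]
  calc lam ^ 2 * (N / Q) = lam ^ 2 * N / Q := by ring
    _ ≤ V * (5 * 2 ^ ((n - 2) * k) * (2 * 2 ^ k) + N * D) / Q := by gcongr
    _ = V * (10 * (2 ^ ((n - 2) * k) * 2 ^ k / Q) + N / Q * D) := by ring
    _ ≤ V * (10 * b + 1 * D) := by gcongr
    _ ≤ V * (10 * (k + 1) * b + 1 * D) := by
        gcongr
        linarith
    _ = _ := by rw [hD]; ring

/-- The constant in `pow_mul_card_rpow_le`. -/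
noncomputable def cardConst (n : ℕ) : ℝ := 9 * n ^ 3 * corrConst n

theorem four_le_corrConst (n : ℕ) : 4 ≤ corrConst n := by
  have : (0 : ℝ) ≤ 128 * n ^ 2 * 2 ^ (n + 2) +
    4 ^ n * (2 * n) * ((12 * n ^ 2 + 3 * n + 2 : ℕ) : ℝ) := by positivity
  unfold corrConst
  linarith

theorem correlation_le_rpow {ι : Type*} {c : ι → ℕ} {P : ι → ℝ × ℝ} (hn : 4 ≤ n)
    (h : IsCantorSequence n ρ)
    (hc : ∀ i, c i < 2 ^ (n * k)) (hP : ∀ i, P i ∈ paramBox)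
    (hcell : ∀ i, (P i).1 ∈ Ico ((c i : ℝ) / 2 ^ (n * k)) ((c i + 1) / 2 ^ (n * k)))
    (p : Fin n → ι) : ∃ i j, i ≠ j ∧ correlation (ρ k) (fun l => P (p l)) ≤
      3 * corrConst n * (k + 1) ^ 3 * (2 ^ k) ^ (n - 1) *
        (|(c (p i) : ℝ) - c (p j)| + 1) ^ (-(1 - 1 / (n : ℝ))) := by
  obtain ⟨hs0, hs1⟩ := one_sub_inv_mem (n := n) (by omega)
  set s : ℝ := 1 - 1 / (n : ℝ) with hs
  set Q : ℝ := 2 ^ (n * k) with hQ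
  have hQ0 : 0 < Q := by positivity
  have hK := four_le_corrConst n
  set L : ℝ := (k : ℝ) + 1 with hL
  have hL1 : 1 ≤ L ^ 3 := one_le_pow₀ (by rw [hL]; linarith [Nat.cast_nonneg (α := ℝ) k])
  obtain ⟨⟨i, j⟩, hij, hmin⟩ := Finset.exists_min_image (Finset.univ : Finset (Fin n)).offDiag
    (fun q => |(c (p q.1) : ℝ) - c (p q.2)|)
    ⟨(⟨0, by omega⟩, ⟨1, by omega⟩), by simp⟩
  have hij' : i ≠ j := (Finset.mem_offDiag.1 hij).2.2
  refine ⟨i, j, hij', ?_⟩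
  set d : ℝ := |(c (p i) : ℝ) - c (p j)| with hd
  have hd0 : 0 ≤ d := abs_nonneg _
  have hPp : ∀ l, P (p l) ∈ paramBox := fun l => hP _
  set X : ℝ := (2 ^ k) ^ (n - 1) with hX
  have hX0 : 0 < X := by positivity
  have hw0 : 0 < (d + 1) ^ (-s) := by positivity
  by_cases hd1 : d < 2
  · have h1 := (h.level k).correlation_le hPp (by omega)
    have h2 : 3⁻¹ ≤ (d + 1) ^ (-s) := by
      rw [Real.rpow_neg (by positivity)]
      gcongr
      calc (d + 1) ^ s ≤ 3 ^ s := Real.rpow_le_rpow (by positivity) (by linarith) hs0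
        _ ≤ 3 := Real.rpow_le_self_of_one_le (by norm_num) hs1
    calc _ ≤ 2 * X := h1
      _ ≤ 3 * 4 * 1 * X * 3⁻¹ := by linarith
      _ ≤ _ := by gcongr
  · push Not at hd1
    have hdQ : d ≤ Q := by
      have h1 : (c (p i) : ℝ) < Q := by rw [hQ]; exact_mod_cast hc (p i)
      have h2 : (c (p j) : ℝ) < Q := by rw [hQ]; exact_mod_cast hc (p j)
      rw [hd, abs_le]
      constructor <;> linarith [Nat.cast_nonneg (α := ℝ) (c (p i)),
        Nat.cast_nonneg (α := ℝ) (c (p j))]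
    have h1 := h.correlation k (fun l => P (p l)) hPp ((d - 1) / Q) (by
        apply div_pos _ hQ0; linarith) (by rw [div_le_one hQ0]; linarith) (by
      intro i' j' hne
      have h2 := hmin (i', j') (Finset.mem_offDiag.2 ⟨Finset.mem_univ _, Finset.mem_univ _, hne⟩)
      have h3 := abs_sub_le_of_mem_cell hQ0 (hcell (p i')) (hcell (p j'))
      rw [div_le_iff₀ hQ0]
      linarith)
    refine h1.trans ?_
    have h2 : ((d - 1) / Q) ^ (-s) ≤ 3 * (d + 1) ^ (-s) * X := by
      have h3 : ((d + 1) / 3 * Q⁻¹) ^ (-s) = 3 ^ s * (d + 1) ^ (-s) * X := by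
        rw [Real.mul_rpow (by positivity) (by positivity), Real.div_rpow (by positivity)
          (by norm_num), Real.rpow_neg (by norm_num : (0 : ℝ) ≤ 3),
          Real.rpow_neg (by positivity : 0 ≤ Q⁻¹), hQ, inv_two_pow_rpow (by omega), inv_inv,
          div_inv_eq_mul, mul_comm ((3 : ℝ) ^ s)]
      calc ((d - 1) / Q) ^ (-s) ≤ ((d + 1) / 3 * Q⁻¹) ^ (-s) := by
            refine Real.rpow_le_rpow_of_nonpos (by positivity) ?_ (by linarith)
            rw [div_eq_mul_inv (d - 1)]
            gcongr
            linarith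
        _ = _ := h3
        _ ≤ _ := by
            gcongr
            exact Real.rpow_le_self_of_one_le (by norm_num) hs1
    calc _ ≤ corrConst n * L ^ 3 * (3 * (d + 1) ^ (-s) * X) := by gcongr
      _ = _ := by ring

theorem sum_comp_pair_le {m : ℕ} {i j : Fin m} (hij : i ≠ j) {f : ι → ι → ℝ} {W : ℝ}
    (hW : ∀ a, ∑ b, f a b ≤ W) :
    ∑ p : Fin m → ι, f (p i) (p j) ≤ (Fintype.card ι : ℝ) ^ (m - 1) * W := by
  classical
  rw [← (Equiv.funSplitAt j ι).symm.sum_comp, Fintype.sum_prod_type_right]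
  have e : ∀ (q : {l // l ≠ j} → ι) (b : ι), f ((Equiv.funSplitAt j ι).symm (b, q) i)
      ((Equiv.funSplitAt j ι).symm (b, q) j) = f (q ⟨i, hij⟩) b := by
    intro q b; simp [Equiv.funSplitAt, hij]
  simp_rw [e]
  refine (Finset.sum_le_sum fun q _ => hW _).trans (le_of_eq ?_)
  simp [Fintype.card_subtype_compl]

theorem pow_mul_card_rpow_le (hn : 4 ≤ n) (h : IsCantorSequence n ρ) (hinj : Function.Injective c)
    (hc : ∀ i, c i < 2 ^ (n * k)) (hP : ∀ i, P i ∈ paramBox)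
    (hcell : ∀ i, (P i).1 ∈ Ico ((c i : ℝ) / 2 ^ (n * k)) ((c i + 1) / 2 ^ (n * k)))
    (hU : volume U ≠ ∞) (hlam : 0 ≤ lam)
    (hbig : ∀ i, lam ≤ ∫ z in U, ρ k (affineCoord (P i) z)) :
    lam ^ n * ((Fintype.card ι : ℝ) / 2 ^ (n * k)) ^ (1 - 1 / (n : ℝ)) ≤
      cardConst n * (k + 1) ^ 4 * volume.real U ^ (n - 1) := by
  obtain ⟨hs0, hs1⟩ := one_sub_inv_mem (n := n) (by omega)
  set s : ℝ := 1 - 1 / (n : ℝ) with hs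
  set N : ℝ := (Fintype.card ι : ℝ) with hN
  set Q : ℝ := 2 ^ (n * k) with hQ
  have hn4 : (4 : ℝ) ≤ n := by exact_mod_cast hn
  have hQ0 : 0 < Q := by positivity
  have hN0 : 0 ≤ N := by positivity
  set V := volume.real U with hV
  have hV0 : 0 ≤ V := measureReal_nonneg
  have hK := four_le_corrConst n
  set K := corrConst n with hKd
  set L : ℝ := (k : ℝ) + 1 with hL
  have hL1 : 1 ≤ L := by rw [hL]; linarith [Nat.cast_nonneg (α := ℝ) k]
  have hk := h.level k
  set X : ℝ := (2 ^ k) ^ (n - 1) with hX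
  have hX0 : 0 < X := by positivity
  rcases hN0.eq_or_lt with hNz | hNp
  · have hsp : s ≠ 0 := by
      have : 1 / (n : ℝ) ≤ 1 / 4 := by gcongr
      rw [hs]; intro h0; linarith
    rw [← hNz, zero_div, Real.zero_rpow hsp, mul_zero]
    unfold cardConst
    positivity
  have hpow := pow_sum_setIntegral_le (P := P) (g := ρ k) (B := 2 ^ k) (m := n) hP
    hk.integrable hk.measurable hk.abs_le hk.nonneg (by omega) hU
  have hlow : (lam * N) ^ n ≤ (∑ i, ∫ z in U, ρ k (affineCoord (P i) z)) ^ n := by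
    refine pow_le_pow_left₀ (by positivity) ?_ n
    calc lam * N = ∑ _i : ι, lam := by simp [hN, mul_comm]
      _ ≤ _ := Finset.sum_le_sum fun i _ => hbig i
  set w : ι → ι → ℝ := fun i j => (|(c i : ℝ) - c j| + 1) ^ (-s) with hw
  have hw0 : ∀ i j, 0 ≤ w i j := fun i j => by positivity
  set W : ℝ := N ^ (1 - s) * (3 * n * L) with hW
  have hsumw : ∀ i, ∑ j, w i j ≤ W := by
    intro i
    refine (sum_rpow_abs_sub_le hinj hc (hc i) hs0 hs1).trans ?_
    rw [hW]
    gcongr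
    push_cast
    rw [Real.log_pow]
    have hlog : Real.log 2 ≤ 1 := (Real.log_two_lt_d9.trans (by norm_num)).le
    have : ((n * k : ℕ) : ℝ) * Real.log 2 ≤ n * k * 1 := by
      push_cast; gcongr
    rw [hL]
    nlinarith [Nat.cast_nonneg (α := ℝ) k]
  have hcorr : ∀ p : Fin n → ι, correlation (ρ k) (fun l => P (p l)) ≤
      3 * K * L ^ 3 * X * ∑ q ∈ (Finset.univ : Finset (Fin n)).offDiag, w (p q.1) (p q.2) := by
    intro p
    obtain ⟨i, j, hij, hle⟩ := correlation_le_rpow hn h hc hP hcell p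
    refine hle.trans ?_
    gcongr
    exact Finset.single_le_sum (f := fun q : Fin n × Fin n => w (p q.1) (p q.2))
      (fun q _ => hw0 _ _) (a := (i, j))
      (Finset.mem_offDiag.2 ⟨Finset.mem_univ _, Finset.mem_univ _, hij⟩)
  have hsum : ∑ p : Fin n → ι, correlation (ρ k) (fun l => P (p l)) ≤
      3 * K * L ^ 3 * X * (n ^ 2 * (N ^ (n - 1) * W)) := by
    refine (Finset.sum_le_sum fun p _ => hcorr p).trans ?_
    rw [← Finset.mul_sum, Finset.sum_comm]
    gcongr
    calc _ ≤ ∑ q ∈ (Finset.univ : Finset (Fin n)).offDiag, N ^ (n - 1) * W :=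
          Finset.sum_le_sum fun q hq => sum_comp_pair_le (Finset.mem_offDiag.1 hq).2.2 hsumw
      _ ≤ _ := by
          rw [Finset.sum_const, nsmul_eq_mul]
          have hW0 : 0 ≤ W := by positivity
          gcongr
          have : (Finset.univ : Finset (Fin n)).offDiag.card ≤ n ^ 2 := by
            rw [Finset.offDiag_card, Finset.card_univ, Fintype.card_fin, sq]
            exact Nat.sub_le _ _
          exact_mod_cast this
  have hmain : (lam * N) ^ n ≤ V ^ (n - 1) * (3 * K * L ^ 3 * X * (n ^ 2 * (N ^ (n - 1) * W))) :=
    hlow.trans (hpow.trans (by gcongr))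
  have hXs : (Q⁻¹) ^ s = X⁻¹ := by rw [hQ, hs, inv_two_pow_rpow (by omega)]
  rw [div_eq_mul_inv, Real.mul_rpow hN0 (by positivity), hXs]
  have e1 : N ^ (1 - s) * N ^ s = N := by
    rw [← Real.rpow_add hNp, sub_add_cancel, Real.rpow_one]
  have e2 : N ^ n = N ^ (n - 1) * N := by
    rw [← pow_succ, Nat.sub_add_cancel (by omega)]
  set A : ℝ := N ^ (1 - s) with hA
  have hA0 : 0 < A := by positivity
  set Bs : ℝ := N ^ s with hBs
  refine le_of_mul_le_mul_right ?_ (show 0 < N ^ (n - 1) * A * X by positivity)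
  calc lam ^ n * (Bs * X⁻¹) * (N ^ (n - 1) * A * X) = lam ^ n * (N ^ (n - 1) * (A * Bs)) := by
        field_simp
    _ = (lam * N) ^ n := by rw [e1, ← e2, mul_pow]
    _ ≤ _ := hmain
    _ = _ := by rw [hW]; unfold cardConst; rw [← hKd]; ring

end Counting

theorem exists_pow_mul_rpow_le {κ : ℝ} (hκ : 0 < κ) : ∃ B : ℝ, 0 ≤ B ∧ ∀ k : ℕ,
    ((k : ℝ) + 1) ^ 5 * ((2 : ℝ) ^ (-(k : ℝ) / 2)) ^ κ ≤ B * (2 : ℝ) ^ (-(κ * k / 4)) := by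
  set r : ℝ := 2 ^ (-(κ / 4)) with hr
  have hr0 : 0 < r := by positivity
  have hr1 : r < 1 := Real.rpow_lt_one_of_one_lt_of_neg (by norm_num) (by linarith)
  obtain ⟨B, hB⟩ := (tendsto_pow_const_mul_const_pow_of_abs_lt_one 5
    (by rwa [abs_of_pos hr0] : |r| < 1)).bddAbove_range
  have hB' : ∀ k : ℕ, (k : ℝ) ^ 5 * r ^ k ≤ B := fun k => hB ⟨k, rfl⟩
  have hB0 : 0 ≤ B := by simpa using hB' 0
  refine ⟨B / r, by positivity, fun k => ?_⟩
  have e1 : ((2 : ℝ) ^ (-(k : ℝ) / 2)) ^ κ = r ^ k * r ^ k := by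
    rw [hr, ← Real.rpow_mul (by norm_num), ← Real.rpow_mul_natCast (by norm_num),
      ← Real.rpow_add (by norm_num)]
    congr 1; ring
  have e2 : (2 : ℝ) ^ (-(κ * k / 4)) = r ^ k := by
    rw [hr, ← Real.rpow_mul_natCast (by norm_num)]
    congr 1; ring
  rw [e1, e2]
  have := hB' (k + 1)
  push_cast at this
  calc _ = (((k : ℝ) + 1) ^ 5 * r ^ (k + 1)) / r * r ^ k := by
        rw [pow_succ r k]; field_simp
    _ ≤ _ := by gcongr

theorem weak_type_aux {n : ℕ} {lam e V κ A1 A2 L b : ℝ} (hn : 4 ≤ n) (hlam : 0 < lam) (he0 : 0 ≤ e)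
    (he1 : e ≤ 1) (hV : 0 ≤ V) (hκ0 : 0 < κ) (hκ1 : κ ≤ 1 / n) (hA1 : 1 ≤ A1) (hA2 : 0 ≤ A2)
    (hL : 1 ≤ L) (hb : 0 ≤ b) (h1 : lam ^ 2 * e ≤ A1 * L * b * V)
    (h2 : lam ^ n * e ^ (1 - 1 / (n : ℝ)) ≤ A2 * L ^ 4 * V ^ (n - 1)) :
    e ≤ A1 * A2 * (L ^ 5 * b ^ κ) * lam ^ (-(n + 2 * κ)) * V ^ ((n : ℝ) - 1 + κ) := by
  have hn4 : (4 : ℝ) ≤ n := by exact_mod_cast hn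
  have hn' : 1 / (n : ℝ) ≤ 1 / 4 := by gcongr
  have hκ' : κ ≤ 1 := by linarith
  have h3 : (lam ^ 2 * e) ^ κ ≤ A1 * L * (b ^ κ * V ^ κ) := by
    calc (lam ^ 2 * e) ^ κ ≤ (A1 * L * b * V) ^ κ := Real.rpow_le_rpow (by positivity) h1 hκ0.le
      _ = (A1 * L) ^ κ * (b ^ κ * V ^ κ) := by
        rw [mul_assoc (A1 * L), Real.mul_rpow (by positivity) (by positivity),
          Real.mul_rpow hb hV]
      _ ≤ _ := by
        gcongr
        exact Real.rpow_le_self_of_one_le (by nlinarith) hκ'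
  have h4 : e ≤ e ^ (1 - 1 / (n : ℝ) + κ) := by
    simpa using Real.rpow_le_rpow_of_exponent_ge' he0 he1 (by linarith)
      (by linarith : 1 - 1 / (n : ℝ) + κ ≤ 1)
  have h5 : (lam ^ n * e ^ (1 - 1 / (n : ℝ))) * (lam ^ 2 * e) ^ κ =
      lam ^ ((n : ℝ) + 2 * κ) * e ^ (1 - 1 / (n : ℝ) + κ) := by
    rw [Real.mul_rpow (by positivity) he0, Real.rpow_add hlam, Real.rpow_natCast,
      Real.rpow_mul hlam.le, Real.rpow_add_of_nonneg he0 (by linarith) hκ0.le]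
    norm_num
    ring
  have h6 : V ^ (n - 1) * V ^ κ = V ^ ((n : ℝ) - 1 + κ) := by
    rw [Real.rpow_add_of_nonneg hV (by linarith) hκ0.le, ← Real.rpow_natCast,
      Nat.cast_sub (by omega), Nat.cast_one]
  have h7 : lam ^ ((n : ℝ) + 2 * κ) * e ≤ A1 * A2 * (L ^ 5 * b ^ κ) * V ^ ((n : ℝ) - 1 + κ) := by
    calc lam ^ ((n : ℝ) + 2 * κ) * e ≤ lam ^ ((n : ℝ) + 2 * κ) * e ^ (1 - 1 / (n : ℝ) + κ) := by
          gcongr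
      _ = _ := h5.symm
      _ ≤ (A2 * L ^ 4 * V ^ (n - 1)) * (A1 * L * (b ^ κ * V ^ κ)) := by gcongr
      _ = A1 * A2 * (L ^ 5 * b ^ κ) * (V ^ (n - 1) * V ^ κ) := by ring
      _ = _ := by rw [h6]
  rw [Real.rpow_neg hlam.le]
  calc e = lam ^ ((n : ℝ) + 2 * κ) * e * (lam ^ ((n : ℝ) + 2 * κ))⁻¹ := by
        field_simp
    _ ≤ A1 * A2 * (L ^ 5 * b ^ κ) * V ^ ((n : ℝ) - 1 + κ) * (lam ^ ((n : ℝ) + 2 * κ))⁻¹ := by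
        gcongr
    _ = _ := by ring

/-- The points of `[0, 1)` at which the maximal average of `σ` over `U` exceeds `lam`. -/
def superlevel (σ : ℝ → ℝ) (U : Set ℝ) (lam : ℝ) : Set ℝ :=
  {x | x ∈ Ico (0 : ℝ) 1 ∧ ∃ r ∈ Icc (1 : ℝ) 2, lam < |∫ z in U, σ (affineCoord (x, r) z)|}

theorem IsCantorSequence.weak_type {n : ℕ} {ρ : ℕ → ℝ → ℝ} (hn : 4 ≤ n)
    (h : IsCantorSequence n ρ) {κ : ℝ} (hκ0 : 0 < κ) (hκ1 : κ ≤ 1 / n) :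
    ∃ C : ℝ, 0 ≤ C ∧ ∀ (k : ℕ) (U : Set ℝ) (lam : ℝ), volume U ≠ ∞ → 0 < lam →
      volume (superlevel (fun y => ρ (k + 1) y - ρ k y) U lam) ≤
        ENNReal.ofReal (C * (2 : ℝ) ^ (-(κ * k / 4)) * lam ^ (-(n + 2 * κ)) *
          volume.real U ^ ((n : ℝ) - 1 + κ)) := by
  classical
  obtain ⟨B, hB0, hB⟩ := exists_pow_mul_rpow_le hκ0
  have hK0 : 0 ≤ pairConst n := by unfold pairConst; positivity
  have hK := four_le_corrConst n
  have hA2 : 0 ≤ cardConst n := by unfold cardConst; positivity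
  refine ⟨(10 + pairConst n) * cardConst n * B, by positivity, fun k U lam hU hlam => ?_⟩
  set E := superlevel (fun y => ρ (k + 1) y - ρ k y) U lam with hE
  have hQ0 : (0 : ℝ) < 2 ^ (n * k) := by positivity
  set cell : ℕ → Set ℝ := fun c => Ico ((c : ℝ) / 2 ^ (n * k)) ((c + 1) / 2 ^ (n * k)) with hcell
  set S : Finset ℕ := (Finset.range (2 ^ (n * k))).filter fun c => (E ∩ cell c).Nonempty with hS
  have hSne : ∀ c : S, (E ∩ cell c).Nonempty := fun c => (Finset.mem_filter.1 c.2).2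
  choose x hx using hSne
  have hr : ∀ c : S, ∃ r ∈ Icc (1 : ℝ) 2, lam <
      |∫ z in U, (ρ (k + 1) (affineCoord (x c, r) z) - ρ k (affineCoord (x c, r) z))| :=
    fun c => (hx c).1.2
  choose r hr hbig using hr
  set P : S → ℝ × ℝ := fun c => (x c, r c) with hPd
  have hP : ∀ c, P c ∈ paramBox := fun c => ⟨⟨(hx c).1.1.1, (hx c).1.1.2.le⟩, hr c⟩
  have hinj : Function.Injective (fun c : S => (c : ℕ)) := Subtype.val_injective
  have hc : ∀ c : S, (c : ℕ) < 2 ^ (n * k) := fun c =>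
    Finset.mem_range.1 (Finset.mem_filter.1 c.2).1
  have hPcell : ∀ c : S, (P c).1 ∈
      Ico (((c : ℕ) : ℝ) / 2 ^ (n * k)) (((c : ℕ) + 1) / 2 ^ (n * k)) :=
    fun c => (hx c).2
  have h1 := sq_mul_card_le hn h hinj hc hP hPcell hU hlam.le (fun c => (hbig c).le)
  have h2 := pow_mul_card_rpow_le hn h hinj hc hP hPcell hU hlam.le (fun c => by
    refine (hbig c).le.trans (abs_integral_le_integral_abs.trans (le_of_eq ?_))
    congr 1
    ext z
    exact h.abs_sub k _)
  have h3 := card_div_le_one hinj hc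
  push_cast at h3
  rw [Fintype.card_coe] at h1 h2 h3
  have h4 := weak_type_aux (L := (k : ℝ) + 1) hn hlam (by positivity) h3 measureReal_nonneg
    hκ0 hκ1 (by linarith : 1 ≤ 10 + pairConst n) hA2
    (by linarith [Nat.cast_nonneg (α := ℝ) k]) (by positivity) h1 h2
  have hcover : E ⊆ ⋃ c ∈ S, cell c := by
    intro y hy
    have hm := mem_cell_floor hQ0 hy.1.1
    refine mem_iUnion₂.2 ⟨⌊y * 2 ^ (n * k)⌋₊, Finset.mem_filter.2 ⟨Finset.mem_range.2 ?_,
      ⟨y, hy, hm⟩⟩, hm⟩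
    rw [Nat.floor_lt (mul_nonneg hy.1.1 hQ0.le)]
    push_cast
    nlinarith [hy.1.2]
  calc volume E ≤ ∑ c ∈ S, volume (cell c) :=
        (measure_mono hcover).trans (measure_biUnion_finset_le _ _)
    _ = ∑ _c ∈ S, ENNReal.ofReal (1 / 2 ^ (n * k)) := by
        refine Finset.sum_congr rfl fun c _ => ?_
        rw [hcell, Real.volume_Ico]
        congr 1
        ring
    _ = ENNReal.ofReal ((S.card : ℝ) / 2 ^ (n * k)) := by
        rw [Finset.sum_const, nsmul_eq_mul, ← ENNReal.ofReal_natCast,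
          ← ENNReal.ofReal_mul (by positivity), mul_one_div]
    _ ≤ _ := by
        refine ENNReal.ofReal_le_ofReal (h4.trans ?_)
        have hV0 : (0 : ℝ) ≤ volume.real U := measureReal_nonneg
        calc _ ≤ (10 + pairConst n) * cardConst n * (B * (2 : ℝ) ^ (-(κ * k / 4))) *
              lam ^ (-(n + 2 * κ)) * volume.real U ^ ((n : ℝ) - 1 + κ) := by
              have hA : 0 ≤ (10 + pairConst n) * cardConst n := by positivity
              exact mul_le_mul_of_nonneg_right (mul_le_mul_of_nonneg_right
                (mul_le_mul_of_nonneg_left (hB k) hA) (by positivity)) (by positivity)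
          _ = _ := by ring

/-- Minkowski's inequality for countable sums of nonnegative functions. -/
theorem lintegral_tsum_rpow_le {α ι : Type*} [MeasurableSpace α] [Countable ι]
    {μ : Measure α} {q : ℝ}
    (hq : 1 ≤ q) {F : ι → α → ℝ≥0∞} (hF : ∀ i, AEMeasurable (F i) μ) :
    (∫⁻ x, (∑' i, F i x) ^ q ∂μ) ^ (1 / q) ≤ ∑' i, (∫⁻ x, F i x ^ q ∂μ) ^ (1 / q) := by
  have hq0 : 0 < q := by linarith
  have hfin : ∀ S : Finset ι, (∫⁻ x, (∑ i ∈ S, F i x) ^ q ∂μ) ^ (1 / q) ≤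
      ∑ i ∈ S, (∫⁻ x, F i x ^ q ∂μ) ^ (1 / q) := by
    classical
    intro S
    induction S using Finset.induction_on with
    | empty => simp [hq0]
    | insert a S ha ih =>
      simp_rw [Finset.sum_insert ha]
      refine le_trans ?_ (add_le_add le_rfl ih)
      exact ENNReal.lintegral_Lp_add_le (hF a) (Finset.aemeasurable_fun_sum S fun i _ => hF i) hq
  have e : ∀ x, (∑' i, F i x) ^ q = ⨆ S : Finset ι, (∑ i ∈ S, F i x) ^ q := by
    intro x
    rw [ENNReal.tsum_eq_iSup_sum]
    exact (ENNReal.orderIsoRpow q hq0).map_iSup _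
  simp_rw [e]
  rw [lintegral_iSup_directed (fun S =>
    (Finset.aemeasurable_fun_sum S fun i _ => hF i).pow_const q)]
  · have := (ENNReal.orderIsoRpow (1 / q) (by positivity)).map_iSup
      (fun S : Finset ι => ∫⁻ x, (∑ i ∈ S, F i x) ^ q ∂μ)
    simp only [ENNReal.orderIsoRpow_apply] at this
    rw [this]
    exact iSup_le fun S => (hfin S).trans (ENNReal.sum_le_tsum S)
  · classical
    refine Monotone.directed_le fun S T hST x => ?_
    exact ENNReal.rpow_le_rpow (Finset.sum_le_sum_of_subset hST) hq0.le

/-- The maximal operator with values in `ℝ≥0∞`. -/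
noncomputable def lmax (ν : Measure ℝ) (F : ℝ → ℝ≥0∞) (x : ℝ) : ℝ≥0∞ :=
  ⨆ r : Icc (1 : ℝ) 2, ∫⁻ y, F (x + r * y) ∂ν

theorem lmax_mono {ν : Measure ℝ} {F G : ℝ → ℝ≥0∞} (h : ∀ z, F z ≤ G z) (x : ℝ) :
    lmax ν F x ≤ lmax ν G x :=
  iSup_mono fun _ => lintegral_mono fun _ => h _

theorem lmax_tsum_le {ι : Type*} [Countable ι] {ν : Measure ℝ} {F : ι → ℝ → ℝ≥0∞}
    (hF : ∀ i, Measurable (F i)) (x : ℝ) :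
    lmax ν (fun z => ∑' i, F i z) x ≤ ∑' i, lmax ν (F i) x := by
  refine iSup_le fun r => ?_
  beta_reduce
  have hm : Measurable fun y : ℝ => x + r * y := by fun_prop
  rw [lintegral_tsum (f := fun i y => F i (x + r * y)) fun i => ((hF i).comp hm).aemeasurable]
  exact ENNReal.tsum_le_tsum fun i => le_iSup (fun r : Icc (1 : ℝ) 2 => ∫⁻ y, F i (x + r * y) ∂ν) r

theorem lmax_const_mul {ν : Measure ℝ} {F : ℝ → ℝ≥0∞} (hF : Measurable F) (c : ℝ≥0∞) (x : ℝ) :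
    lmax ν (fun z => c * F z) x = c * lmax ν F x := by
  unfold lmax
  rw [ENNReal.mul_iSup]
  refine iSup_congr fun r => ?_
  have hm : Measurable fun y : ℝ => x + r * y := by fun_prop
  exact lintegral_const_mul _ (hF.comp hm)

theorem setIntegral_preimage_eq {x r : ℝ} (hr : 0 < r) {U : Set ℝ} (hU : MeasurableSet U)
    (g : ℝ → ℝ) :
    ∫ y in (fun y => x + r * y) ⁻¹' U, g y = r⁻¹ * ∫ z in U, g (affineCoord (x, r) z) := by
  have hm : Measurable fun y : ℝ => x + r * y := by fun_prop
  rw [← integral_indicator (hm hU), ← integral_indicator hU]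
  have := integral_comp_affineCoord (P := (x, r)) hr
    (((fun y => x + r * y) ⁻¹' U).indicator g)
  simp only at this
  rw [eq_inv_mul_iff_mul_eq₀ hr.ne', ← this]
  congr 1
  ext z
  have e : x + r * affineCoord (x, r) z = z := by
    simp only [affineCoord]; field_simp; ring
  by_cases hz : z ∈ U
  · rw [indicator_of_mem hz, indicator_of_mem (by simpa [e] using hz)]
  · rw [indicator_of_notMem hz, indicator_of_notMem (by simpa [e] using hz)]

theorem exists_inv_two_pow_lt_le {t : ℝ} (h0 : 0 < t) (h2 : t ≤ 2) :
    ∃ j : ℕ, ((2 : ℝ) ^ j)⁻¹ < t ∧ t ≤ 2 * ((2 : ℝ) ^ j)⁻¹ := by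
  obtain ⟨j, h3, h4⟩ := exists_nat_pow_near_of_lt_one (x := t / 2) (y := (2 : ℝ)⁻¹) (by linarith)
    (by linarith) (by norm_num) (by norm_num)
  refine ⟨j, ?_, ?_⟩
  · rw [← inv_pow]; rw [pow_succ] at h3; linarith
  · rw [← inv_pow]; linarith

/-- A measurable hull of the superlevel set of the maximal average of `ρ (k + 1) - ρ k`. -/
noncomputable def hull (ρ : ℕ → ℝ → ℝ) (U : Set ℝ) (k j : ℕ) : Set ℝ :=
  toMeasurable volume (superlevel (fun y => ρ (k + 1) y - ρ k y) U ((2 : ℝ) ^ j)⁻¹)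

theorem measurableSet_hull (ρ : ℕ → ℝ → ℝ) (U : Set ℝ) (k j : ℕ) : MeasurableSet (hull ρ U k j) :=
  measurableSet_toMeasurable _ _

theorem IsCantorSequence.ofReal_abs_setIntegral_le {n : ℕ} {ρ : ℕ → ℝ → ℝ}
    (h : IsCantorSequence n ρ) (U : Set ℝ) {x r : ℝ} (hx : x ∈ Ico (0 : ℝ) 1)
    (hr : r ∈ Icc (1 : ℝ) 2) (k : ℕ) :
    ENNReal.ofReal |∫ z in U, (ρ (k + 1) (affineCoord (x, r) z) - ρ k (affineCoord (x, r) z))| ≤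
      ∑' j, (hull ρ U k j).indicator (fun _ => ENNReal.ofReal (2 * ((2 : ℝ) ^ j)⁻¹)) x := by
  set t := |∫ z in U, (ρ (k + 1) (affineCoord (x, r) z) - ρ k (affineCoord (x, r) z))| with ht
  have hr0 : 0 < r := by linarith [hr.1]
  rcases (abs_nonneg _ : 0 ≤ t).eq_or_lt with h0 | h0
  · rw [show t = 0 from h0.symm]; simp
  have h2 : t ≤ 2 := by
    have hi := integrable_comp_affineCoord (P := (x, r)) hr0 (h.level k).integrable
    calc t ≤ ∫ z in U, |ρ (k + 1) (affineCoord (x, r) z) - ρ k (affineCoord (x, r) z)| :=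
          abs_integral_le_integral_abs
      _ = ∫ z in U, ρ k (affineCoord (x, r) z) := by simp_rw [h.abs_sub]
      _ ≤ ∫ z, ρ k (affineCoord (x, r) z) :=
          setIntegral_le_integral hi (ae_of_all _ fun z => (h.level k).nonneg _)
      _ = r := by
          rw [integral_comp_affineCoord (P := (x, r)) hr0, (h.level k).total, mul_one]
      _ ≤ 2 := hr.2
  obtain ⟨j, h3, h4⟩ := exists_inv_two_pow_lt_le h0 h2
  refine le_trans ?_ (ENNReal.le_tsum j)
  have hmem : x ∈ hull ρ U k j := subset_toMeasurable _ _ ⟨hx, r, hr, h3⟩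
  rw [indicator_of_mem hmem]
  exact ENNReal.ofReal_le_ofReal h4

theorem IsCantorMeasure.lmax_indicator_le {n : ℕ} {ρ : ℕ → ℝ → ℝ} {ν : Measure ℝ} (hn : 1 ≤ n)
    (h : IsCantorSequence n ρ) (hν : IsCantorMeasure n ρ ν) {U : Set ℝ} (hU : IsOpen U)
    (hfin : volume U ≠ ∞) {x : ℝ} (hx : x ∈ Ico (0 : ℝ) 1) :
    lmax ν (U.indicator 1) x ≤ volume U + ∑' q : ℕ × ℕ,
      (hull ρ U q.1 q.2).indicator (fun _ => ENNReal.ofReal (2 * ((2 : ℝ) ^ q.2)⁻¹)) x := by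
  refine iSup_le fun ⟨r, hr⟩ => ?_
  have hr0 : 0 < r := by linarith [hr.1]
  have hcont : Continuous fun y : ℝ => x + r * y := by fun_prop
  set V : Set ℝ := (fun y => x + r * y) ⁻¹' U with hV
  have hVo : IsOpen V := hU.preimage hcont
  have e1 : ∫⁻ y, U.indicator 1 (x + r * y) ∂ν = ν V := by
    rw [← lintegral_indicator_one hVo.measurableSet]
    rfl
  change ∫⁻ y, U.indicator 1 (x + r * y) ∂ν ≤ _
  rw [e1]
  refine (hν.measure_le_iSup hn h hVo).trans (iSup_le fun J => ?_)
  rw [← ofReal_integral_eq_lintegral_ofReal (h.level J).integrable.integrableOn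
    (ae_of_all _ (h.level J).nonneg)]
  set t : ℕ → ℝ := fun k =>
    |∫ z in U, (ρ (k + 1) (affineCoord (x, r) z) - ρ k (affineCoord (x, r) z))| with ht
  have hr1 : r⁻¹ ≤ 1 := inv_le_one_of_one_le₀ hr.1
  have hJ : ∀ J, ∫ y in V, ρ J y ≤ volume.real U + ∑ k ∈ Finset.range J, t k := by
    intro J
    induction J with
    | zero =>
      rw [Finset.sum_range_zero, add_zero, hV, setIntegral_preimage_eq hr0 hU.measurableSet]
      have h1 : ∫ z in U, ρ 0 (affineCoord (x, r) z) ≤ volume.real U := by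
        calc _ ≤ ∫ z in U, (1 : ℝ) := by
              refine setIntegral_mono_on (integrable_comp_affineCoord (P := (x, r)) hr0
                (h.level 0).integrable).integrableOn (integrableOn_const hfin) hU.measurableSet
                fun z _ => ?_
              simpa using (h.level 0).le (affineCoord (x, r) z)
          _ = _ := by simp
      have h0 : 0 ≤ ∫ z in U, ρ 0 (affineCoord (x, r) z) :=
        integral_nonneg fun z => (h.level 0).nonneg _
      nlinarith
    | succ J ih =>
      rw [Finset.sum_range_succ]
      have hi : Integrable (fun y => ρ (J + 1) y - ρ J y) (volume.restrict V) :=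
        ((h.level (J + 1)).integrable.sub (h.level J).integrable).integrableOn
      have h1 : ∫ y in V, ρ (J + 1) y = (∫ y in V, ρ J y) + ∫ y in V, (ρ (J + 1) y - ρ J y) := by
        rw [← integral_add (h.level J).integrable.integrableOn hi]
        simp
      have h2 : ∫ y in V, (ρ (J + 1) y - ρ J y) ≤ t J := by
        rw [hV, setIntegral_preimage_eq hr0 hU.measurableSet (fun y => ρ (J + 1) y - ρ J y)]
        refine (le_abs_self _).trans ?_
        rw [abs_mul, abs_of_pos (inv_pos.2 hr0)]
        exact mul_le_of_le_one_left (abs_nonneg _) hr1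
      linarith
  refine (ENNReal.ofReal_le_ofReal (hJ J)).trans ?_
  rw [ENNReal.ofReal_add measureReal_nonneg (Finset.sum_nonneg fun _ _ => abs_nonneg _),
    ENNReal.ofReal_sum_of_nonneg fun _ _ => abs_nonneg _, measureReal_def,
    ENNReal.ofReal_toReal hfin]
  gcongr
  refine (ENNReal.sum_le_tsum _).trans ?_
  rw [ENNReal.tsum_prod (f := fun k j =>
    (hull ρ U k j).indicator (fun _ => ENNReal.ofReal (2 * ((2 : ℝ) ^ j)⁻¹)) x)]
  exact ENNReal.tsum_le_tsum fun k => h.ofReal_abs_setIntegral_le U hx hr k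

theorem dyadic_term_le {C κ p q m e v : ℝ} (hC : 0 ≤ C) (hq : 0 < q) (he : 0 ≤ e) (hv : 0 ≤ v)
    {i k j : ℕ} (hvi : v ≤ 2 * 2 ^ (-(i * p))) :
    2 ^ (i + 1) * (2 * ((2 : ℝ) ^ j)⁻¹) *
      (C * 2 ^ (-(κ * k / 4)) * ((2 : ℝ) ^ j)⁻¹ ^ (-m) * v ^ e) ^ (1 / q) ≤
    C ^ (1 / q) * 2 ^ (2 + e / q) *
      (((2 : ℝ) ^ (1 - p * e / q)) ^ i * (((2 : ℝ) ^ (-(κ / (4 * q)))) ^ k *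
        ((2 : ℝ) ^ (m / q - 1)) ^ j)) := by
  have h2 : (0 : ℝ) < 2 := by norm_num
  have h20 : (0 : ℝ) ≤ 2 := by norm_num
  have e1 : (2 : ℝ) * 2 ^ (-(i * p)) = 2 ^ (1 - i * p) := by
    rw [sub_eq_add_neg, Real.rpow_add h2, Real.rpow_one]
  have e2 : ((2 : ℝ) ^ j)⁻¹ = 2 ^ (-(j : ℝ)) := by rw [Real.rpow_neg h20, Real.rpow_natCast]
  have e3 : (2 : ℝ) ^ (i + 1) = 2 ^ ((i : ℝ) + 1) := by
    rw [← Real.rpow_natCast]; push_cast; rfl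
  calc _ ≤ 2 ^ (i + 1) * (2 * ((2 : ℝ) ^ j)⁻¹) *
      (C * 2 ^ (-(κ * k / 4)) * ((2 : ℝ) ^ j)⁻¹ ^ (-m) * (2 * 2 ^ (-(i * p))) ^ e) ^ (1 / q) := by
        gcongr
    _ = 2 ^ ((i : ℝ) + 1) * (2 ^ (1 : ℝ) * 2 ^ (-(j : ℝ))) *
        (C * 2 ^ (-(κ * k / 4) + -(j : ℝ) * -m + (1 - i * p) * e)) ^ (1 / q) := by
        rw [e1, e2, e3, ← Real.rpow_mul h20,
          ← Real.rpow_mul h20, Real.rpow_add h2 _ ((1 - i * p) * e),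
          Real.rpow_add h2 (-(κ * k / 4)), Real.rpow_one]
        ring_nf
    _ = C ^ (1 / q) * 2 ^ ((i : ℝ) + 1 + (1 + -(j : ℝ)) +
          (-(κ * k / 4) + -(j : ℝ) * -m + (1 - i * p) * e) * (1 / q)) := by
        rw [Real.mul_rpow hC (by positivity), ← Real.rpow_mul h20, Real.rpow_add h2 (_ + _),
          Real.rpow_add h2 (_ + _) (_ + _), Real.rpow_add h2 1]
        ring
    _ = C ^ (1 / q) * 2 ^ ((2 + e / q) + ((1 - p * e / q) * i + (-(κ / (4 * q)) * k +
          (m / q - 1) * j))) := by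
        congr 2
        field_simp
        ring
    _ = _ := by
        rw [Real.rpow_add h2, Real.rpow_add h2 _ (_ + _), Real.rpow_add h2 (_ * (k : ℝ)),
          Real.rpow_mul_natCast h20, Real.rpow_mul_natCast h20, Real.rpow_mul_natCast h20]
        ring

theorem tsum_ofReal_geometric_ne_top {C a b c : ℝ} (ha : 0 ≤ a) (ha1 : a < 1) (hb : 0 ≤ b)
    (hb1 : b < 1) (hc : 0 ≤ c) (hc1 : c < 1) :
    ∑' q : ℕ × ℕ × ℕ, ENNReal.ofReal (C * (a ^ q.1 * (b ^ q.2.1 * c ^ q.2.2))) ≠ ∞ := by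
  have h1 := (summable_geometric_of_lt_one hb hb1).mul_of_nonneg
    (summable_geometric_of_lt_one hc hc1)
    (fun _ => by positivity) (fun _ => by positivity)
  have h2 := (summable_geometric_of_lt_one ha ha1).mul_of_nonneg h1
    (fun _ => by positivity) (fun _ => by positivity)
  exact (h2.mul_left C).tsum_ofReal_ne_top

theorem le_one_add_tsum_indicator {f : ℝ → ℝ} {U : ℕ → Set ℝ}
    (hU : ∀ i, {z | (2 : ℝ) ^ i ≤ |f z|} ⊆ U i) (z : ℝ) :
    ENNReal.ofReal |f z| ≤ 1 + ∑' i, ENNReal.ofReal (2 ^ (i + 1)) * (U i).indicator 1 z := by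
  rcases le_total |f z| 1 with h | h
  · exact (ENNReal.ofReal_le_one.2 h).trans le_self_add
  obtain ⟨i, h1, h2⟩ := exists_nat_pow_near h (by norm_num : (1 : ℝ) < 2)
  have hz : z ∈ U i := hU i h1
  refine le_trans ?_ le_add_self
  refine le_trans ?_ (ENNReal.le_tsum i)
  rw [indicator_of_mem hz, Pi.one_apply, mul_one]
  exact ENNReal.ofReal_le_ofReal h2.le

theorem exists_isOpen_superlevel {f : ℝ → ℝ} {p : ℝ} (hf : Measurable f) (hp : 0 < p)
    (hf1 : ∫⁻ z, ENNReal.ofReal |f z| ^ p ≤ 1) (i : ℕ) :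
    ∃ U, IsOpen U ∧ {z | (2 : ℝ) ^ i ≤ |f z|} ⊆ U ∧ volume U ≠ ∞ ∧
      volume.real U ≤ 2 * 2 ^ (-(i * p)) := by
  have h0 : (0 : ℝ) < 2 ^ (-(i * p)) := by positivity
  have h1 : volume {z | (2 : ℝ) ^ i ≤ |f z|} ≤ ENNReal.ofReal (2 ^ (-(i * p))) := by
    have h2 : {z | (2 : ℝ) ^ i ≤ |f z|} ⊆
        {z | ENNReal.ofReal ((2 : ℝ) ^ (i * p)) ≤ ENNReal.ofReal |f z| ^ p} := by
      intro z hz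
      show ENNReal.ofReal ((2 : ℝ) ^ (i * p)) ≤ ENNReal.ofReal |f z| ^ p
      rw [ENNReal.ofReal_rpow_of_nonneg (abs_nonneg _) hp.le, Real.rpow_mul (by norm_num),
        Real.rpow_natCast]
      exact ENNReal.ofReal_le_ofReal (Real.rpow_le_rpow (by positivity) hz hp.le)
    have h4 : (0 : ℝ) < 2 ^ (i * p) := by positivity
    refine (measure_mono h2).trans ((meas_ge_le_lintegral_div
      ((hf.abs.ennreal_ofReal).pow_const p).aemeasurable (ENNReal.ofReal_pos.2 h4).ne'
      ENNReal.ofReal_ne_top).trans ?_)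
    rw [Real.rpow_neg (by norm_num), ENNReal.ofReal_inv_of_pos h4, ← one_div]
    exact ENNReal.div_le_div_right hf1 _
  obtain ⟨U, hU, hUo, hlt⟩ := Set.exists_isOpen_lt_of_lt _ (ENNReal.ofReal (2 * 2 ^ (-(i * p))))
    (h1.trans_lt ((ENNReal.ofReal_lt_ofReal_iff (by positivity)).2 (by linarith)))
  refine ⟨U, hUo, hU, (hlt.trans ENNReal.ofReal_lt_top).ne, ?_⟩
  exact ENNReal.toReal_le_of_le_ofReal (by positivity) hlt.le

theorem lmax_le_tsum {n : ℕ} {ρ : ℕ → ℝ → ℝ} {ν : Measure ℝ} (hn : 1 ≤ n)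
    (h : IsCantorSequence n ρ) (hν : IsCantorMeasure n ρ ν) {f : ℝ → ℝ} {U : ℕ → Set ℝ}
    (hUo : ∀ i, IsOpen (U i)) (hfin : ∀ i, volume (U i) ≠ ∞)
    (hU : ∀ i, {z | (2 : ℝ) ^ i ≤ |f z|} ⊆ U i) {x : ℝ} (hx : x ∈ Ico (0 : ℝ) 1) :
    lmax ν (fun z => ENNReal.ofReal |f z|) x ≤
      (1 + ∑' i, ENNReal.ofReal (2 ^ (i + 1)) * volume (U i)) +
        ∑' q : ℕ × ℕ × ℕ, (hull ρ (U q.1) q.2.1 q.2.2).indicator (fun _ =>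
          ENNReal.ofReal (2 ^ (q.1 + 1)) * ENNReal.ofReal (2 * ((2 : ℝ) ^ q.2.2)⁻¹)) x := by
  have hone : ∀ i, Measurable ((U i).indicator (1 : ℝ → ℝ≥0∞)) := fun i =>
    measurable_one.indicator (hUo i).measurableSet
  have hadd : lmax ν (fun z => ENNReal.ofReal |f z|) x ≤
      1 + lmax ν (fun z => ∑' i, ENNReal.ofReal (2 ^ (i + 1)) * (U i).indicator 1 z) x := by
    refine (lmax_mono (le_one_add_tsum_indicator hU) x).trans (iSup_le fun r => ?_)
    beta_reduce
    rw [lintegral_add_left measurable_const, lintegral_const, hν.univ_eq, one_mul]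
    gcongr
    exact le_iSup (fun r : Icc (1 : ℝ) 2 => ∫⁻ y, (fun z => ∑' i,
      ENNReal.ofReal (2 ^ (i + 1)) * (U i).indicator 1 z) (x + r * y) ∂ν) r
  refine hadd.trans ?_
  rw [add_assoc]
  gcongr
  refine (lmax_tsum_le (F := fun i z => ENNReal.ofReal (2 ^ (i + 1)) * (U i).indicator 1 z)
    (fun i => (hone i).const_mul _) x).trans ?_
  rw [ENNReal.tsum_prod (f := fun i (q : ℕ × ℕ) => (hull ρ (U i) q.1 q.2).indicator (fun _ =>
    ENNReal.ofReal (2 ^ (i + 1)) * ENNReal.ofReal (2 * ((2 : ℝ) ^ q.2)⁻¹)) x), ← ENNReal.tsum_add]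
  refine ENNReal.tsum_le_tsum fun i => ?_
  rw [lmax_const_mul (hone i)]
  refine (mul_le_mul_right (hν.lmax_indicator_le hn h (hUo i) (hfin i) hx) _).trans ?_
  rw [mul_add, ← ENNReal.tsum_mul_left]
  gcongr with q
  by_cases hq : x ∈ hull ρ (U i) q.1 q.2
  · rw [indicator_of_mem hq, indicator_of_mem hq]
  · rw [indicator_of_notMem hq, mul_zero]
    exact bot_le

theorem IsCantorSequence.exists_lintegral_lmax_le {n : ℕ} {ρ : ℕ → ℝ → ℝ} {ν : Measure ℝ}
    (hn : 4 ≤ n)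
    (h : IsCantorSequence n ρ) (hν : IsCantorMeasure n ρ ν) {p : ℝ}
    (hp : (n : ℝ) < p * (n - 1)) :
    ∃ C : ℝ≥0∞, C ≠ ∞ ∧ ∀ f : ℝ → ℝ, Measurable f → ∫⁻ z, ENNReal.ofReal |f z| ^ p ≤ 1 →
      ∫⁻ x in Ico (0 : ℝ) 1, lmax ν (fun z => ENNReal.ofReal |f z|) x ^ (p * (n - 1)) ≤ C := by
  have hn4 : (4 : ℝ) ≤ n := by exact_mod_cast hn
  set q : ℝ := p * (n - 1) with hq
  have hp1 : 1 < p := by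
    by_contra! hle
    nlinarith
  have hq0 : 0 < q := by linarith
  set κ : ℝ := min (1 / n) ((q - n) / 4) with hκ
  have hκ0 : 0 < κ := lt_min (by positivity) (by linarith)
  have hκ1 : κ ≤ 1 / n := min_le_left _ _
  have hκ2 : κ ≤ (q - n) / 4 := min_le_right _ _
  obtain ⟨C, hC, hweak⟩ := h.weak_type hn hκ0 hκ1
  set e : ℝ := (n : ℝ) - 1 + κ with he
  have he0 : 0 ≤ e := by linarith
  set m : ℝ := n + 2 * κ with hm
  set a : ℝ := 2 ^ (1 - p * e / q) with ha
  set b : ℝ := 2 ^ (-(κ / (4 * q))) with hb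
  set c : ℝ := 2 ^ (m / q - 1) with hc
  have ha1 : a < 1 := by
    refine Real.rpow_lt_one_of_one_lt_of_neg (by norm_num) ?_
    rw [sub_neg, lt_div_iff₀ hq0, he, hq]
    nlinarith
  have hb1 : b < 1 := Real.rpow_lt_one_of_one_lt_of_neg (by norm_num) (by
    have : 0 < κ / (4 * q) := by positivity
    linarith)
  have hc1 : c < 1 := by
    refine Real.rpow_lt_one_of_one_lt_of_neg (by norm_num) ?_
    rw [sub_neg, div_lt_one hq0, hm]
    linarith
  set T := ∑' t : ℕ × ℕ × ℕ, ENNReal.ofReal (C ^ (1 / q) * 2 ^ (2 + e / q) *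
    (a ^ t.1 * (b ^ t.2.1 * c ^ t.2.2))) with hT
  have hTfin : T ≠ ∞ := tsum_ofReal_geometric_ne_top (by positivity) ha1 (by positivity) hb1
    (by positivity) hc1
  set g : ℝ := 2 ^ (1 - p) with hg
  have hg1 : g < 1 := Real.rpow_lt_one_of_one_lt_of_neg (by norm_num) (by linarith)
  set D : ℝ≥0∞ := 1 + ∑' i : ℕ, ENNReal.ofReal (4 * g ^ i) with hD
  have hDfin : D ≠ ∞ := ENNReal.add_ne_top.2 ⟨ENNReal.one_ne_top,
    ((summable_geometric_of_lt_one (by positivity) hg1).mul_left 4).tsum_ofReal_ne_top⟩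
  refine ⟨(D + T) ^ q, ENNReal.rpow_ne_top_of_nonneg hq0.le (ENNReal.add_ne_top.2 ⟨hDfin, hTfin⟩),
    fun f hf hf1 => ?_⟩
  choose U hUo hU hfin hvol using exists_isOpen_superlevel hf (by linarith) hf1
  have hD' : 1 + ∑' i, ENNReal.ofReal (2 ^ (i + 1)) * volume (U i) ≤ D := by
    rw [hD]
    gcongr with i
    rw [← ENNReal.ofReal_toReal (hfin i), ← ENNReal.ofReal_mul (by positivity)]
    refine ENNReal.ofReal_le_ofReal ?_
    calc (2 : ℝ) ^ (i + 1) * (volume (U i)).toReal ≤ 2 ^ (i + 1) * (2 * 2 ^ (-(i * p))) := by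
          gcongr
          exact hvol i
      _ = 4 * (2 ^ (i : ℝ) * 2 ^ (-(i * p))) := by rw [Real.rpow_natCast]; ring
      _ = _ := by
          rw [hg, ← Real.rpow_mul_natCast (by norm_num), ← Real.rpow_add (by norm_num)]
          congr 2
          ring
  set F : ℕ × ℕ × ℕ → ℝ → ℝ≥0∞ := fun t => (hull ρ (U t.1) t.2.1 t.2.2).indicator (fun _ =>
    ENNReal.ofReal (2 ^ (t.1 + 1)) * ENNReal.ofReal (2 * ((2 : ℝ) ^ t.2.2)⁻¹)) with hF
  have hFm : ∀ t, Measurable (F t) := fun t =>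
    measurable_const.indicator (measurableSet_hull ρ (U t.1) t.2.1 t.2.2)
  have hterm : ∀ t, (∫⁻ x in Ico (0 : ℝ) 1, F t x ^ q) ^ (1 / q) ≤
      ENNReal.ofReal (C ^ (1 / q) * 2 ^ (2 + e / q) * (a ^ t.1 * (b ^ t.2.1 * c ^ t.2.2))) := by
    rintro ⟨i, k, j⟩
    refine le_trans ?_ (ENNReal.ofReal_le_ofReal (dyadic_term_le hC hq0 he0
      (measureReal_nonneg (μ := volume) (s := U i)) (hvol i)))
    have h1 : ∫⁻ x in Ico (0 : ℝ) 1, F (i, k, j) x ^ q ≤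
        ENNReal.ofReal (2 ^ (i + 1) * (2 * ((2 : ℝ) ^ j)⁻¹)) ^ q * volume (hull ρ (U i) k j) := by
      refine (setLIntegral_le_lintegral _ _).trans ?_
      rw [← setLIntegral_const, ← lintegral_indicator (measurableSet_hull ρ (U i) k j)]
      refine lintegral_mono fun x => ?_
      simp only [hF]
      by_cases hx : x ∈ hull ρ (U i) k j
      · rw [indicator_of_mem hx, indicator_of_mem hx, ← ENNReal.ofReal_mul (by positivity)]
      · rw [indicator_of_notMem hx, ENNReal.zero_rpow_of_pos hq0]
        exact bot_le
    have h2 : volume (hull ρ (U i) k j) ≤ ENNReal.ofReal (C * (2 : ℝ) ^ (-(κ * k / 4)) *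
        ((2 : ℝ) ^ j)⁻¹ ^ (-m) * volume.real (U i) ^ e) := by
      rw [hull, measure_toMeasurable]
      exact hweak k (U i) _ (hfin i) (by positivity)
    calc _ ≤ (ENNReal.ofReal (2 ^ (i + 1) * (2 * ((2 : ℝ) ^ j)⁻¹)) ^ q *
          ENNReal.ofReal (C * (2 : ℝ) ^ (-(κ * k / 4)) *
            ((2 : ℝ) ^ j)⁻¹ ^ (-m) * volume.real (U i) ^ e)) ^ (1 / q) :=
          ENNReal.rpow_le_rpow (h1.trans (mul_le_mul_right h2 _)) (by positivity)
      _ = _ := by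
          rw [ENNReal.mul_rpow_of_nonneg _ _ (by positivity), ← ENNReal.rpow_mul,
            mul_one_div_cancel hq0.ne', ENNReal.rpow_one,
            ENNReal.ofReal_rpow_of_nonneg _ (by positivity),
            ← ENNReal.ofReal_mul (by positivity)]
          positivity
  have hmain : (∫⁻ x in Ico (0 : ℝ) 1, (D + ∑' t, F t x) ^ q) ^ (1 / q) ≤ D + T := by
    refine (ENNReal.lintegral_Lp_add_le aemeasurable_const
      (Measurable.tsum hFm).aemeasurable (by linarith)).trans ?_
    refine add_le_add ?_ ((lintegral_tsum_rpow_le (by linarith)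
      fun t => (hFm t).aemeasurable).trans (ENNReal.tsum_le_tsum hterm))
    simp only [lintegral_const, Measure.restrict_apply_univ, Real.volume_Ico, sub_zero,
      ENNReal.ofReal_one, mul_one]
    rw [← ENNReal.rpow_mul, mul_one_div_cancel hq0.ne', ENNReal.rpow_one]
  have hmain' : ∫⁻ x in Ico (0 : ℝ) 1, (D + ∑' t, F t x) ^ q ≤ (D + T) ^ q := by
    have := ENNReal.rpow_le_rpow hmain hq0.le
    rwa [← ENNReal.rpow_mul, one_div_mul_cancel hq0.ne', ENNReal.rpow_one] at this
  refine le_trans (setLIntegral_mono' measurableSet_Ico fun x hx => ?_) hmain'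
  refine ENNReal.rpow_le_rpow ?_ hq0.le
  exact (lmax_le_tsum (by omega) h hν hUo hfin hU hx).trans (add_le_add hD' le_rfl)

theorem lintegral_lmax_rpow_le {ν : Measure ℝ} {p q q' : ℝ} {C : ℝ≥0∞} (hp : 0 < p) (hq : 0 < q)
    (hqq : q ≤ q') (hC : C ≠ ∞)
    (h : ∀ f : ℝ → ℝ, Measurable f → ∫⁻ z, ENNReal.ofReal |f z| ^ p ≤ 1 →
      ∫⁻ x in Ico (0 : ℝ) 1, lmax ν (fun z => ENNReal.ofReal |f z|) x ^ q' ≤ C)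
    {f : ℝ → ℝ} (hf : Measurable f) :
    ∫⁻ x in Ico (0 : ℝ) 1, lmax ν (fun z => ENNReal.ofReal |f z|) x ^ q ≤
      (1 + C) * (∫⁻ z, ENNReal.ofReal |f z| ^ p) ^ (q / p) := by
  set X := ∫⁻ x in Ico (0 : ℝ) 1, lmax ν (fun z => ENNReal.ofReal |f z|) x ^ q with hX
  set I := ∫⁻ z, ENNReal.ofReal |f z| ^ p with hI
  have hqp : 0 < q / p := by positivity
  by_cases hIt : I = ∞
  · rw [hIt, ENNReal.top_rpow_of_pos hqp, ENNReal.mul_top (by simp)]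
    exact le_top
  have hmf : Measurable fun z => ENNReal.ofReal |f z| := hf.abs.ennreal_ofReal
  have key : ∀ u : ℝ, 0 < u → I ≤ ENNReal.ofReal u →
      X ≤ (1 + C) * ENNReal.ofReal u ^ (q / p) := by
    intro u hu hIu
    set t : ℝ := u ^ (-(1 / p)) with ht
    have ht0 : 0 < t := by positivity
    have e0 : ∀ z, ENNReal.ofReal |t * f z| = ENNReal.ofReal t * ENNReal.ofReal |f z| := by
      intro z
      rw [abs_mul, abs_of_pos ht0, ENNReal.ofReal_mul ht0.le]
    have e1 : ENNReal.ofReal t ^ p * ENNReal.ofReal u = 1 := by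
      rw [ENNReal.ofReal_rpow_of_pos ht0, ← ENNReal.ofReal_mul (by positivity), ht,
        ← Real.rpow_mul hu.le, neg_mul, one_div_mul_cancel hp.ne', Real.rpow_neg_one,
        inv_mul_cancel₀ hu.ne', ENNReal.ofReal_one]
    have e2 : ENNReal.ofReal t ^ q * ENNReal.ofReal u ^ (q / p) = 1 := by
      have := congrArg (· ^ (q / p)) e1
      simp only [ENNReal.one_rpow] at this
      rw [ENNReal.mul_rpow_of_nonneg _ _ hqp.le, ← ENNReal.rpow_mul,
        mul_div_cancel₀ _ hp.ne'] at this
      exact this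
    have h1 := h (fun z => t * f z) (hf.const_mul t) (by
      simp_rw [e0, ENNReal.mul_rpow_of_nonneg _ _ hp.le]
      rw [lintegral_const_mul _ (hmf.pow_const p), ← e1]
      gcongr)
    simp_rw [e0, lmax_const_mul hmf] at h1
    have h2 : ENNReal.ofReal t ^ q * X ≤ 1 + C := by
      rw [hX, ← lintegral_const_mul' _ _
        (ENNReal.rpow_ne_top_of_nonneg hq.le ENNReal.ofReal_ne_top)]
      simp_rw [← ENNReal.mul_rpow_of_nonneg _ _ hq.le]
      calc _ ≤ ∫⁻ x in Ico (0 : ℝ) 1,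
            (1 + (ENNReal.ofReal t * lmax ν (fun z => ENNReal.ofReal |f z|) x) ^ q') := by
            refine lintegral_mono fun x => ?_
            rcases le_total (ENNReal.ofReal t * lmax ν (fun z => ENNReal.ofReal |f z|) x) 1
              with h0 | h0
            · exact (ENNReal.rpow_le_one h0 hq.le).trans le_self_add
            · exact (ENNReal.rpow_le_rpow_of_exponent_le h0 hqq).trans le_add_self
        _ ≤ 1 + C := by
            rw [lintegral_add_left measurable_const]
            gcongr
            simp
    calc X = ENNReal.ofReal t ^ q * X * ENNReal.ofReal u ^ (q / p) := by
          rw [mul_right_comm, e2, one_mul]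
      _ ≤ _ := by gcongr
  have hlim : Filter.Tendsto (fun m : ℕ =>
      (1 + C) * (I + ENNReal.ofReal (1 / ((m : ℝ) + 1))) ^ (q / p))
      Filter.atTop (nhds ((1 + C) * I ^ (q / p))) := by
    refine ENNReal.Tendsto.const_mul ?_ (Or.inr (ENNReal.add_ne_top.2 ⟨ENNReal.one_ne_top, hC⟩))
    refine (ENNReal.continuous_rpow_const.tendsto _).comp ?_
    have h0 := ENNReal.tendsto_ofReal tendsto_one_div_add_atTop_nhds_zero_nat
    rw [ENNReal.ofReal_zero] at h0
    simpa using h0.const_add I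
  refine ge_of_tendsto' hlim fun m => ?_
  have hm : (0 : ℝ) < 1 / ((m : ℝ) + 1) := by positivity
  have := key (I.toReal + 1 / ((m : ℝ) + 1)) (by positivity) (by
    rw [ENNReal.ofReal_add ENNReal.toReal_nonneg hm.le, ENNReal.ofReal_toReal hIt]
    exact le_self_add)
  rwa [ENNReal.ofReal_add ENNReal.toReal_nonneg hm.le, ENNReal.ofReal_toReal hIt] at this

theorem ENNReal.tsum_rpow_le_rpow_tsum {ι : Type*} (a : ι → ℝ≥0∞) {r : ℝ} (hr : 1 ≤ r) :
    ∑' i, a i ^ r ≤ (∑' i, a i) ^ r := by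
  have e : ∀ x : ℝ≥0∞, x ^ r = x * x ^ (r - 1) := by
    intro x
    have := ENNReal.rpow_add_of_nonneg (x := x) 1 (r - 1) zero_le_one (by linarith)
    rwa [ENNReal.rpow_one, add_sub_cancel] at this
  rw [e (∑' i, a i), ← ENNReal.tsum_mul_right]
  refine ENNReal.tsum_le_tsum fun i => ?_
  rw [e]
  exact mul_le_mul_right (ENNReal.rpow_le_rpow (ENNReal.le_tsum i) (by linarith)) _

theorem lintegral_eq_tsum_Ico (F : ℝ → ℝ≥0∞) :
    ∫⁻ x, F x = ∑' i : ℤ, ∫⁻ x in Ico (i : ℝ) (i + 1), F x := by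
  rw [← lintegral_iUnion (fun i => measurableSet_Ico) (by
    simpa using pairwise_disjoint_Ico_intCast ℝ), iUnion_Ico_intCast, setLIntegral_univ]

theorem setLIntegral_Ico_add (F : ℝ → ℝ≥0∞) (a b c : ℝ) :
    ∫⁻ x in Ico (c + a) (c + b), F x = ∫⁻ x in Ico a b, F (x + c) := by
  rw [← lintegral_indicator measurableSet_Ico, ← lintegral_indicator measurableSet_Ico,
    ← lintegral_add_right_eq_self _ c]
  congr 1
  ext x
  by_cases hx : x ∈ Ico a b
  · have hx' : x + c ∈ Ico (c + a) (c + b) := ⟨by linarith [hx.1], by linarith [hx.2]⟩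
    rw [indicator_of_mem hx, indicator_of_mem hx']
  · rw [indicator_of_notMem hx, indicator_of_notMem]
    exact fun h => hx ⟨by linarith [h.1], by linarith [h.2]⟩

theorem tsum_setLIntegral_Ico_six (F : ℝ → ℝ≥0∞) :
    ∑' i : ℤ, ∫⁻ x in Ico (i : ℝ) (i + 6), F x = 6 * ∫⁻ x, F x := by
  have e : ∀ i : ℤ, ∫⁻ x in Ico (i : ℝ) (i + 6), F x =
      ∑ l ∈ Finset.range 6, ∫⁻ x in Ico (((i + l : ℤ) : ℝ)) (((i + l : ℤ) : ℝ) + 1), F x := by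
    intro i
    have : ∀ m : ℕ, ∫⁻ x in Ico (i : ℝ) (i + m), F x =
        ∑ l ∈ Finset.range m, ∫⁻ x in Ico (((i + l : ℤ) : ℝ)) (((i + l : ℤ) : ℝ) + 1), F x := by
      intro m
      induction m with
      | zero => simp
      | succ m ih =>
        rw [Finset.sum_range_succ, ← ih, ← lintegral_union measurableSet_Ico]
        · push_cast
          rw [Ico_union_Ico_eq_Ico (by simp) (by simp), add_assoc]
        · push_cast
          exact Ico_disjoint_Ico_same
    exact_mod_cast this 6
  simp_rw [e]
  rw [Summable.tsum_finsetSum fun _ _ => ENNReal.summable]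
  have e2 : ∀ l : ℕ, ∑' i : ℤ, ∫⁻ x in Ico (((i + l : ℤ) : ℝ)) (((i + l : ℤ) : ℝ) + 1), F x =
      ∫⁻ x, F x := by
    intro l
    rw [lintegral_eq_tsum_Ico F]
    exact (Equiv.addRight (l : ℤ)).tsum_eq fun i : ℤ => ∫⁻ x in Ico (i : ℝ) (i + 1), F x
  simp_rw [e2]
  simp

theorem lmax_add_right (ν : Measure ℝ) (F : ℝ → ℝ≥0∞) (x c : ℝ) :
    lmax ν F (x + c) = lmax ν (fun z => F (z + c)) x := by
  unfold lmax
  simp_rw [add_right_comm]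

theorem lmax_congr_of_Ico {ν : Measure ℝ} (hν : ν (Icc 1 2)ᶜ = 0) {F G : ℝ → ℝ≥0∞}
    (h : ∀ z ∈ Ico (0 : ℝ) 6, F z = G z) {x : ℝ} (hx : x ∈ Ico (0 : ℝ) 1) :
    lmax ν F x = lmax ν G x := by
  refine iSup_congr fun ⟨r, hr⟩ => lintegral_congr_ae ?_
  have : ∀ᵐ y ∂ν, y ∈ Icc (1 : ℝ) 2 := hν
  filter_upwards [this] with y hy
  refine h _ ⟨?_, ?_⟩
  · have := mul_nonneg (by linarith [hr.1] : 0 ≤ r) (by linarith [hy.1] : 0 ≤ y)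
    linarith [hx.1]
  · nlinarith [hx.2, hr.1, hr.2, hy.1, hy.2]

theorem lintegral_lmax_rpow_le_global {ν : Measure ℝ} (hν : ν (Icc 1 2)ᶜ = 0) {p q : ℝ} {K : ℝ≥0∞}
    (hp : 0 < p) (hpq : p ≤ q)
    (h : ∀ f : ℝ → ℝ, Measurable f →
      ∫⁻ x in Ico (0 : ℝ) 1, lmax ν (fun z => ENNReal.ofReal |f z|) x ^ q ≤
        K * (∫⁻ z, ENNReal.ofReal |f z| ^ p) ^ (q / p))
    {f : ℝ → ℝ} (hf : Measurable f) :
    ∫⁻ x, lmax ν (fun z => ENNReal.ofReal |f z|) x ^ q ≤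
      K * (6 * ∫⁻ z, ENNReal.ofReal |f z| ^ p) ^ (q / p) := by
  rw [lintegral_eq_tsum_Ico, ← tsum_setLIntegral_Ico_six]
  have hterm : ∀ i : ℤ, ∫⁻ x in Ico (i : ℝ) (i + 1), lmax ν (fun z => ENNReal.ofReal |f z|) x ^ q ≤
      K * (∫⁻ z in Ico (i : ℝ) (i + 6), ENNReal.ofReal |f z| ^ p) ^ (q / p) := by
    intro i
    have h1 := setLIntegral_Ico_add (fun x => lmax ν (fun z => ENNReal.ofReal |f z|) x ^ q) 0 1 i
    have h2 := setLIntegral_Ico_add (fun z => ENNReal.ofReal |f z| ^ p) 0 6 i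
    rw [add_zero] at h1 h2
    rw [h1, h2]
    have hg : Measurable ((Ico (0 : ℝ) 6).indicator fun z => f (z + i)) :=
      (hf.comp (measurable_id.add_const _)).indicator measurableSet_Ico
    refine le_trans (le_of_eq ?_) ((h _ hg).trans (le_of_eq ?_))
    · refine setLIntegral_congr_fun measurableSet_Ico fun x hx => ?_
      rw [lmax_add_right]
      congr 1
      refine lmax_congr_of_Ico hν (fun z hz => ?_) hx
      rw [indicator_of_mem hz]
    · rw [← lintegral_indicator measurableSet_Ico]
      congr 3
      ext z
      by_cases hz : z ∈ Ico (0 : ℝ) 6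
      · rw [indicator_of_mem hz, indicator_of_mem hz]
      · rw [indicator_of_notMem hz, indicator_of_notMem hz, abs_zero, ENNReal.ofReal_zero,
          ENNReal.zero_rpow_of_pos hp]
  refine (ENNReal.tsum_le_tsum hterm).trans ?_
  rw [ENNReal.tsum_mul_left]
  gcongr
  exact ENNReal.tsum_rpow_le_rpow_tsum _ ((one_le_div hp).2 hpq)

theorem restrictedMax_nonneg (ν : Measure ℝ) (f : ℝ → ℝ) (x : ℝ) : 0 ≤ restrictedMax ν f x :=
  Real.iSup_nonneg fun _ => integral_nonneg fun _ => abs_nonneg _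

theorem ofReal_restrictedMax_le_lmax {ν : Measure ℝ} {f : ℝ → ℝ} (hf : Measurable f) (x : ℝ) :
    ENNReal.ofReal (restrictedMax ν f x) ≤ lmax ν (fun z => ENNReal.ofReal |f z|) x := by
  by_cases htop : lmax ν (fun z => ENNReal.ofReal |f z|) x = ∞
  · rw [htop]; exact le_top
  rw [← ENNReal.ofReal_toReal htop]
  refine ENNReal.ofReal_le_ofReal (Real.iSup_le (fun r => ?_) ENNReal.toReal_nonneg)
  have hm : Measurable fun y => |f (x + (r : ℝ) * y)| :=
    (hf.comp (by fun_prop : Measurable fun y : ℝ => x + (r : ℝ) * y)).abs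
  rw [integral_eq_lintegral_of_nonneg_ae (ae_of_all _ fun _ => abs_nonneg _)
    hm.aestronglyMeasurable]
  exact ENNReal.toReal_mono htop
    (le_iSup (fun r : Icc (1 : ℝ) 2 => ∫⁻ y, ENNReal.ofReal |f (x + r * y)| ∂ν) r)

theorem eLpNorm_ofReal_eq {f : ℝ → ℝ} {p : ℝ} (hp : 0 < p) :
    eLpNorm f (ENNReal.ofReal p) volume = (∫⁻ z, ENNReal.ofReal |f z| ^ p) ^ (1 / p) := by
  rw [eLpNorm_eq_lintegral_rpow_enorm_toReal (ENNReal.ofReal_pos.2 hp).ne' ENNReal.ofReal_ne_top,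
    ENNReal.toReal_ofReal hp.le]
  simp_rw [Real.enorm_eq_ofReal_abs]

theorem IsCantorMeasure.boundedLpLq {n : ℕ} {ρ : ℕ → ℝ → ℝ} {ν : Measure ℝ} (hn : 4 ≤ n)
    (h : IsCantorSequence n ρ) (hν : IsCantorMeasure n ρ ν) {p q : ℝ}
    (hp : (n : ℝ) < p * (n - 1)) (hpq : p ≤ q) (hq : q ≤ p * (n - 1)) :
    BoundedLpLq ν p (ENNReal.ofReal q) := by
  have hn4 : (4 : ℝ) ≤ n := by exact_mod_cast hn
  have hp0 : 0 < p := by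
    by_contra! hle
    nlinarith
  have hq0 : 0 < q := by linarith
  obtain ⟨C, hC, hloc⟩ := h.exists_lintegral_lmax_le hn hν hp
  have hglob : ∀ f : ℝ → ℝ, Measurable f → _ := fun f hf =>
    lintegral_lmax_rpow_le_global hν.compl_eq hp0 hpq
      (fun f hf => lintegral_lmax_rpow_le hp0 hq0 hq hC hloc hf) hf
  set K : ℝ≥0∞ := (1 + C) ^ (1 / q) * 6 ^ (1 / p) with hK
  have hKt : K ≠ ∞ := ENNReal.mul_ne_top
    (ENNReal.rpow_ne_top_of_nonneg (by positivity) (ENNReal.add_ne_top.2 ⟨ENNReal.one_ne_top, hC⟩))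
    (ENNReal.rpow_ne_top_of_nonneg (by positivity) (by norm_num))
  refine ⟨K.toReal, ENNReal.toReal_nonneg, fun f hf => ?_⟩
  rw [ENNReal.ofReal_toReal hKt, eLpNorm_ofReal_eq hq0, eLpNorm_ofReal_eq hp0]
  calc (∫⁻ z, ENNReal.ofReal |restrictedMax ν f z| ^ q) ^ (1 / q)
      ≤ ((1 + C) * (6 * ∫⁻ z, ENNReal.ofReal |f z| ^ p) ^ (q / p)) ^ (1 / q) := by
        refine ENNReal.rpow_le_rpow (le_trans (lintegral_mono fun z => ?_) (hglob f hf))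
          (by positivity)
        refine ENNReal.rpow_le_rpow ?_ hq0.le
        rw [abs_of_nonneg (restrictedMax_nonneg ν f z)]
        exact ofReal_restrictedMax_le_lmax hf z
    _ = _ := by
        rw [ENNReal.mul_rpow_of_nonneg _ _ (by positivity), ← ENNReal.rpow_mul,
          show q / p * (1 / q) = 1 / p by field_simp,
          ENNReal.mul_rpow_of_nonneg _ _ (by positivity),
          hK, mul_assoc]

theorem le_restrictedMax_indicator {ν : Measure ℝ} [IsProbabilityMeasure ν] {y₀ η x : ℝ}
    (hy : 0 < y₀) (hη : 0 ≤ η) (hx : x ∈ Icc (-(2 * y₀)) (-y₀)) :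
    ν.real (Icc (y₀ - η) (y₀ + η)) ≤
      restrictedMax ν ((Icc (-(2 * η)) (2 * η)).indicator fun _ => 1) x := by
  set f : ℝ → ℝ := (Icc (-(2 * η)) (2 * η)).indicator fun _ => 1 with hf
  have hfm : Measurable f := measurable_const.indicator measurableSet_Icc
  have hf1 : ∀ z, |f z| ≤ 1 := by
    intro z
    rw [hf]
    by_cases hz : z ∈ Icc (-(2 * η)) (2 * η)
    · simp [indicator_of_mem hz]
    · simp [indicator_of_notMem hz]
  have hint : ∀ r : ℝ, Integrable (fun y => |f (x + r * y)|) ν := by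
    intro r
    refine Integrable.of_bound (hfm.comp
      (by fun_prop : Measurable fun y : ℝ => x + r * y)).abs.aestronglyMeasurable 1
      (ae_of_all _ fun y => ?_)
    simpa using hf1 (x + r * y)
  have hbdd : BddAbove (range fun r : Icc (1 : ℝ) 2 => ∫ y, |f (x + (r : ℝ) * y)| ∂ν) := by
    refine ⟨1, ?_⟩
    rintro _ ⟨r, rfl⟩
    calc ∫ y, |f (x + (r : ℝ) * y)| ∂ν ≤ ∫ _y, (1 : ℝ) ∂ν :=
          integral_mono (hint r) (integrable_const _) fun y => hf1 _
      _ = 1 := by simp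
  have hr : -x / y₀ ∈ Icc (1 : ℝ) 2 := by
    rw [mem_Icc, le_div_iff₀ hy, div_le_iff₀ hy]
    constructor <;> linarith [hx.1, hx.2]
  refine le_trans ?_ (le_ciSup hbdd ⟨-x / y₀, hr⟩)
  calc ν.real (Icc (y₀ - η) (y₀ + η)) = ∫ y, (Icc (y₀ - η) (y₀ + η)).indicator 1 y ∂ν :=
        (integral_indicator_one measurableSet_Icc).symm
    _ ≤ _ := by
        refine integral_mono ((integrable_const (1 : ℝ)).indicator measurableSet_Icc)
          (hint _) fun y => ?_
        by_cases hy' : y ∈ Icc (y₀ - η) (y₀ + η)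
        · have hmem : x + -x / y₀ * y ∈ Icc (-(2 * η)) (2 * η) := by
            have e : x + -x / y₀ * y = -x / y₀ * (y - y₀) := by field_simp; ring
            rw [e]
            constructor <;> nlinarith [hr.1, hr.2, hy'.1, hy'.2]
          simp [hf, indicator_of_mem hy', indicator_of_mem hmem]
        · rw [indicator_of_notMem hy']
          exact abs_nonneg _

theorem not_boundedLpLq {ν : Measure ℝ} [IsProbabilityMeasure ν] (hν : ν (Icc 1 2)ᶜ = 0) {s : ℝ}
    (hs : 0 < s) (hreg : IsAhlforsRegular ν s) {p : ℝ} (hp : 1 ≤ p) (hps : p < 1 / s) {q : ℝ≥0∞}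
    (hq : 1 ≤ q) : ¬ BoundedLpLq ν p q := by
  rintro ⟨C, hC, hbound⟩
  obtain ⟨c, hc, hreg⟩ := hreg
  obtain ⟨y₀, hy₀⟩ := msupport_nonempty (ν := ν) (by simp)
  have hy1 : 1 ≤ y₀ := (msupport_subset isClosed_Icc hν hy₀).1
  have hp0 : 0 < p := by linarith
  have hc0 : 0 < c := by linarith
  have hd : 0 < 1 / p - s := by
    rw [sub_pos, lt_div_iff₀ hp0]
    rwa [lt_div_iff₀ hs, mul_comm] at hps
  have key : ∀ η : ℝ, 0 < η → η ≤ 1 → c⁻¹ ≤ C * 4 ^ (1 / p) * η ^ (1 / p - s) := by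
    intro η h0 h1
    have hlow := (hreg y₀ hy₀ η h0 h1).1
    rw [← ENNReal.ofReal_toReal (measure_ne_top ν (Icc (y₀ - η) (y₀ + η))),
      ENNReal.ofReal_le_ofReal_iff ENNReal.toReal_nonneg] at hlow
    set f : ℝ → ℝ := (Icc (-(2 * η)) (2 * η)).indicator fun _ => 1 with hf
    have hE : (1 : ℝ≥0∞) ≤ volume (Icc (-(2 * y₀)) (-y₀)) := by
      rw [Real.volume_Icc, ← ENNReal.ofReal_one]
      exact ENNReal.ofReal_le_ofReal (by linarith)
    have h2 : ENNReal.ofReal (c⁻¹ * η ^ s) ≤ eLpNorm (restrictedMax ν f) q volume := by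
      calc ENNReal.ofReal (c⁻¹ * η ^ s) ≤
            eLpNorm ((Icc (-(2 * y₀)) (-y₀)).indicator fun _ => c⁻¹ * η ^ s) q volume := by
            rw [eLpNorm_indicator_const' measurableSet_Icc (zero_lt_one.trans_le hE).ne'
              (zero_lt_one.trans_le hq).ne', Real.enorm_of_nonneg (by positivity)]
            refine le_mul_of_one_le_right bot_le ?_
            rw [← ENNReal.one_rpow (1 / q.toReal)]
            exact ENNReal.rpow_le_rpow hE (by positivity)
        _ ≤ _ := by
            refine eLpNorm_mono fun x => ?_
            rw [Real.norm_of_nonneg (restrictedMax_nonneg ν f x)]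
            by_cases hx : x ∈ Icc (-(2 * y₀)) (-y₀)
            · rw [indicator_of_mem hx, Real.norm_of_nonneg (by positivity)]
              exact hlow.trans (le_restrictedMax_indicator (by linarith) h0.le hx)
            · rw [indicator_of_notMem hx, norm_zero]
              exact restrictedMax_nonneg ν f x
    have h3 := h2.trans (hbound f (measurable_const.indicator measurableSet_Icc))
    have hvol : volume (Icc (-(2 * η)) (2 * η)) = ENNReal.ofReal (4 * η) := by
      rw [Real.volume_Icc]
      congr 1
      ring
    rw [hf, eLpNorm_indicator_const measurableSet_Icc (ENNReal.ofReal_pos.2 hp0).ne'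
      ENNReal.ofReal_ne_top, ENNReal.toReal_ofReal hp0.le, hvol, enorm_one, one_mul,
      ENNReal.ofReal_rpow_of_nonneg (by positivity) (by positivity),
      ← ENNReal.ofReal_mul hC, ENNReal.ofReal_le_ofReal_iff (by positivity),
      Real.mul_rpow (by norm_num) h0.le] at h3
    rw [Real.rpow_sub h0]
    calc c⁻¹ = c⁻¹ * η ^ s / η ^ s := by field_simp
      _ ≤ C * (4 ^ (1 / p) * η ^ (1 / p)) / η ^ s := by gcongr
      _ = _ := by ring
  have hlim : Filter.Tendsto (fun m : ℕ => C * 4 ^ (1 / p) * (1 / ((m : ℝ) + 1)) ^ (1 / p - s))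
      Filter.atTop (nhds (C * 4 ^ (1 / p) * (0 : ℝ) ^ (1 / p - s))) :=
    ((Real.continuousAt_rpow_const 0 _ (Or.inr hd.le)).tendsto.comp
      tendsto_one_div_add_atTop_nhds_zero_nat).const_mul _
  rw [Real.zero_rpow hd.ne', mul_zero] at hlim
  have := ge_of_tendsto' hlim fun m => key (1 / ((m : ℝ) + 1)) (by positivity) (by
    rw [div_le_one (by positivity)]
    linarith [Nat.cast_nonneg (α := ℝ) m])
  linarith [inv_pos.2 hc0]

theorem stmt3 (d' : ℕ) (hd' : 2 ≤ d') (s : ℝ) (hs : s = 1 - 1 / (2 * (d' : ℝ))) :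
    ∃ (A : Set ℝ) (ν : Measure ℝ), IsCompact A ∧ A ⊆ Icc 1 2 ∧
      IsProbabilityMeasure ν ∧ msupport ν = A ∧ IsAhlforsRegular ν s ∧
      (∀ p q : ℝ, 1 / s < p → p ≤ q → q ≤ p * s / (1 - s) →
        BoundedLpLq ν p (ENNReal.ofReal q)) ∧
      (∀ p : ℝ, 1 ≤ p → p < 1 / s → ∀ q : ℝ≥0∞, 1 ≤ q → ¬ BoundedLpLq ν p q) := by
  have hn : 4 ≤ 2 * d' := by omega
  have hd4 : (4 : ℝ) ≤ 2 * d' := by exact_mod_cast hn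
  have hs' : s = 1 - 1 / ((2 * d' : ℕ) : ℝ) := by rw [hs]; push_cast; rfl
  have hs0 : 0 < s := by
    have : 1 / (2 * (d' : ℝ)) ≤ 1 / 4 := by gcongr
    rw [hs]; linarith
  obtain ⟨ρ, h⟩ := exists_isCantorSequence hn
  obtain ⟨ν, hν⟩ := h.exists_isCantorMeasure (by omega)
  have hprob : IsProbabilityMeasure ν := ⟨hν.univ_eq⟩
  have hreg : IsAhlforsRegular ν s := by
    rw [hs']
    exact hν.isAhlforsRegular (by omega) h
  have hsub := msupport_subset isClosed_Icc hν.compl_eq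
  refine ⟨msupport ν, ν, isCompact_Icc.of_isClosed_subset (isClosed_msupport ν) hsub, hsub, hprob,
    rfl, hreg, fun p q hp hpq hq => ?_, fun p hp hps q hq =>
      not_boundedLpLq hν.compl_eq hs0 hreg hp hps hq⟩
  have e : p * s / (1 - s) = p * (2 * d' - 1) := by
    rw [hs]; field_simp; ring
  refine hν.boundedLpLq hn h ?_ hpq ?_
  · rw [div_lt_iff₀ hs0, hs] at hp
    push_cast
    have := mul_lt_mul_of_pos_right hp (by linarith : (0 : ℝ) < 2 * d')
    field_simp at this
    linarith
  · push_cast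
    linarith
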